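/- arXiv:1010.0321 — 3 statements merged into one kernel-verified Lean document; each statement's English description precedes it below -/
import Mathlib

section
/- The braid group on n strands is isomorphic to the fundamental group of the unordered configuration space of n points in the complex plane. Precisely: for n ≥ 1, let M_n = {(z_1,…,z_n) ∈ ℂ^n : z_i ≠ z_j for all i ≠ j} with the subspace topology, and let N_n = M_n/Σ_n be the quotient by the action of the symmetric group Σ_n permuting coordinates. Then, for any base point of N_n, the fundamental group π_1(N_n) is isomorphic as a group to the presented group ⟨σ_1,…,σ_{n-1} | σ_iσ_j = σ_jσ_i for |i−j| > 1, σ_iσ_jσ_i = σ_jσ_iσ_j for |i−j| = 1⟩. -/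
/-- The set of Artin braid relations in the free group on `n - 1` generators:
`σᵢσⱼ = σⱼσᵢ` for `|i - j| > 1` and `σᵢσⱼσᵢ = σⱼσᵢσⱼ` for `|i - j| = 1`. -/
def braidRels (n : ℕ) : Set (FreeGroup (Fin (n - 1))) :=
  { r | (∃ i j : Fin (n - 1), (i : ℕ) + 1 < (j : ℕ) ∧
          r = FreeGroup.of i * FreeGroup.of j * (FreeGroup.of j * FreeGroup.of i)⁻¹) ∨
        (∃ i j : Fin (n - 1), (j : ℕ) = (i : ℕ) + 1 ∧
          r = FreeGroup.of i * FreeGroup.of j * FreeGroup.of i *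
              (FreeGroup.of j * FreeGroup.of i * FreeGroup.of j)⁻¹) }

/-- The braid group on `n` strands, via the Artin presentation. -/
abbrev BraidGroup (n : ℕ) : Type := PresentedGroup (braidRels n)

/-- The standard Artin generator `σᵢ` (`0`-indexed: `i = 0, …, n - 2`). -/
def braidGen (n : ℕ) (i : Fin (n - 1)) : BraidGroup n := PresentedGroup.of i

/-- The ordered configuration space `Mₙ` of `n` points in `ℂ`: injective tuples
`Fin n → ℂ`, with the subspace topology from `ℂⁿ`. -/
abbrev ConfigSpace (n : ℕ) : Type := {f : Fin n → ℂ // Function.Injective f}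

/-- Two configurations are equivalent if they differ by a permutation of the coordinates. -/
def configSetoid (n : ℕ) : Setoid (ConfigSpace n) where
  r f g := ∃ π : Equiv.Perm (Fin n), (f : Fin n → ℂ) ∘ π = g
  iseqv := by
    refine ⟨fun f => ⟨1, ?_⟩, fun {f g} ⟨π, h⟩ => ⟨π⁻¹, ?_⟩, fun {f g k} ⟨π, h⟩ ⟨τ, h'⟩ => ⟨π * τ, ?_⟩⟩
    · funext x; simp
    · funext x
      have := congrFun h (π⁻¹ x)
      simpa using this.symm
    · funext x
      have := congrFun h (τ x)
      have h'' := congrFun h' x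
      simp only [Function.comp_apply] at this h'' ⊢
      simp [Equiv.Perm.mul_apply, this, h'']

/-- The unordered configuration space `Nₙ = Mₙ/Σₙ`, with the quotient topology. -/
abbrev UConfigSpace (n : ℕ) : Type := Quotient (configSetoid n)


namespace BraidProof
open Topology unitInterval

instance contractible_I : ContractibleSpace I :=
  (convex_Icc (0 : ℝ) 1).contractibleSpace ⟨0, by simp⟩

instance locallyPathConnected_I : LocallyPathConnectedSpace I := by
  have hq : IsQuotientMap (Set.projIcc (0 : ℝ) 1 zero_le_one) := by
    apply IsQuotientMap.of_comp (f := ((↑) : I → ℝ)) continuous_subtype_val continuous_projIcc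
    have : (Set.projIcc (0 : ℝ) 1 zero_le_one ∘ ((↑) : I → ℝ)) = id := by
      funext t; simp
    rw [this]; exact IsQuotientMap.id
  exact hq.locallyPathConnectedSpace

section Monodromy

variable {X ι G : Type} [TopologicalSpace X] [Group G]

/-- A `G`-valued function along `h` which is locally a constant times the local functions `f i`. -/
def Flat (V : ι → Set X) (f : ι → X → G) {A : Type} [TopologicalSpace A] (h : A → X) (g : A → G) :
    Prop :=
  ∀ a i, h a ∈ V i → ∀ᶠ b in 𝓝 a, g b * (f i (h b))⁻¹ = g a * (f i (h a))⁻¹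

variable {V : ι → Set X} {f : ι → X → G}

theorem Flat.comp {A B : Type} [TopologicalSpace A] [TopologicalSpace B] {h : A → X} {g : A → G}
    (hg : Flat V f h g) (k : B → A) (hk : Continuous k) : Flat V f (h ∘ k) (g ∘ k) := by
  intro b i hb
  exact (hk.tendsto b).eventually (hg (k b) i hb)

theorem Flat.unique {A : Type} [TopologicalSpace A] [PreconnectedSpace A] (hc : ∀ x, ∃ i, x ∈ V i)
    {h : A → X} {g g' : A → G} (hg : Flat V f h g) (hg' : Flat V f h g') (a b : A) :
    (g a)⁻¹ * g b = (g' a)⁻¹ * g' b := by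
  have key : g b * (g' b)⁻¹ = g a * (g' a)⁻¹ := by
    refine @PreconnectedSpace.induction₂ A _ _ (fun a b => g b * (g' b)⁻¹ = g a * (g' a)⁻¹)
      ⟨fun a b h1 => h1.symm⟩ ?_ ⟨fun a b c h1 h2 => h2.trans h1⟩ a b
    · intro a
      obtain ⟨i, hi⟩ := hc (h a)
      filter_upwards [hg a i hi, hg' a i hi] with b h1 h2
      have e1 : g b = g a * (f i (h a))⁻¹ * f i (h b) := by rw [← h1]; group
      have e2 : g' b = g' a * (f i (h a))⁻¹ * f i (h b) := by rw [← h2]; group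
      rw [e1, e2]; group
  have : g b = g a * (g' a)⁻¹ * g' b := by rw [← key]; group
  rw [this]; group

theorem Flat.exists {A : Type} [TopologicalSpace A] [SimplyConnectedSpace A]
    [LocallyPathConnectedSpace A] (hV : ∀ i, IsOpen (V i)) (hc : ∀ x, ∃ i, x ∈ V i)
    (loc : ∀ i j x, x ∈ V i → x ∈ V j →
      ∀ᶠ y in 𝓝 x, f i y * (f j y)⁻¹ = f i x * (f j x)⁻¹) (h : C(A, X)) :
    ∃ g : A → G, Flat V f h g := by
  classical
  let _ : TopologicalSpace G := ⊥
  have : DiscreteTopology G := ⟨rfl⟩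
  choose idx hidx using hc
  let Z : FiberBundleCore ι X G :=
    { baseSet := V
      isOpen_baseSet := hV
      indexAt := idx
      mem_baseSet_at := hidx
      coordChange := fun i j x v => v * (f i x * (f j x)⁻¹)
      coordChange_self := by intros; simp
      continuousOn_coordChange := by
        intro i j p hp
        apply ContinuousAt.continuousWithinAt
        have hp1 := hp.1
        have h1 : ∀ᶠ q : X × G in 𝓝 p, f i q.1 * (f j q.1)⁻¹ = f i p.1 * (f j p.1)⁻¹ :=
          continuous_fst.continuousAt.eventually (loc i j p.1 hp1.1 hp1.2)
        have h2 : ∀ᶠ q : X × G in 𝓝 p, q.2 = p.2 :=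
          (continuous_snd.continuousAt (x := p)).eventually (p := fun v => v = p.2)
            (by rw [nhds_discrete]; simp)
        have h3 : (fun q : X × G => q.2 * (f i q.1 * (f j q.1)⁻¹)) =ᶠ[𝓝 p]
            fun _ => p.2 * (f i p.1 * (f j p.1)⁻¹) := by
          filter_upwards [h1, h2] with q a b
          rw [a, b]
        exact continuousAt_const.congr h3.symm
      coordChange_comp := by intros; group }
  have cov : IsCoveringMap (Bundle.TotalSpace.proj : Z.TotalSpace → X) :=
    FiberBundle.isCoveringMap (F := G) (E := Z.Fiber)
  obtain ⟨a₀⟩ : Nonempty A := inferInstance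
  obtain ⟨H, ⟨-, hH⟩, -⟩ := cov.existsUnique_continuousMap_lifts h a₀ (⟨h a₀, (1 : G)⟩) rfl
  have hH' : ∀ a, (H a).proj = h a := fun a => congrFun hH a
  let vv : A → G := fun a => (H a).2
  refine ⟨fun a => vv a * f (idx (h a)) (h a), ?_⟩
  intro a i hai
  have hcont : ContinuousAt (fun b => (Z.localTriv i (H b)).2) a := by
    apply continuous_snd.continuousAt.comp
    apply ContinuousAt.comp _ H.continuous.continuousAt
    apply (Z.localTriv i).continuousAt
    rw [Bundle.Trivialization.mem_source]
    change (H a).proj ∈ V i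
    rw [hH' a]; exact hai
  have hev : ∀ᶠ b in 𝓝 a, (Z.localTriv i (H b)).2 = (Z.localTriv i (H a)).2 :=
    hcont.eventually (p := fun v => v = (Z.localTriv i (H a)).2) (by rw [nhds_discrete]; simp)
  have hform : ∀ b, (Z.localTriv i (H b)).2 = vv b * f (idx (h b)) (h b) * (f i (h b))⁻¹ := by
    intro b
    rw [FiberBundleCore.localTriv_apply]
    change vv b * (f (idx (H b).proj) (H b).proj * (f i (H b).proj)⁻¹) = _
    rw [hH' b]; group
  filter_upwards [hev] with b hb
  rw [hform, hform] at hb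
  exact hb

/-- Holonomy of a path. -/
theorem exists_holonomy (hV : ∀ i, IsOpen (V i)) (hc : ∀ x, ∃ i, x ∈ V i)
    (loc : ∀ i j x, x ∈ V i → x ∈ V j →
      ∀ᶠ y in 𝓝 x, f i y * (f j y)⁻¹ = f i x * (f j x)⁻¹) :
    ∃ μ : ∀ x y : X, Path.Homotopic.Quotient x y → G,
      (∀ x y (γ : Path x y) (g : I → G), Flat V f γ g →
        μ x y (Path.Homotopic.Quotient.mk γ) = (g 0)⁻¹ * g 1) ∧
      (∀ x y z (p : Path.Homotopic.Quotient x y) (q : Path.Homotopic.Quotient y z),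
        μ x z (p.trans q) = μ x y p * μ y z q) := by
  classical
  have ex : ∀ {x y} (γ : Path x y), ∃ g : I → G, Flat V f γ g := by
    intro x y γ
    exact Flat.exists hV hc loc γ.toContinuousMap
  let μ₀ : ∀ x y : X, Path x y → G := fun x y γ => ((ex γ).choose 0)⁻¹ * (ex γ).choose 1
  have hμ₀ : ∀ x y (γ : Path x y) (g : I → G), Flat V f γ g → μ₀ x y γ = (g 0)⁻¹ * g 1 := by
    intro x y γ g hg
    exact Flat.unique hc (ex γ).choose_spec hg 0 1
  have hconst : ∀ (x : X) (g : I → G), Flat V f (fun _ => x) g → g 0 = g 1 := by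
    intro x g hg
    have h1 : Flat V f (fun _ : I => x) (fun _ => (1 : G)) := by
      intro a i _; simp
    have := Flat.unique hc hg h1 0 1
    simp only [inv_one, mul_one] at this
    exact inv_mul_eq_one.1 this
  have hinv : ∀ x y (γ γ' : Path x y), γ.Homotopic γ' → μ₀ x y γ = μ₀ x y γ' := by
    rintro x y γ γ' ⟨F⟩
    obtain ⟨g, hg⟩ := Flat.exists hV hc loc (A := I × I) (F.toContinuousMap)
    have k0 := hg.comp (fun t : I => ((0 : I), t)) (by fun_prop)
    have k1 := hg.comp (fun t : I => ((1 : I), t)) (by fun_prop)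
    have l0 := hg.comp (fun t : I => (t, (0 : I))) (by fun_prop)
    have l1 := hg.comp (fun t : I => (t, (1 : I))) (by fun_prop)
    have a0 : (F.toContinuousMap ∘ fun t : I => ((0 : I), t)) = γ := by
      funext t; simp
    have a1 : (F.toContinuousMap ∘ fun t : I => ((1 : I), t)) = γ' := by
      funext t; simp
    have b0 : (F.toContinuousMap ∘ fun t : I => (t, (0 : I))) = fun _ => x := by
      funext t; simp
    have b1 : (F.toContinuousMap ∘ fun t : I => (t, (1 : I))) = fun _ => y := by
      funext t; simp
    rw [a0] at k0; rw [a1] at k1; rw [b0] at l0; rw [b1] at l1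
    have c0 := hconst _ _ l0
    have c1 := hconst _ _ l1
    rw [hμ₀ _ _ _ _ k0, hμ₀ _ _ _ _ k1]
    simp only [Function.comp] at c0 c1 ⊢
    rw [c0, c1]
  refine ⟨fun x y => Quotient.lift (μ₀ x y) (hinv x y), ?_, ?_⟩
  · intro x y γ g hg; exact hμ₀ x y γ g hg
  · intro x y z p q
    induction p using Path.Homotopic.Quotient.ind with | mk p => ?_
    induction q using Path.Homotopic.Quotient.ind with | mk q => ?_
    rw [← Path.Homotopic.Quotient.mk_trans]
    change μ₀ x z (p.trans q) = μ₀ x y p * μ₀ y z q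
    obtain ⟨g, hg⟩ := ex (p.trans q)
    let k : I → I := fun t => ⟨t / 2, by have := t.2.1; have := t.2.2; constructor <;> linarith⟩
    let l : I → I := fun t => ⟨(t + 1) / 2, by have := t.2.1; have := t.2.2; constructor <;> linarith⟩
    have hk := hg.comp k (by fun_prop)
    have hl := hg.comp l (by fun_prop)
    have a0 : (p.trans q) ∘ k = p := by
      funext t
      have := t.2.1; have := t.2.2
      simp only [Function.comp, Path.trans_apply, k]
      rw [dif_pos (by linarith)]
      congr 1; ext; simp; ring
    have a1 : (p.trans q) ∘ l = q := by
      funext t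
      have h0 := t.2.1; have := t.2.2
      simp only [Function.comp, Path.trans_apply, l]
      split_ifs with h
      · have : (t : ℝ) = 0 := by linarith
        have ht : t = 0 := by ext; simpa using this
        subst ht
        rw [q.source]
        convert p.target using 2
        ext; simp
      · congr 1; ext; simp; ring
    rw [a0] at hk; rw [a1] at hl
    rw [hμ₀ _ _ _ _ hg, hμ₀ _ _ _ _ hk, hμ₀ _ _ _ _ hl]
    have k0 : k 0 = 0 := by ext; simp [k]
    have l1 : l 1 = 1 := by ext; simp [l]
    have kl : k 1 = l 0 := by ext; simp [k, l]
    simp only [Function.comp, k0, l1, kl]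
    group

end Monodromy
end BraidProof


namespace BraidProof
open Topology unitInterval

section Transport

variable {X : Type} [TopologicalSpace X] {x₀ : X} (e : ∀ x, Path.Homotopic.Quotient x₀ x)

/-- The element of the fundamental group obtained from a path class by means of the reference
paths `e` (inverted, as multiplication in `FundamentalGroup` is reversed concatenation). -/
noncomputable def ofPath {x y : X} (γ : Path.Homotopic.Quotient x y) : FundamentalGroup X x₀ :=
  FundamentalGroup.fromPath (((e y).trans γ.symm).trans (e x).symm)

/-- Transport between two points of a simply connected space over `X`. -/
noncomputable def TT {A : Type} [TopologicalSpace A] [SimplyConnectedSpace A] (h : C(A, X))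
    (a b : A) : FundamentalGroup X x₀ :=
  ofPath e ((Path.Homotopic.Quotient.mk (PathConnectedSpace.somePath a b)).map h)

theorem TT_eq {A : Type} [TopologicalSpace A] [SimplyConnectedSpace A] (h : C(A, X))
    {a b : A} (γ : Path.Homotopic.Quotient a b) : TT e h a b = ofPath e (γ.map h) := by
  unfold TT
  rw [Subsingleton.elim γ]

open Path.Homotopic.Quotient in
theorem quot_symm_trans {x y z : X} (p : Path.Homotopic.Quotient x y)
    (q : Path.Homotopic.Quotient y z) : (p.trans q).symm = q.symm.trans p.symm := by
  have h : (p.trans q).symm = ((p.trans q).symm.trans (p.trans q)).trans (q.symm.trans p.symm) := by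
    rw [trans_assoc, trans_assoc, ← trans_assoc q, trans_symm, refl_trans, trans_symm, trans_refl]
  rw [h, symm_trans, refl_trans]

open Path.Homotopic.Quotient in
theorem ofPath_mul {x y z : X} (p : Path.Homotopic.Quotient x y)
    (q : Path.Homotopic.Quotient y z) :
    ofPath e p * ofPath e q = ofPath e (p.trans q) := by
  unfold ofPath
  rw [FundamentalGroup.mul_def, quot_symm_trans]
  change (((e z).trans q.symm).trans (e y).symm).trans (((e y).trans p.symm).trans (e x).symm) = _
  simp only [trans_assoc]
  rw [← trans_assoc (e y).symm, symm_trans, refl_trans]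

theorem TT_mul {A : Type} [TopologicalSpace A] [SimplyConnectedSpace A] (h : C(A, X))
    (a b c : A) : TT e h a b * TT e h b c = TT e h a c := by
  rw [TT_eq e h (.mk (PathConnectedSpace.somePath a b)),
    TT_eq e h (.mk (PathConnectedSpace.somePath b c)), ofPath_mul,
    TT_eq e h ((Path.Homotopic.Quotient.mk (PathConnectedSpace.somePath a b)).trans
      (.mk (PathConnectedSpace.somePath b c)))]
  rw [← Path.Homotopic.Quotient.mk_trans, ← Path.Homotopic.Quotient.mk_map,
    ← Path.Homotopic.Quotient.mk_map, ← Path.Homotopic.Quotient.mk_map, Path.map_trans,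
    Path.Homotopic.Quotient.mk_trans]

theorem TT_self {A : Type} [TopologicalSpace A] [SimplyConnectedSpace A] (h : C(A, X))
    (a : A) : TT e h a a = 1 := by
  have := TT_mul e h a a a
  exact mul_eq_left.1 this

theorem TT_inv {A : Type} [TopologicalSpace A] [SimplyConnectedSpace A] (h : C(A, X))
    (a b : A) : (TT e h a b)⁻¹ = TT e h b a := by
  rw [inv_eq_iff_mul_eq_one, TT_mul, TT_self]

theorem TT_comp {A B : Type} [TopologicalSpace A] [SimplyConnectedSpace A] [TopologicalSpace B]
    [SimplyConnectedSpace B] (h : C(A, X)) (k : C(B, A)) (a b : B) :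
    TT e (h.comp k) a b = TT e h (k a) (k b) := by
  rw [TT_eq e h ((Path.Homotopic.Quotient.mk (PathConnectedSpace.somePath a b)).map k),
    TT_eq e (h.comp k) (.mk (PathConnectedSpace.somePath a b)), Path.Homotopic.Quotient.map_comp]

theorem TT_path {x y : X} (γ : Path x y) :
    TT e γ.toContinuousMap 0 1 = ofPath e (Path.Homotopic.Quotient.mk γ) := by
  obtain ⟨f, rfl, rfl⟩ := γ
  rw [TT_eq e _ (Path.Homotopic.Quotient.mk (⟨ContinuousMap.id I, rfl, rfl⟩ : Path (0 : I) 1))]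
  rfl

/-- Generation: if all the small transports lie in a subgroup, so do all of them. -/
theorem TT_mem {ι : Type} (A : ι → Type) [∀ i, TopologicalSpace (A i)]
    [∀ i, SimplyConnectedSpace (A i)] (h : ∀ i, C(A i, X)) (ho : ∀ i, IsOpenEmbedding (h i))
    (hc : ∀ x, ∃ i, x ∈ Set.range (h i)) (m : X → FundamentalGroup X x₀)
    (H : Subgroup (FundamentalGroup X x₀))
    (hH : ∀ i a b, m (h i a) * TT e (h i) a b * (m (h i b))⁻¹ ∈ H) (γ : C(I, X)) (s t : I) :
    m (γ s) * TT e γ s t * (m (γ t))⁻¹ ∈ H := by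
  refine @PreconnectedSpace.induction₂ I _ _
    (fun s t => m (γ s) * TT e γ s t * (m (γ t))⁻¹ ∈ H) ⟨?_⟩ ?_ ⟨?_⟩ s t
  · intro a b hab
    have := H.inv_mem hab
    rw [← TT_inv]
    convert this using 1
    group
  · intro s
    obtain ⟨i, hi⟩ := hc (γ s)
    have hO : IsOpen (γ ⁻¹' Set.range (h i)) := (ho i).isOpen_range.preimage γ.continuous
    obtain ⟨W, ⟨hWn, hWp⟩, hW⟩ :=
      (path_connected_basis s).mem_iff.1 (hO.mem_nhds hi)
    filter_upwards [hWn] with t ht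
    obtain ⟨k, hk⟩ := hWp.joinedIn s (mem_of_mem_nhds hWn) t ht
    have hr : ∀ u, γ (k u) ∈ Set.range (h i) := fun u => hW (hk u)
    choose k' hk' using hr
    have hk'c : Continuous k' := by
      rw [(ho i).toIsEmbedding.continuous_iff]
      have : (h i) ∘ k' = γ ∘ k := funext hk'
      rw [this]; fun_prop
    have e1 : TT e γ s t = TT e (h i) (k' 0) (k' 1) := by
      have h1 := TT_comp e γ k.toContinuousMap 0 1
      have h2 := TT_comp e (h i) ⟨k', hk'c⟩ 0 1
      have h3 : γ.comp k.toContinuousMap = (h i).comp ⟨k', hk'c⟩ := by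
        ext u; exact (hk' u).symm
      rw [h3, h2] at h1
      have k0 : k.toContinuousMap 0 = s := k.source
      have k1 : k.toContinuousMap 1 = t := k.target
      rw [k0, k1] at h1
      exact h1.symm
    have := hH i (k' 0) (k' 1)
    rw [hk', hk', k.source, k.target] at this
    rw [e1]; exact this
  · intro a b c h1 h2
    have := H.mul_mem h1 h2
    rw [← TT_mul e γ a b c]
    convert this using 1
    group

/-- The holonomy homomorphism. -/
theorem exists_hom {ι G : Type} [Group G] {V : ι → Set X} {f : ι → X → G}
    (hV : ∀ i, IsOpen (V i)) (hc : ∀ x, ∃ i, x ∈ V i)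
    (loc : ∀ i j x, x ∈ V i → x ∈ V j →
      ∀ᶠ y in 𝓝 x, f i y * (f j y)⁻¹ = f i x * (f j x)⁻¹) :
    ∃ (ψ : FundamentalGroup X x₀ →* G) (η : X → G),
      ∀ (A : Type) [TopologicalSpace A] [SimplyConnectedSpace A] (h : C(A, X)) (i : ι)
        (_ : ∀ a, h a ∈ V i) (a b : A),
        ψ (TT e h a b) = η (h a) * ((f i (h a))⁻¹ * f i (h b)) * (η (h b))⁻¹ := by
  obtain ⟨μ, hμ, hmul⟩ := exists_holonomy hV hc loc
  have hone : ∀ x, μ x x (.refl x) = 1 := by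
    intro x
    have := hmul x x x (.refl x) (.refl x)
    rw [Path.Homotopic.Quotient.refl_trans] at this
    exact mul_eq_left.1 this.symm
  have hsymm : ∀ x y (p : Path.Homotopic.Quotient x y), μ y x p.symm = (μ x y p)⁻¹ := by
    intro x y p
    have := hmul _ _ _ p p.symm
    rw [Path.Homotopic.Quotient.trans_symm, hone] at this
    exact (inv_eq_of_mul_eq_one_right this.symm).symm
  refine ⟨⟨⟨fun p => (μ x₀ x₀ p)⁻¹, ?_⟩, ?_⟩, fun x => μ _ _ (e x), ?_⟩
  · exact inv_eq_one.2 (hone x₀)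
  · intro p q
    change (μ x₀ x₀ (Path.Homotopic.Quotient.trans q p))⁻¹ = _
    rw [hmul, mul_inv_rev]
  · intro A _ _ h i hi a b
    change (μ x₀ x₀ (((e (h b)).trans
      ((Path.Homotopic.Quotient.mk (PathConnectedSpace.somePath a b)).map h).symm).trans
        (e (h a)).symm))⁻¹ = _
    rw [hmul, hmul, hsymm, hsymm, ← Path.Homotopic.Quotient.mk_map]
    rw [hμ _ _ _ (fun t => f i (h (PathConnectedSpace.somePath a b t)))]
    · simp only [Path.source, Path.target]; group
    · intro t j hj
      have hj' : h (PathConnectedSpace.somePath a b t) ∈ V j := hj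
      have := loc i j _ (hi (PathConnectedSpace.somePath a b t)) hj'
      have hcont : Continuous (fun t => h (PathConnectedSpace.somePath a b t)) := by fun_prop
      exact (hcont.tendsto t).eventually this

end Transport
end BraidProof


namespace BraidProof
open Topology unitInterval

section Matsumoto

variable {m : ℕ}

/-- The adjacent transposition. -/
def st (i : Fin m) : Equiv.Perm (Fin (m + 1)) := Equiv.swap i.castSucc i.succ

/-- The Artin generator in `BraidGroup (m + 1)`. -/
def sg (i : Fin m) : BraidGroup (m + 1) := PresentedGroup.of (rels := braidRels (m + 1)) i

theorem sg_comm (i j : Fin m) (h : (i : ℕ) + 1 < j) : sg i * sg j = sg j * sg i := by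
  have : PresentedGroup.mk (braidRels (m + 1))
      (FreeGroup.of i * FreeGroup.of j * (FreeGroup.of j * FreeGroup.of i)⁻¹) = 1 := by
    apply PresentedGroup.one_of_mem
    exact Or.inl ⟨i, j, h, rfl⟩
  rw [map_mul, map_inv, mul_inv_eq_one, map_mul, map_mul] at this
  exact this

theorem sg_braid (i j : Fin m) (h : (j : ℕ) = i + 1) :
    sg i * sg j * sg i = sg j * sg i * sg j := by
  have : PresentedGroup.mk (braidRels (m + 1))
      (FreeGroup.of i * FreeGroup.of j * FreeGroup.of i *
        (FreeGroup.of j * FreeGroup.of i * FreeGroup.of j)⁻¹) = 1 := by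
    apply PresentedGroup.one_of_mem
    exact Or.inr ⟨i, j, h, rfl⟩
  rw [map_mul, map_inv, mul_inv_eq_one, map_mul, map_mul, map_mul, map_mul] at this
  exact this

@[simp] theorem st_castSucc (i : Fin m) : st i i.castSucc = i.succ := Equiv.swap_apply_left _ _
@[simp] theorem st_succ (i : Fin m) : st i i.succ = i.castSucc := Equiv.swap_apply_right _ _
theorem st_of_ne (i : Fin m) (x : Fin (m + 1)) (h : x ≠ i.castSucc) (h' : x ≠ i.succ) :
    st i x = x := Equiv.swap_apply_of_ne_of_ne h h'
@[simp] theorem st_mul_self (i : Fin m) : st i * st i = 1 := Equiv.swap_mul_self _ _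
@[simp] theorem st_inv (i : Fin m) : (st i)⁻¹ = st i := Equiv.swap_inv _ _
@[simp] theorem mul_st_st (v : Equiv.Perm (Fin (m + 1))) (i : Fin m) : v * st i * st i = v := by
  rw [mul_assoc, st_mul_self, mul_one]

theorem st_val (i : Fin m) (x : Fin (m + 1)) :
    ((st i x : Fin (m + 1)) : ℕ) = if (x : ℕ) = i then (i : ℕ) + 1 else
      if (x : ℕ) = i + 1 then (i : ℕ) else x := by
  split_ifs with h1 h2
  · have : x = i.castSucc := by ext; simpa using h1
    subst this; simp
  · have : x = i.succ := by ext; simpa using h2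
    subst this; simp
  · rw [st_of_ne]
    · intro h; apply h1; rw [h]; simp
    · intro h; apply h2; rw [h]; simp

theorem st_lt (i : Fin m) (a b : Fin (m + 1)) (h : a < b) (hne : ¬ (a = i.castSucc ∧ b = i.succ)) :
    st i a < st i b := by
  rw [Fin.lt_def, st_val, st_val]
  rw [Fin.lt_def] at h
  have : ¬ ((a : ℕ) = i ∧ (b : ℕ) = i + 1) := by
    rintro ⟨h1, h2⟩
    exact hne ⟨by ext; simpa using h1, by ext; simpa using h2⟩
  split_ifs <;> omega

/-- A measure which increases along ascents. -/
def wt (v : Equiv.Perm (Fin (m + 1))) : ℕ := ∑ j, (v j : ℕ) * (m - j)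

theorem wt_lt (v : Equiv.Perm (Fin (m + 1))) (i : Fin m) (h : v i.castSucc < v i.succ) :
    wt v < wt (v * st i) := by
  have h1 : wt (v * st i) = ∑ j, (v j : ℕ) * (m - (st i j : Fin (m + 1))) := by
    unfold wt
    rw [← Equiv.sum_comp (st i)]
    apply Finset.sum_congr rfl
    intro j _
    have : st i (st i j) = j := by rw [← Equiv.Perm.mul_apply, st_mul_self]; rfl
    rw [Equiv.Perm.mul_apply, this]
  rw [h1]
  unfold wt
  zify
  rw [← sub_pos, ← Finset.sum_sub_distrib]
  rw [Fintype.sum_eq_add i.castSucc i.succ]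
  · simp only [st_castSucc, st_succ]
    have hi := i.2
    rw [Fin.lt_def] at h
    have e1 : ((m - ((i.succ : Fin (m + 1)) : ℕ) : ℕ) : ℤ) = m - i - 1 := by
      simp only [Fin.val_succ]; omega
    have e2 : ((m - ((i.castSucc : Fin (m + 1)) : ℕ) : ℕ) : ℤ) = m - i := by
      simp only [Fin.val_castSucc]; omega
    rw [e1, e2]
    have h' : ((v i.castSucc : ℕ) : ℤ) < (v i.succ : ℕ) := by exact_mod_cast h
    linarith
  · intro h; have := congrArg Fin.val h; simp at this
  · rintro x ⟨h1, h2⟩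
    rw [st_of_ne i x h1 h2]; ring

theorem exists_descent (v : Equiv.Perm (Fin (m + 1))) (h : v ≠ 1) :
    ∃ i : Fin m, v i.succ < v i.castSucc := by
  by_contra hc
  push Not at hc
  apply h
  have hs : StrictMono v := by
    rw [Fin.strictMono_iff_lt_succ]
    intro i
    refine lt_of_le_of_ne (hc i) ?_
    intro he
    have := congrArg Fin.val (v.injective he); simp at this
  have hiso : (hs.orderIsoOfSurjective v v.surjective) = OrderIso.refl _ := Subsingleton.elim _ _
  ext x
  have := congrArg (fun o : Fin (m + 1) ≃o Fin (m + 1) => o x) hiso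
  simpa using congrArg Fin.val this

theorem ascent_induction (P : Equiv.Perm (Fin (m + 1)) → Prop) (h1 : P 1)
    (hs : ∀ v i, v (Fin.castSucc i) < v i.succ → P v → P (v * st i)) : ∀ v, P v := by
  have : ∀ N v, wt v = N → P v := by
    intro N
    induction N using Nat.strong_induction_on with
    | _ N ih =>
      intro v hv
      by_cases hv1 : v = 1
      · rw [hv1]; exact h1
      · obtain ⟨i, hi⟩ := exists_descent v hv1
        have ha : (v * st i) i.castSucc < (v * st i) i.succ := by simpa using hi
        have hw := wt_lt (v * st i) i ha
        rw [mul_st_st] at hw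
        have := hs (v * st i) i ha (ih _ (by omega) _ rfl)
        rwa [mul_st_st] at this
  exact fun v => this _ v rfl

/-- The graph of the Matsumoto section. -/
inductive IsR : Equiv.Perm (Fin (m + 1)) → BraidGroup (m + 1) → Prop
  | one : IsR 1 1
  | step (v : Equiv.Perm (Fin (m + 1))) (g : BraidGroup (m + 1)) (i : Fin m)
      (h : v i.castSucc < v i.succ) (hv : IsR v g) : IsR (v * st i) (g * sg i)

theorem IsR.inv {w : Equiv.Perm (Fin (m + 1))} {g : BraidGroup (m + 1)} (h : IsR w g) :
    (w = 1 ∧ g = 1) ∨ ∃ i g', w (Fin.succ i) < w i.castSucc ∧ IsR (w * st i) g' ∧ g = g' * sg i := by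
  cases h with
  | one => exact Or.inl ⟨rfl, rfl⟩
  | step v g i h hv =>
    refine Or.inr ⟨i, g, ?_, ?_, rfl⟩
    · simpa using h
    · rw [mul_st_st]; exact hv

theorem IsR.exists (w : Equiv.Perm (Fin (m + 1))) : ∃ g, IsR w g := by
  refine ascent_induction (fun w => ∃ g, IsR w g) ⟨1, IsR.one⟩ ?_ w
  rintro v i h ⟨g, hg⟩
  exact ⟨_, IsR.step v g i h hg⟩

theorem st_comm (i j : Fin m) (h : (i : ℕ) + 1 < j) : st i * st j = st j * st i := by
  ext x
  simp only [Equiv.Perm.mul_apply, st_val]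
  split_ifs <;> omega

theorem st_braid (i j : Fin m) (h : (j : ℕ) = i + 1) :
    st i * st j * st i = st j * st i * st j := by
  have e0 : i.succ = j.castSucc := by ext; simp [h]
  have n1 : i.castSucc ≠ i.succ := by intro h; have := congrArg Fin.val h; simp at this
  have n2 : i.castSucc ≠ j.succ := by
    intro h'; have := congrArg Fin.val h'; simp at this; omega
  have n3 : i.succ ≠ j.succ := by
    intro h'; have := congrArg Fin.val h'; simp at this; omega
  have h1 := Equiv.swap_mul_swap_mul_swap n3.symm n2.symm
  have h2 := Equiv.swap_mul_swap_mul_swap n1 n2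
  unfold st
  rw [← e0, h2, Equiv.swap_comm j.succ, ← h1, Equiv.swap_comm i.castSucc,
    Equiv.swap_comm i.succ j.succ]

theorem IsR.unique_aux (N : ℕ)
    (ih : ∀ w : Equiv.Perm (Fin (m + 1)), wt w < N → ∀ g h, IsR w g → IsR w h → g = h)
    (w : Equiv.Perm (Fin (m + 1))) (hw : wt w = N) (i j : Fin m) (hij : i ≤ j)
    (hi : w i.succ < w i.castSucc) (hj : w j.succ < w j.castSucc)
    (g h : BraidGroup (m + 1)) (hg : IsR (w * st i) g) (hh : IsR (w * st j) h) :
    g * sg i = h * sg j := by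
  have lti : wt (w * st i) < N := by
    have := wt_lt (w * st i) i (by simpa using hi)
    rw [mul_st_st] at this; omega
  have ltj : wt (w * st j) < N := by
    have := wt_lt (w * st j) j (by simpa using hj)
    rw [mul_st_st] at this; omega
  rcases Nat.lt_trichotomy ((i : ℕ) + 1) j with hf | he | hl
  · obtain ⟨k, hk⟩ := IsR.exists (w * st i * st j)
    have e1 : st i j.castSucc = j.castSucc := by
      ext; rw [st_val]; simp only [Fin.val_castSucc]; split_ifs <;> omega
    have e2 : st i j.succ = j.succ := by
      ext; rw [st_val]; simp only [Fin.val_succ]; split_ifs <;> omega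
    have e3 : st j i.castSucc = i.castSucc := by
      ext; rw [st_val]; simp only [Fin.val_castSucc]; split_ifs <;> omega
    have e4 : st j i.succ = i.succ := by
      ext; rw [st_val]; simp only [Fin.val_succ]; split_ifs <;> omega
    have h1 := IsR.step _ _ j (by simpa [e1, e2] using hj) hk
    rw [mul_st_st] at h1
    have h2 := IsR.step _ _ i (by simpa [e3, e4] using hi) hk
    have : w * st i * st j * st i = w * st j := by
      rw [mul_assoc w, st_comm i j hf, ← mul_assoc, mul_st_st]
    rw [this] at h2
    rw [ih _ lti _ _ hg h1, ih _ ltj _ _ hh h2, mul_assoc, mul_assoc, sg_comm i j hf]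
  · have he' : (j : ℕ) = i + 1 := he.symm
    obtain ⟨k, hk⟩ := IsR.exists (w * st i * st j * st i)
    have e0 : i.succ = j.castSucc := by ext; simp [he']
    have e1 : st i j.succ = j.succ := by
      ext; rw [st_val]; simp only [Fin.val_succ]; split_ifs <;> omega
    have e2 : st j i.castSucc = i.castSucc := by
      ext; rw [st_val]; simp only [Fin.val_castSucc]; split_ifs <;> omega
    have hk' := hk
    rw [mul_assoc w, mul_assoc w, st_braid i j he', ← mul_assoc w, ← mul_assoc w] at hk'
    have e3 : st i j.castSucc = i.castSucc := by rw [← e0]; simp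
    have e4 : st j i.succ = j.succ := by rw [e0]; simp
    have hij' : w j.succ < w i.castSucc := by rw [e0] at hi; exact hj.trans hi
    have hi' : w j.castSucc < w i.castSucc := by rw [← e0]; exact hi
    have a1 := IsR.step _ _ i (by simp [e0, e1, e2, e3]; exact hj) hk
    rw [mul_st_st] at a1
    have a2 := IsR.step _ _ j (by simp [e1, e3]; exact hij') a1
    rw [mul_st_st] at a2
    have b1 := IsR.step _ _ j (by simp [e0, e1, e2, e3, e4]; exact hi') hk'
    rw [mul_st_st] at b1
    have b2 := IsR.step _ _ i (by simp [e0, e1, e2, e3, e4]; exact hij') b1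
    rw [mul_st_st] at b2
    rw [ih _ lti _ _ hg a2, ih _ ltj _ _ hh b2]
    have := sg_braid i j he'
    simp only [mul_assoc] at this ⊢
    rw [this]
  · have : i = j := by
      rw [Fin.le_def] at hij
      ext; omega
    subst this
    rw [ih _ lti _ _ hg hh]

theorem IsR.unique : ∀ (w : Equiv.Perm (Fin (m + 1))) (g h), IsR w g → IsR w h → g = h := by
  have : ∀ N (w : Equiv.Perm (Fin (m + 1))), wt w = N → ∀ g h, IsR w g → IsR w h → g = h := by
    intro N
    induction N using Nat.strong_induction_on with
    | _ N ih =>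
      intro w hw g h hg hh
      have ih' : ∀ w : Equiv.Perm (Fin (m + 1)), wt w < N →
          ∀ g h, IsR w g → IsR w h → g = h := fun w hw => ih _ hw w rfl
      rcases hg.inv with ⟨h1, h2⟩ | ⟨i, g', hi, hg', rfl⟩
      · rcases hh.inv with ⟨h3, h4⟩ | ⟨j, h', hj, hh', rfl⟩
        · rw [h2, h4]
        · subst h1
          simp only [Equiv.Perm.coe_one, id] at hj
          exact absurd hj (not_lt.2 (Fin.castSucc_le_succ j))
      · rcases hh.inv with ⟨h3, h4⟩ | ⟨j, h', hj, hh', rfl⟩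
        · subst h3
          simp only [Equiv.Perm.coe_one, id] at hi
          exact absurd hi (not_lt.2 (Fin.castSucc_le_succ i))
        · rcases le_total i j with hij | hij
          · exact IsR.unique_aux N ih' w hw i j hij hi hj _ _ hg' hh'
          · exact (IsR.unique_aux N ih' w hw j i hij hj hi _ _ hh' hg').symm
  exact fun w => this _ w rfl

/-- The Matsumoto section. -/
noncomputable def mat (w : Equiv.Perm (Fin (m + 1))) : BraidGroup (m + 1) := (IsR.exists w).choose

theorem mat_spec (w : Equiv.Perm (Fin (m + 1))) : IsR w (mat w) := (IsR.exists w).choose_spec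

theorem mat_one : mat (1 : Equiv.Perm (Fin (m + 1))) = 1 := IsR.unique _ _ _ (mat_spec _) IsR.one

theorem mat_step (v : Equiv.Perm (Fin (m + 1))) (i : Fin m) (h : v i.castSucc < v i.succ) :
    mat (v * st i) = mat v * sg i :=
  IsR.unique _ _ _ (mat_spec _) (IsR.step _ _ i h (mat_spec v))

theorem mat_st (i : Fin m) : mat (st i) = sg i := by
  have := mat_step 1 i (by simp)
  rwa [mat_one, one_mul, one_mul] at this

theorem mat_mul (v u : Equiv.Perm (Fin (m + 1)))
    (h : ∀ a b, a < b → u b < u a → v (u b) < v (u a)) : mat (v * u) = mat v * mat u := by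
  revert h
  refine ascent_induction (fun u => (∀ a b, a < b → u b < u a → v (u b) < v (u a)) →
    mat (v * u) = mat v * mat u) ?_ ?_ u
  · intro _; rw [mat_one, mul_one, mul_one]
  · intro u i hi ih h
    have h1 : (v * u) i.castSucc < (v * u) i.succ := by
      have := h i.castSucc i.succ Fin.castSucc_lt_succ (by simpa using hi)
      simpa using this
    rw [← mul_assoc, mat_step _ _ h1, mat_step _ _ hi, ih, mul_assoc]
    intro a b hab hu
    have hs := st_lt i a b hab (by rintro ⟨rfl, rfl⟩; exact lt_asymm hu hi)
    have hss : ∀ x, st i (st i x) = x := fun x => by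
      rw [← Equiv.Perm.mul_apply, st_mul_self]; rfl
    have := h _ _ hs (by simpa [hss] using hu)
    simpa [hss] using this

end Matsumoto
end BraidProof


namespace BraidProof
open Topology unitInterval

section Config

variable {n : ℕ}

/-- Lexicographic key of a complex number. -/
noncomputable def key (z : ℂ) : ℝ ×ₗ ℝ := toLex (z.re, z.im)

theorem key_lt (a b : ℂ) : key a < key b ↔ a.re < b.re ∨ (a.re = b.re ∧ a.im < b.im) := by
  unfold key; rw [Prod.Lex.toLex_lt_toLex]

theorem key_inj : Function.Injective key := by
  intro a b h
  have := congrArg ofLex h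
  simp only [key, ofLex_toLex, Prod.mk.injEq] at this
  exact Complex.ext this.1 this.2

/-- The sorting permutation. -/
noncomputable def LL (z : Fin n → ℂ) : Equiv.Perm (Fin n) := Tuple.sort (key ∘ z)

theorem LL_strict {z : Fin n → ℂ} (hz : Function.Injective z) :
    StrictMono (key ∘ z ∘ LL z) :=
  (Tuple.monotone_sort (key ∘ z)).strictMono_of_injective
    ((key_inj.comp hz).comp (LL z).injective)

theorem LL_unique {z : Fin n → ℂ} {w : Equiv.Perm (Fin n)} (h : StrictMono (key ∘ z ∘ w)) :
    LL z = w := by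
  have h1 : (key ∘ z) ∘ LL z = (key ∘ z) ∘ w :=
    Tuple.unique_monotone (Tuple.monotone_sort (key ∘ z)) h.monotone
  have hi : Function.Injective (key ∘ z) := by
    have := h.injective.comp w.symm.injective
    convert this using 1
    funext x; simp
  ext x
  exact congrArg Fin.val (hi (congrFun h1 x))

theorem LL_comp {z : Fin n → ℂ} (hz : Function.Injective z) (w : Equiv.Perm (Fin n)) :
    LL (z ∘ w) = w⁻¹ * LL z := by
  apply LL_unique
  have := LL_strict hz
  convert this using 1
  funext x; simp

theorem comp_LL_comp {z : Fin n → ℂ} (hz : Function.Injective z) (w : Equiv.Perm (Fin n)) :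
    (z ∘ w) ∘ LL (z ∘ w) = z ∘ LL z := by
  rw [LL_comp hz]; funext x; simp

theorem perm_strictMono (w : Equiv.Perm (Fin n)) (h : StrictMono w) : w = 1 := by
  have hiso : (h.orderIsoOfSurjective w w.surjective) = OrderIso.refl _ := Subsingleton.elim _ _
  ext x
  have := congrArg (fun o : Fin n ≃o Fin n => o x) hiso
  simpa using congrArg Fin.val this

variable (n) in
/-- Chambers (facets): monotone functions. -/
abbrev Ch : Type := {c : Fin n → ℝ // Monotone c}

/-- The convex open set associated with a facet. -/
def U (c : Ch n) : Set (Fin n → ℂ) :=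
  {z | ∀ i j, (c.1 i < c.1 j → (z i).re < (z j).re) ∧
    (i < j → c.1 i = c.1 j → (z i).im < (z j).im)}

theorem U_inj {c : Ch n} {z : Fin n → ℂ} (hz : z ∈ U c) : Function.Injective z := by
  have key : ∀ i j, i < j → z i ≠ z j := by
    intro i j hij h
    rcases (c.2 hij.le).lt_or_eq with h1 | h1
    · have := (hz i j).1 h1; rw [h] at this; exact lt_irrefl _ this
    · have := (hz i j).2 hij h1; rw [h] at this; exact lt_irrefl _ this
  intro i j h
  rcases lt_trichotomy i j with h1 | h1 | h1
  · exact absurd h (key _ _ h1)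
  · exact h1
  · exact absurd h.symm (key _ _ h1)

theorem U_open (c : Ch n) : IsOpen (U c) := by
  have : U c = ⋂ i, ⋂ j, ({z | c.1 i < c.1 j → (z i).re < (z j).re} ∩
      {z | i < j → c.1 i = c.1 j → (z i).im < (z j).im}) := by
    ext z; simp [U]
  rw [this]
  refine isOpen_iInter_of_finite fun i => isOpen_iInter_of_finite fun j => IsOpen.inter ?_ ?_
  · by_cases h : c.1 i < c.1 j
    · simp only [h, forall_true_left]
      exact isOpen_lt (by fun_prop) (by fun_prop)
    · simp [h]
  · by_cases h : i < j
    · by_cases h' : c.1 i = c.1 j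
      · simp only [h, h', forall_true_left]
        exact isOpen_lt (by fun_prop) (by fun_prop)
      · simp [h']
    · simp [h]

theorem U_convex (c : Ch n) : Convex ℝ (U c) := by
  intro x hx y hy a b ha hb hab i j
  have key : ∀ p q p' q' : ℝ, p < q → p' < q' → a * p + b * p' < a * q + b * q' := by
    intro p q p' q' h1 h2
    rcases ha.lt_or_eq with h | h
    · nlinarith
    · have : b = 1 := by linarith
      subst this; rw [← h]; linarith
  refine ⟨fun h => ?_, fun h h' => ?_⟩
  · simpa using key _ _ _ _ ((hx i j).1 h) ((hy i j).1 h)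
  · simpa using key _ _ _ _ ((hx i j).2 h h') ((hy i j).2 h h')

theorem U_nonempty (c : Ch n) : (U c).Nonempty :=
  ⟨fun j => ⟨c.1 j, (j : ℕ)⟩, fun i j => ⟨fun h => h, fun h _ => by simpa using h⟩⟩

instance (c : Ch n) : ContractibleSpace (U c) := (U_convex c).contractibleSpace (U_nonempty c)

theorem c_LL {c : Ch n} {z : Fin n → ℂ} (hz : z ∈ U c) : c.1 ∘ LL z = c.1 := by
  have h1 : Monotone (c.1 ∘ LL z) := by
    intro a b hab
    by_contra h
    have h2 := (hz _ _).1 (not_le.1 h)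
    rcases hab.lt_or_eq with h3 | h3
    · have := LL_strict (U_inj hz) h3
      simp only [Function.comp_apply, key_lt] at this
      rcases this with h4 | h4
      · exact lt_asymm h2 h4
      · rw [h4.1] at h2; exact lt_irrefl _ h2
    · rw [h3] at h2; exact lt_irrefl _ h2
  exact Tuple.unique_monotone (τ := 1) h1 c.2

theorem U_unique {c : Ch n} {z : Fin n → ℂ} (hz : z ∈ U c) (w : Equiv.Perm (Fin n))
    (hw : z ∘ w ∈ U c) : w = 1 := by
  have h1 := c_LL hz
  have h2 := c_LL hw
  rw [LL_comp (U_inj hz)] at h2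
  have h3 : ∀ x, c.1 (w x) = c.1 x := by
    intro x
    have a1 := congrFun h1 ((LL z)⁻¹ (w x))
    have a2 := congrFun h2 ((LL z)⁻¹ (w x))
    simp at a1 a2
    rw [a1, ← a2]
  apply perm_strictMono
  intro i j hij
  by_contra hc
  have hlt : w j < w i := by
    rcases (not_lt.1 hc).lt_or_eq with h | h
    · exact h
    · exact absurd (w.injective h) hij.ne'
  rcases (c.2 hij.le).lt_or_eq with h | h
  · have := c.2 hlt.le
    rw [h3, h3] at this
    exact absurd h (not_lt.2 this)
  · have a1 := (hw i j).2 hij h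
    have a2 := (hz _ _).2 hlt (by rw [h3, h3, h])
    exact lt_asymm a1 a2

/-- The projection to the unordered configuration space. -/
def pr (z : ConfigSpace n) : UConfigSpace n := Quotient.mk _ z

theorem pr_cont : Continuous (pr (n := n)) := continuous_quotient_mk'

theorem pr_eq (z z' : ConfigSpace n) : pr z = pr z' ↔ ∃ w : Equiv.Perm (Fin n), z.1 ∘ w = z'.1 :=
  Quotient.eq (r := configSetoid n)

theorem pr_open : IsOpenMap (pr (n := n)) := by
  intro O hO
  have : IsOpen (pr ⁻¹' (pr '' O)) := by
    have : pr ⁻¹' (pr '' O) = ⋃ w : Equiv.Perm (Fin n),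
        (fun z : ConfigSpace n => (⟨z.1 ∘ w, z.2.comp w.injective⟩ : ConfigSpace n)) ⁻¹' O := by
      ext z
      simp only [Set.mem_preimage, Set.mem_image, Set.mem_iUnion]
      constructor
      · rintro ⟨y, hy, h⟩
        obtain ⟨w, hw⟩ := (pr_eq _ _).1 h.symm
        refine ⟨w, ?_⟩
        convert hy
      · rintro ⟨w, hw⟩
        exact ⟨_, hw, ((pr_eq _ _).2 ⟨w, rfl⟩).symm⟩
    rw [this]
    refine isOpen_iUnion fun w => hO.preimage ?_
    refine Continuous.subtype_mk ?_ _
    exact continuous_pi fun i => (continuous_apply (w i)).comp continuous_subtype_val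
  exact this

/-- The chart of the unordered configuration space. -/
def hh (c : Ch n) : C(U c, UConfigSpace n) :=
  ⟨fun z => pr ⟨z.1, U_inj z.2⟩, pr_cont.comp (Continuous.subtype_mk continuous_subtype_val _)⟩

theorem hh_open (c : Ch n) : IsOpenEmbedding (hh c) := by
  refine IsOpenEmbedding.of_continuous_injective_isOpenMap (hh c).continuous ?_ ?_
  · rintro ⟨z, hz⟩ ⟨z', hz'⟩ h
    obtain ⟨w, hw⟩ := (pr_eq _ _).1 h
    simp only at hw
    subst hw
    have := U_unique hz w hz'
    subst this
    rfl
  · intro O hO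
    have h1 : IsOpen (Subtype.val '' O) := (U_open c).isOpenMap_subtype_val _ hO
    have : hh c '' O = pr '' (Subtype.val ⁻¹' (Subtype.val '' O)) := by
      ext y; constructor
      · rintro ⟨z, hz, rfl⟩
        exact ⟨⟨z.1, U_inj z.2⟩, ⟨z, hz, rfl⟩, rfl⟩
      · rintro ⟨z, ⟨z', hz', h⟩, rfl⟩
        refine ⟨z', hz', ?_⟩
        change pr _ = _
        congr 1; exact Subtype.ext h
    rw [this]
    exact pr_open _ (h1.preimage continuous_subtype_val)

/-- The facet of a sorted configuration. -/
noncomputable def cOf (z : Fin n → ℂ) (hz : Function.Injective z) : Ch n :=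
  ⟨fun j => (z (LL z j)).re, by
    intro a b hab
    rcases hab.lt_or_eq with h | h
    · have := LL_strict hz h
      simp only [Function.comp_apply, key_lt] at this
      rcases this with h | h
      · exact h.le
      · exact h.1.le
    · rw [h]⟩

theorem mem_cOf (z : Fin n → ℂ) (hz : Function.Injective z) : z ∘ LL z ∈ U (cOf z hz) := by
  intro i j
  refine ⟨fun h => h, fun h h' => ?_⟩
  have := LL_strict hz h
  simp only [Function.comp_apply, key_lt] at this
  rcases this with h1 | h1
  · exact absurd h' h1.ne
  · exact h1.2

theorem cover (x : UConfigSpace n) : ∃ c, x ∈ Set.range (hh c) := by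
  induction x using Quotient.inductionOn with
  | h z =>
  refine ⟨cOf z.1 z.2, ⟨_, mem_cOf z.1 z.2⟩, ?_⟩
  exact ((pr_eq _ _).2 ⟨LL z.1, rfl⟩).symm

end Config
end BraidProof


namespace BraidProof
open Topology unitInterval

section Loc

variable {m : ℕ}

open Classical in
/-- The local trivialization. -/
noncomputable def ff (c : Ch (m + 1)) (y : UConfigSpace (m + 1)) : BraidGroup (m + 1) :=
  if h : y ∈ Set.range (hh c) then mat (LL (h.choose : U c).1) else 1

theorem ff_hh (c : Ch (m + 1)) (z : U c) : ff c (hh c z) = mat (LL z.1) := by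
  have h : hh c z ∈ Set.range (hh c) := ⟨z, rfl⟩
  unfold ff
  rw [dif_pos h]
  have := (hh_open c).injective h.choose_spec
  rw [this]

theorem comp_LL_mem_open {n : ℕ} (c : Ch n) (w : Equiv.Perm (Fin n)) :
    IsOpen {z : Fin n → ℂ | z ∘ w ∈ U c} :=
  (U_open c).preimage (continuous_pi fun i => continuous_apply (w i))

theorem hh_eq {n : ℕ} (c c' : Ch n) (z : U c) (z' : U c') :
    hh c z = hh c' z' ↔ ∃ w : Equiv.Perm (Fin n), z.1 ∘ w = z'.1 := pr_eq _ _

theorem loc_aux (c : Ch (m + 1)) (z : U c) :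
    ∀ᶠ y in 𝓝 (hh c z), ff c y = ff c (hh c z) * ff (cOf z.1 (U_inj z.2)) y := by
  rw [← (hh_open c).map_nhds_eq, Filter.eventually_map]
  have hO : IsOpen {z' : U c | z'.1 ∘ LL z.1 ∈ U (cOf z.1 (U_inj z.2))} :=
    (comp_LL_mem_open _ _).preimage continuous_subtype_val
  filter_upwards [hO.mem_nhds (mem_cOf z.1 (U_inj z.2))] with z' hz'
  have hz'' : z'.1 ∘ LL z.1 ∈ U (cOf z.1 (U_inj z.2)) := hz'
  have e1 : hh c z' = hh (cOf z.1 (U_inj z.2)) ⟨_, hz''⟩ := (hh_eq _ _ _ _).2 ⟨_, rfl⟩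
  rw [ff_hh, ff_hh, e1, ff_hh]
  have e2 := LL_comp (U_inj z'.2) (LL z.1)
  have e3 : LL z'.1 = LL z.1 * LL (z'.1 ∘ LL z.1) := by rw [e2]; group
  rw [e3]
  apply mat_mul
  set u := LL (z'.1 ∘ LL z.1)
  intro a b hab hu
  have hs := LL_strict (U_inj hz'') hab
  simp only [Function.comp_apply, key_lt] at hs
  have h1 : (z.1 (LL z.1 (u b))).re = (z.1 (LL z.1 (u a))).re := by
    rcases ((cOf z.1 (U_inj z.2)).2 hu.le).lt_or_eq with h | h
    · have := (hz'' _ _).1 h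
      simp only [Function.comp_apply] at this
      rcases hs with h' | h'
      · exact absurd this (lt_asymm h')
      · exact absurd this (h'.1.symm ▸ lt_irrefl _)
    · exact h
  have h2 : (z.1 (LL z.1 (u b))).im < (z.1 (LL z.1 (u a))).im := by
    have := LL_strict (U_inj z.2) hu
    simp only [Function.comp_apply, key_lt] at this
    rcases this with h | h
    · exact absurd h1 h.ne
    · exact h.2
  by_contra hc
  have hlt : LL z.1 (u a) < LL z.1 (u b) := by
    rcases (not_lt.1 hc).lt_or_eq with h | h
    · exact h
    · exact absurd ((LL z.1).injective h) hu.ne'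
  rcases (c.2 hlt.le).lt_or_eq with h | h
  · exact absurd ((z.2 _ _).1 h) (by rw [h1]; exact lt_irrefl _)
  · exact absurd ((z.2 _ _).2 hlt h) (lt_asymm h2)

theorem cOf_comp {n : ℕ} (z z' : Fin n → ℂ) (hz : Function.Injective z)
    (hz' : Function.Injective z') (w : Equiv.Perm (Fin n)) (h : z ∘ w = z') :
    cOf z hz = cOf z' hz' := by
  subst h
  apply Subtype.ext
  funext j
  have := congrFun (comp_LL_comp hz w) j
  exact congrArg Complex.re this.symm

theorem loc (i j : Ch (m + 1)) (x : UConfigSpace (m + 1)) (hi : x ∈ Set.range (hh i))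
    (hj : x ∈ Set.range (hh j)) :
    ∀ᶠ y in 𝓝 x, ff i y * (ff j y)⁻¹ = ff i x * (ff j x)⁻¹ := by
  obtain ⟨z, rfl⟩ := hi
  obtain ⟨z', hz'⟩ := hj
  have h1 := loc_aux i z
  have h2 := loc_aux j z'
  obtain ⟨w, hw⟩ := (hh_eq _ _ _ _).1 hz'
  rw [cOf_comp _ _ (U_inj z'.2) (U_inj z.2) w hw, hz'] at h2
  filter_upwards [h1, h2] with y hy1 hy2
  rw [hy1, hy2]; group

/-- The zero facet. -/
def zC (n : ℕ) : Ch n := ⟨fun _ => 0, fun _ _ _ => le_rfl⟩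

theorem joined_hh {n : ℕ} (c : Ch n) (z z' : U c) : Joined (hh c z) (hh c z') :=
  ⟨(PathConnectedSpace.somePath z z').map (hh c).continuous⟩

theorem joined (x y : UConfigSpace m) : Joined x y := by
  have key : ∀ x : UConfigSpace m, ∃ z : U (zC m), Joined x (hh _ z) := by
    intro x
    obtain ⟨c, z, rfl⟩ := cover x
    have h1 : (fun j => ⟨c.1 j, (j : ℕ)⟩ : Fin m → ℂ) ∈ U c :=
      fun i j => ⟨fun h => h, fun h _ => by simpa using h⟩
    have h2 : (fun j => ⟨c.1 j, (j : ℕ)⟩ : Fin m → ℂ) ∈ U (zC m) :=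
      fun i j => ⟨fun h => absurd h (lt_irrefl _), fun h _ => by simpa using h⟩
    refine ⟨⟨_, h2⟩, ?_⟩
    have := joined_hh c z ⟨_, h1⟩
    have e : hh c ⟨_, h1⟩ = hh (zC m) ⟨_, h2⟩ := (hh_eq _ _ _ _).2 ⟨1, rfl⟩
    rwa [e] at this
  obtain ⟨z, hz⟩ := key x
  obtain ⟨z', hz'⟩ := key y
  exact (hz.trans (joined_hh _ z z')).trans hz'.symm

end Loc

section Alg

variable {n : ℕ} {x₀ : UConfigSpace n} (e : ∀ x, Path.Homotopic.Quotient x₀ x)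

open Classical in
/-- Transport in a chart. -/
noncomputable def DD (c : Ch n) (z z' : Fin n → ℂ) : FundamentalGroup (UConfigSpace n) x₀ :=
  if h : z ∈ U c ∧ z' ∈ U c then TT e (hh c) ⟨z, h.1⟩ ⟨z', h.2⟩ else 1

theorem DD_eq (c : Ch n) {z z' : Fin n → ℂ} (h : z ∈ U c) (h' : z' ∈ U c) :
    DD e c z z' = TT e (hh c) ⟨z, h⟩ ⟨z', h'⟩ := dif_pos ⟨h, h'⟩

theorem DD_mul (c : Ch n) {z z' z'' : Fin n → ℂ} (h : z ∈ U c) (h' : z' ∈ U c) (h'' : z'' ∈ U c) :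
    DD e c z z' * DD e c z' z'' = DD e c z z'' := by
  rw [DD_eq e c h h', DD_eq e c h' h'', DD_eq e c h h'', TT_mul]

theorem DD_self (c : Ch n) {z : Fin n → ℂ} (h : z ∈ U c) : DD e c z z = 1 := by
  rw [DD_eq e c h h, TT_self]

theorem DD_inv (c : Ch n) {z z' : Fin n → ℂ} (h : z ∈ U c) (h' : z' ∈ U c) :
    (DD e c z z')⁻¹ = DD e c z' z := by
  rw [DD_eq e c h h', DD_eq e c h' h, TT_inv]

/-- The segment between two points in a chart. -/
noncomputable def seg (c : Ch n) (a b : U c) : C(I, U c) :=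
  ⟨fun t => ⟨(1 - (t : ℝ)) • a.1 + (t : ℝ) • b.1,
    U_convex c a.2 b.2 (by linarith [t.2.2]) t.2.1 (by ring)⟩, by
      refine Continuous.subtype_mk ?_ _
      fun_prop⟩

theorem seg_zero (c : Ch n) (a b : U c) : seg c a b 0 = a := by
  apply Subtype.ext; simp [seg]

theorem seg_one (c : Ch n) (a b : U c) : seg c a b 1 = b := by
  apply Subtype.ext; simp [seg]

theorem DD_comp (c c' : Ch n) (w : Equiv.Perm (Fin n)) {a b : Fin n → ℂ} (ha : a ∈ U c)
    (hb : b ∈ U c) (ha' : a ∘ w ∈ U c') (hb' : b ∘ w ∈ U c') :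
    DD e c a b = DD e c' (a ∘ w) (b ∘ w) := by
  rw [DD_eq e c ha hb, DD_eq e c' ha' hb']
  have h1 := TT_comp e (hh c) (seg c ⟨a, ha⟩ ⟨b, hb⟩) 0 1
  have h2 := TT_comp e (hh c') (seg c' ⟨_, ha'⟩ ⟨_, hb'⟩) 0 1
  rw [seg_zero, seg_one] at h1 h2
  rw [← h1, ← h2]
  have : (hh c).comp (seg c ⟨a, ha⟩ ⟨b, hb⟩) = (hh c').comp (seg c' ⟨_, ha'⟩ ⟨_, hb'⟩) := by
    ext t
    exact (hh_eq _ _ _ _).2 ⟨w, rfl⟩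
  rw [this]

theorem DD_congr (c c' : Ch n) {a b : Fin n → ℂ} (ha : a ∈ U c)
    (hb : b ∈ U c) (ha' : a ∈ U c') (hbb : b ∈ U c') :
    DD e c a b = DD e c' a b := DD_comp e c c' 1 ha hb ha' hbb

/-- The generic facet. -/
def iC (n : ℕ) : Ch n := ⟨fun j => (j : ℕ), fun a b h => by
  have hle : (a : ℕ) ≤ b := h
  simpa using hle⟩

/-- Standard points. -/
noncomputable def PP (u : Equiv.Perm (Fin n)) : Fin n → ℂ := fun j => ⟨((u⁻¹ j : Fin n) : ℕ), (j : ℕ)⟩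

theorem PP_comp (u : Equiv.Perm (Fin n)) (j : Fin n) : PP u (u j) = ⟨(j : ℕ), ((u j : Fin n) : ℕ)⟩ := by
  simp [PP]

theorem LL_PP (u : Equiv.Perm (Fin n)) : LL (PP u) = u := by
  apply LL_unique
  intro a b hab
  simp only [Function.comp_apply, key_lt, PP_comp]
  left; simpa using hab

theorem PP_mem {c : Ch n} {u : Equiv.Perm (Fin n)} (h : c.1 ∘ u = c.1) : PP u ∈ U c := by
  have h' : ∀ x, c.1 (u⁻¹ x) = c.1 x := fun x => by
    have := congrFun h (u⁻¹ x); simpa using this.symm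
  intro i j
  refine ⟨fun hij => ?_, fun hij _ => ?_⟩
  · rw [← h' i, ← h' j] at hij
    have := c.2.reflect_lt hij
    simpa [PP] using this
  · simpa [PP] using hij

theorem PP_mem_zC (u : Equiv.Perm (Fin n)) : PP u ∈ U (zC n) := PP_mem rfl

/-- Genericity: the real parts are distinct. -/
def Gen (y : Fin n → ℂ) : Prop := Function.Injective fun j => (y j).re

theorem Gen.inj {y : Fin n → ℂ} (h : Gen y) : Function.Injective y :=
  fun _ _ hab => h (congrArg Complex.re hab)

theorem Gen.comp {y : Fin n → ℂ} (h : Gen y) (w : Equiv.Perm (Fin n)) : Gen (y ∘ w) :=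
  fun _ _ hab => w.injective (h hab)

theorem Gen.mem {y : Fin n → ℂ} (h : Gen y) : y ∘ LL y ∈ U (iC n) := by
  have key : ∀ i j, i < j → (y (LL y i)).re < (y (LL y j)).re := by
    intro i j hij
    have := LL_strict h.inj hij
    simp only [Function.comp_apply, key_lt] at this
    rcases this with h1 | h1
    · exact h1
    · exact absurd ((LL y).injective (h h1.1)) hij.ne
  intro i j
  refine ⟨fun hij => key i j ?_, fun hij h' => ?_⟩
  · simpa [iC] using hij
  · have : (i : ℕ) = j := by simpa [iC] using h'
    exact absurd (Fin.ext this) hij.ne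

theorem PP_gen (u : Equiv.Perm (Fin n)) : Gen (PP u) := by
  intro a b hab
  have : u⁻¹ a = u⁻¹ b := by
    apply Fin.ext
    simpa [PP] using hab
  exact u⁻¹.injective this

theorem PP_one_mem : PP 1 ∈ U (iC n) := PP_mem (by rfl)

/-- Transport from the standard point to a generic point. -/
noncomputable def qq (y : Fin n → ℂ) : FundamentalGroup (UConfigSpace n) x₀ :=
  DD e (iC n) (PP 1) (y ∘ LL y)

theorem qq_comp {y : Fin n → ℂ} (h : Gen y) (w : Equiv.Perm (Fin n)) :
    qq e (y ∘ w) = qq e y := by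
  unfold qq; rw [comp_LL_comp h.inj]

/-- The half-twist elements. -/
noncomputable def RR (u : Equiv.Perm (Fin n)) : FundamentalGroup (UConfigSpace n) x₀ :=
  DD e (zC n) (PP 1) (PP u) * (qq e (PP u))⁻¹

theorem lem1 {c : Ch n} {y y' : Fin n → ℂ} (hy : y ∈ U c) (hy' : y' ∈ U c) (g : Gen y)
    (g' : Gen y') (hL : LL y = LL y') : qq e y * DD e c y y' = qq e y' := by
  have h1 : y' ∘ LL y ∈ U (iC n) := by rw [hL]; exact g'.mem
  rw [DD_comp e c (iC n) (LL y) hy hy' g.mem h1]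
  unfold qq
  rw [DD_mul e _ PP_one_mem g.mem h1, hL]

theorem lem2 {c : Ch n} {y y' : Fin n → ℂ} (hy : y ∈ U c) (hy' : y' ∈ U c) (g : Gen y)
    (g' : Gen y') : qq e y * DD e c y y' * (qq e y')⁻¹ = (RR e (LL y))⁻¹ * RR e (LL y') := by
  have p1 := PP_mem (c_LL hy)
  have p2 := PP_mem (c_LL hy')
  rw [← DD_mul e c hy p1 hy', ← DD_mul e c p1 p2 hy']
  have l1 := lem1 e hy p1 g (PP_gen _) (LL_PP _).symm
  have l2 := lem1 e p2 hy' (PP_gen _) g' (LL_PP _)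
  rw [← l2, ← mul_assoc, l1, DD_congr e c (zC n) p1 p2 (PP_mem_zC _) (PP_mem_zC _)]
  unfold RR
  rw [← DD_mul e (zC n) (PP_mem_zC _) (PP_mem_zC 1) (PP_mem_zC _),
    ← DD_inv e (zC n) (PP_mem_zC 1) (PP_mem_zC _)]
  group

theorem RR_one : RR e (1 : Equiv.Perm (Fin n)) = 1 := by
  unfold RR qq
  rw [LL_PP, DD_self e _ (PP_mem_zC 1)]
  have : PP 1 ∘ (1 : Equiv.Perm (Fin n)) = PP (n := n) 1 := rfl
  rw [this, DD_self e _ PP_one_mem]; group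

end Alg

section Alg2

variable {m : ℕ} {x₀ : UConfigSpace (m + 1)} (e : ∀ x, Path.Homotopic.Quotient x₀ x)

/-- The codimension one facet. -/
noncomputable def wC (i : Fin m) : Ch (m + 1) :=
  ⟨fun j => if (j : ℕ) ≤ i then ((j : ℕ) : ℝ) else (((j : ℕ) - 1 : ℕ) : ℝ), by
    intro a b hab
    have : (a : ℕ) ≤ b := hab
    dsimp only
    split_ifs <;> (norm_cast <;> omega)⟩

theorem wC_mem (i : Fin m) (z : Fin (m + 1) → ℂ)
    (h1 : ∀ a b, a < b → ¬ (a = i.castSucc ∧ b = i.succ) → (z a).re < (z b).re)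
    (h2 : (z i.castSucc).im < (z i.succ).im) : z ∈ U (wC i) := by
  intro a b
  refine ⟨fun h => ?_, fun hab h => ?_⟩
  · apply h1
    · exact (wC i).2.reflect_lt h
    · rintro ⟨rfl, rfl⟩
      simp [wC] at h
  · have : a = i.castSucc ∧ b = i.succ := by
      have hab' : (a : ℕ) < b := hab
      simp only [wC] at h
      have : (a : ℕ) = i ∧ (b : ℕ) = i + 1 := by
        split_ifs at h <;> (norm_cast at h; omega)
      exact ⟨Fin.ext (by simpa using this.1), Fin.ext (by simpa using this.2)⟩
    rw [this.1, this.2]; exact h2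

theorem RR_step (v : Equiv.Perm (Fin (m + 1))) (i : Fin m) (h : v i.castSucc < v i.succ) :
    RR e (v * st i) = RR e v * RR e (st i) := by
  have a1 : PP v ∘ v ∈ U (wC i) := by
    apply wC_mem
    · intro a b hab _
      simp only [Function.comp_apply, PP_comp]; simpa using hab
    · simp only [Function.comp_apply, PP_comp]; simpa using h
  have hb : ∀ j, PP (v * st i) (v j) = ⟨((st i j : Fin (m + 1)) : ℕ), ((v j : Fin (m + 1)) : ℕ)⟩ := by
    intro j; simp [PP]
  have b1 : PP (v * st i) ∘ v ∈ U (wC i) := by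
    apply wC_mem
    · intro a b hab hne
      simp only [Function.comp_apply, hb]
      simpa using st_lt i a b hab hne
    · simp only [Function.comp_apply, hb]; simpa using h
  have l := lem2 e a1 b1 ((PP_gen _).comp _) ((PP_gen _).comp _)
  rw [qq_comp e (PP_gen _), qq_comp e (PP_gen _), LL_comp (PP_gen _).inj, LL_comp (PP_gen _).inj,
    LL_PP, LL_PP, ← DD_comp e (zC _) _ v (PP_mem_zC _) (PP_mem_zC _) a1 b1] at l
  have l' := lem2 e (PP_mem_zC v) (PP_mem_zC (v * st i)) (PP_gen _) (PP_gen _)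
  rw [LL_PP, LL_PP, l, inv_mul_cancel, RR_one, inv_mul_cancel_left, inv_one, one_mul] at l'
  rw [l']; group

theorem st_ascent (i j : Fin m) (h : i ≠ j) : st i j.castSucc < st i j.succ := by
  apply st_lt _ _ _ Fin.castSucc_lt_succ
  rintro ⟨h1, _⟩
  exact h (Fin.castSucc_injective _ h1).symm

theorem RR_comm (i j : Fin m) (h : (i : ℕ) + 1 < j) :
    RR e (st i) * RR e (st j) = RR e (st j) * RR e (st i) := by
  have hne : i ≠ j := by rintro rfl; omega
  rw [← RR_step e _ _ (st_ascent i j hne), ← RR_step e _ _ (st_ascent j i hne.symm), st_comm i j h]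

theorem RR_braid (i j : Fin m) (h : (j : ℕ) = i + 1) :
    RR e (st i) * RR e (st j) * RR e (st i) = RR e (st j) * RR e (st i) * RR e (st j) := by
  have hne : i ≠ j := by rintro rfl; omega
  have e0 : i.succ = j.castSucc := by ext; simp [h]
  rw [← RR_step e _ _ (st_ascent i j hne), ← RR_step e _ _ (st_ascent j i hne.symm),
    ← RR_step, ← RR_step, st_braid i j h]
  · rw [Equiv.Perm.mul_apply, Equiv.Perm.mul_apply]
    apply st_lt _ _ _ (st_ascent i j hne)
    rintro ⟨h1, _⟩
    rw [← e0, st_succ] at h1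
    have := congrArg Fin.val h1; simp at this
  · rw [Equiv.Perm.mul_apply, Equiv.Perm.mul_apply]
    apply st_lt _ _ _ (st_ascent j i hne.symm)
    rintro ⟨_, h1⟩
    rw [e0, st_castSucc] at h1
    have := congrArg Fin.val h1; simp at this

/-- The homomorphism from the braid group. -/
noncomputable def phi : BraidGroup (m + 1) →* FundamentalGroup (UConfigSpace (m + 1)) x₀ :=
  PresentedGroup.toGroup (rels := braidRels (m + 1)) (f := fun i : Fin m => RR e (st i)) (by
    rintro r (⟨i, j, h, rfl⟩ | ⟨i, j, h, rfl⟩)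
    · rw [map_mul, map_inv, mul_inv_eq_one]
      simp only [map_mul, FreeGroup.lift_apply_of]
      exact RR_comm e i j h
    · rw [map_mul, map_inv, mul_inv_eq_one]
      simp only [map_mul, FreeGroup.lift_apply_of]
      exact RR_braid e i j h)

theorem phi_sg (i : Fin m) : phi e (sg i) = RR e (st i) := PresentedGroup.toGroup.of _

theorem phi_mat (u : Equiv.Perm (Fin (m + 1))) : phi e (mat u) = RR e u := by
  refine ascent_induction (fun u => phi e (mat u) = RR e u) ?_ ?_ u
  · rw [mat_one, map_one, RR_one]
  · intro v i h ih
    rw [mat_step _ _ h, map_mul, ih, phi_sg, RR_step e _ _ h]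

end Alg2
end BraidProof


namespace BraidProof
open Topology unitInterval

section Surj

variable {n : ℕ} {x₀ : UConfigSpace n} (e : ∀ x, Path.Homotopic.Quotient x₀ x)

/-- Generic perturbation. -/
noncomputable def yy (z : Fin n → ℂ) : Fin n → ℂ :=
  fun j => ⟨(z j).re + (((LL z)⁻¹ j : Fin n) : ℕ), (z j).im⟩

theorem yy_comp {z : Fin n → ℂ} (hz : Function.Injective z) (w : Equiv.Perm (Fin n)) :
    yy (z ∘ w) = yy z ∘ w := by
  funext j
  simp [yy, LL_comp hz]

theorem yy_aux {z : Fin n → ℂ} (hz : Function.Injective z) (a b : Fin n) (hab : a < b) :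
    (yy z (LL z a)).re < (yy z (LL z b)).re := by
  have := LL_strict hz hab
  simp only [Function.comp_apply, key_lt] at this
  have h1 : (z (LL z a)).re ≤ (z (LL z b)).re := by
    rcases this with h | h
    · exact h.le
    · exact h.1.le
  have h2 : ((a : ℕ) : ℝ) < (b : ℕ) := by exact_mod_cast hab
  have i1 : ∀ x, (LL z)⁻¹ (LL z x) = x := fun x => by simp
  simp only [yy, i1]
  linarith

theorem LL_yy {z : Fin n → ℂ} (hz : Function.Injective z) : LL (yy z) = LL z := by
  apply LL_unique
  intro a b hab
  simp only [Function.comp_apply, key_lt]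
  exact Or.inl (yy_aux hz a b hab)

theorem yy_gen {z : Fin n → ℂ} (hz : Function.Injective z) : Gen (yy z) := by
  have h : StrictMono fun j => (yy z (LL z j)).re := fun a b hab => yy_aux hz a b hab
  intro a b hab
  have := h.injective (a₁ := (LL z)⁻¹ a) (a₂ := (LL z)⁻¹ b) (by simpa using hab)
  exact (LL z)⁻¹.injective this

theorem yy_mem {c : Ch n} {z : Fin n → ℂ} (hz : z ∈ U c) : yy z ∈ U c := by
  intro i j
  refine ⟨fun h => ?_, fun h h' => (hz i j).2 h h'⟩
  have h1 := (hz i j).1 h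
  have h2 : (LL z)⁻¹ i < (LL z)⁻¹ j := by
    rw [← (LL_strict (U_inj hz)).lt_iff_lt]
    have i1 : ∀ x, LL z ((LL z)⁻¹ x) = x := fun x => by simp
    simp only [Function.comp_apply, key_lt, i1]
    exact Or.inl h1
  have h3 : ((((LL z)⁻¹ i : Fin n) : ℕ) : ℝ) < (((LL z)⁻¹ j : Fin n) : ℕ) := by exact_mod_cast h2
  simp only [yy]
  linarith

/-- Transport to the generic perturbation. -/
noncomputable def kap (z : ConfigSpace n) : FundamentalGroup (UConfigSpace n) x₀ :=
  DD e (cOf z.1 z.2) (z.1 ∘ LL z.1) (yy (z.1 ∘ LL z.1))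

/-- The gauge. -/
noncomputable def mm (z : ConfigSpace n) : FundamentalGroup (UConfigSpace n) x₀ :=
  qq e (yy z.1) * (kap e z)⁻¹

theorem mm_congr (z z' : ConfigSpace n) (w : Equiv.Perm (Fin n)) (h : z.1 ∘ w = z'.1) :
    mm e z = mm e z' := by
  obtain ⟨z', hz'⟩ := z'
  simp only at h
  subst h
  unfold mm kap
  rw [cOf_comp z.1 _ z.2 hz' w rfl]
  dsimp only
  rw [comp_LL_comp z.2, yy_comp z.2 w, qq_comp e (yy_gen z.2)]

theorem kap_eq {c : Ch n} (z : U c) :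
    DD e c z.1 (yy z.1) = kap e ⟨z.1, U_inj z.2⟩ := by
  unfold kap
  have h1 := mem_cOf z.1 (U_inj z.2)
  have h2 := yy_mem h1
  rw [yy_comp (U_inj z.2)] at h2 ⊢
  exact DD_comp e _ _ _ z.2 (yy_mem z.2) h1 h2

/-- The gauge on the quotient. -/
noncomputable def MM (x : UConfigSpace n) : FundamentalGroup (UConfigSpace n) x₀ := mm e x.out

theorem MM_pr (z : ConfigSpace n) : MM e (pr z) = mm e z := by
  obtain ⟨w, hw⟩ := (pr_eq _ _).1 (Quotient.out_eq (pr z))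
  exact mm_congr e _ _ w hw

theorem MM_hh {c : Ch n} (z : U c) : MM e (hh c z) = qq e (yy z.1) * (DD e c z.1 (yy z.1))⁻¹ := by
  rw [kap_eq]
  exact MM_pr e _

theorem MM_DD {c : Ch n} (z z' : U c) :
    MM e (hh c z) * TT e (hh c) z z' * (MM e (hh c z'))⁻¹ = (RR e (LL z.1))⁻¹ * RR e (LL z'.1) := by
  have h := lem2 e (yy_mem z.2) (yy_mem z'.2) (yy_gen (U_inj z.2)) (yy_gen (U_inj z'.2))
  rw [LL_yy (U_inj z.2), LL_yy (U_inj z'.2)] at h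
  rw [← h, MM_hh, MM_hh, ← DD_mul e c (yy_mem z.2) z.2 (yy_mem z'.2),
    ← DD_mul e c z.2 z'.2 (yy_mem z'.2), ← DD_inv e c z.2 (yy_mem z.2), DD_eq e c z.2 z'.2]
  group

open Path.Homotopic.Quotient in
theorem ofPath_surj (g : FundamentalGroup (UConfigSpace n) x₀) :
    ∃ γ : Path x₀ x₀, ofPath e (Path.Homotopic.Quotient.mk γ) = g := by
  obtain ⟨γ, hγ⟩ := Path.Homotopic.Quotient.mk_surjective
    (((e x₀).symm.trans (FundamentalGroup.toPath g).symm).trans (e x₀))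
  refine ⟨γ, ?_⟩
  unfold ofPath
  rw [hγ, quot_symm_trans, quot_symm_trans]
  have hs : ∀ {a b : UConfigSpace n} (p : Path.Homotopic.Quotient a b), p.symm.symm = p := by
    intro a b p
    have h : p.symm.symm = (p.trans p.symm).trans p.symm.symm := by
      rw [trans_symm, refl_trans]
    rw [h, trans_assoc, trans_symm, trans_refl]
  rw [hs, hs]
  simp only [trans_assoc]
  rw [trans_symm, trans_refl, ← trans_assoc (e x₀), trans_symm, refl_trans]

end Surj

variable {m : ℕ} {x₀ : UConfigSpace (m + 1)} (e : ∀ x, Path.Homotopic.Quotient x₀ x)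

theorem phi_surj : Function.Surjective (phi e) := by
  intro g
  obtain ⟨γ, hγ⟩ := ofPath_surj e ((MM e x₀)⁻¹ * g * MM e x₀)
  have := TT_mem e (fun c : Ch (m + 1) => U c) hh hh_open cover (MM e) (phi e).range (by
    intro c z z'
    rw [MM_DD, ← phi_mat, ← phi_mat, ← map_inv, ← map_mul]
    exact ⟨_, rfl⟩) γ.toContinuousMap 0 1
  rw [TT_path, hγ] at this
  have k0 : γ.toContinuousMap 0 = x₀ := γ.source
  have k1 : γ.toContinuousMap 1 = x₀ := γ.target
  rw [k0, k1] at this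
  obtain ⟨b, hb⟩ := this
  refine ⟨b, hb.trans ?_⟩
  group

theorem phi_inj : Function.Injective (phi e) := by
  obtain ⟨ψ, η, hψ⟩ := exists_hom (G := BraidGroup (m + 1)) e (V := fun c => Set.range (hh c)) (f := ff)
    (fun c => (hh_open c).isOpen_range) cover loc
  have h1 : ∀ c : Ch (m + 1), ∀ z z' : U c, ψ (TT e (hh c) z z') =
      η (hh c z) * ((mat (LL z.1))⁻¹ * mat (LL z'.1)) * (η (hh c z'))⁻¹ := by
    intro c z z'
    rw [hψ _ (hh c) c (fun a => ⟨a, rfl⟩), ff_hh, ff_hh]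
  have h2 : ∀ u, ψ (RR e u) = η (hh (zC _) ⟨PP 1, PP_mem_zC 1⟩) * mat u *
      (η (hh (zC _) ⟨PP 1, PP_mem_zC 1⟩))⁻¹ := by
    intro u
    unfold RR qq
    rw [DD_eq e _ (PP_mem_zC 1) (PP_mem_zC u), DD_eq e _ PP_one_mem (PP_gen u).mem, map_mul, map_inv,
      h1, h1, LL_comp (PP_gen u).inj]
    have e1 : hh (iC _) ⟨PP 1, PP_one_mem⟩ = hh (zC (m + 1)) ⟨PP 1, PP_mem_zC 1⟩ :=
      (hh_eq _ _ _ _).2 ⟨1, rfl⟩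
    have e2 : hh (iC _) ⟨_, (PP_gen u).mem⟩ = hh (zC (m + 1)) ⟨PP u, PP_mem_zC u⟩ :=
      ((hh_eq _ _ _ _).2 ⟨_, rfl⟩).symm
    rw [e1, e2, inv_mul_cancel]
    simp only [LL_PP, mat_one]
    group
  set k := η (hh (zC _) ⟨PP 1, PP_mem_zC 1⟩)
  have h3 : ψ.comp (phi e) = (MulAut.conj k).toMonoidHom := by
    apply PresentedGroup.ext
    intro (i : Fin m)
    change ψ (phi e (sg i)) = k * sg i * k⁻¹
    rw [phi_sg, h2, mat_st]
  intro a b hab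
  have : (ψ.comp (phi e)) a = (ψ.comp (phi e)) b := by
    simp only [MonoidHom.comp_apply, hab]
  rw [h3] at this
  exact (MulAut.conj k).injective this

end BraidProof

/-- The braid group on `n` strands (given by the Artin presentation) is isomorphic to the
fundamental group of the unordered configuration space of `n` points in `ℂ`. -/
theorem braidGroup_iso_fundamentalGroup_configSpace (n : ℕ) (hn : 1 ≤ n)
    (x : UConfigSpace n) :
    Nonempty (FundamentalGroup (UConfigSpace n) x ≃* BraidGroup n) := by
  obtain ⟨m, rfl⟩ : ∃ m, n = m + 1 := ⟨n - 1, by omega⟩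
  let e : ∀ y, Path.Homotopic.Quotient x y := fun y => .mk (BraidProof.joined x y).somePath
  exact ⟨(MulEquiv.ofBijective (BraidProof.phi e)
    ⟨BraidProof.phi_inj e, BraidProof.phi_surj e⟩).symm⟩
end

section
/- (Fadell–Neuwirth) For every n ≥ 1, the ordered configuration space M_n of n points in ℂ and the unordered configuration space N_n = M_n/Σ_n are aspherical: for every k ≥ 2 and every base point, the k-th homotopy group π_k(M_n) is trivial, and likewise π_k(N_n) is trivial. -/
namespace FN
section
open unitInterval Topology

/-- maps of the cube which are constant on the boundary -/
def BConst {k : ℕ} {X : Type*} [TopologicalSpace X] (f : C(Fin k → I, X)) : Prop :=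
  ∀ a ∈ Cube.boundary (Fin k), ∀ b ∈ Cube.boundary (Fin k), f a = f b

/-- every map of the `k`-cube constant on the boundary is freely null-homotopic -/
def Asph (k : ℕ) (X : Type*) [TopologicalSpace X] : Prop :=
  ∀ f : C(Fin k → I, X), BConst f →
    ∃ c : X, ContinuousMap.HomotopicWith f (ContinuousMap.const _ c) BConst

variable {k : ℕ} {X Y : Type*} [TopologicalSpace X] [TopologicalSpace Y]

/-- constructor from a continuous function -/
theorem homotopicWith_of {f g : C(Fin k → I, X)} (F : I × (Fin k → I) → X) (hF : Continuous F)
    (h0 : ∀ a, F (0, a) = f a) (h1 : ∀ a, F (1, a) = g a)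
    (hb : ∀ t, ∀ a ∈ Cube.boundary (Fin k), ∀ b ∈ Cube.boundary (Fin k), F (t, a) = F (t, b)) :
    ContinuousMap.HomotopicWith f g BConst :=
  ⟨{ toFun := F, continuous_toFun := hF, map_zero_left := h0, map_one_left := h1,
     prop' := fun t a ha b hb' => hb t a ha b hb' }⟩

theorem homotopicWith_map {f g : C(Fin k → I, X)} (h : ContinuousMap.HomotopicWith f g BConst)
    (φ : C(X, Y)) : ContinuousMap.HomotopicWith (φ.comp f) (φ.comp g) BConst := by
  obtain ⟨F⟩ := h
  refine homotopicWith_of (fun p => φ (F p)) (by fun_prop) (by simp) (by simp) ?_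
  intro t a ha b hb
  exact congrArg φ (F.prop t a ha b hb)

theorem asph_of_homotopic {f g : C(Fin k → I, X)}
    (h : ContinuousMap.HomotopicWith f g BConst)
    (hg : ∃ c : X, ContinuousMap.HomotopicWith g (ContinuousMap.const _ c) BConst) :
    ∃ c : X, ContinuousMap.HomotopicWith f (ContinuousMap.const _ c) BConst := by
  obtain ⟨c, hc⟩ := hg
  exact ⟨c, h.trans hc⟩

theorem BConst.right {f g : C(Fin k → I, X)}
    (h : ContinuousMap.HomotopicWith f g BConst) : BConst g := by
  obtain ⟨F⟩ := h
  intro a ha b hb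
  have := F.prop 1 a ha b hb
  simpa using this

theorem boundary_isPreconnected (hk : 2 ≤ k) : IsPreconnected (Cube.boundary (Fin k)) := by
  -- faces
  have face : ∀ (i : Fin k) (e : I), IsPreconnected {a : Fin k → I | a i = e} := by
    intro i e
    have : {a : Fin k → I | a i = e} = Set.range (fun a : Fin k → I => Function.update a i e) := by
      ext a; constructor
      · intro h; exact ⟨a, by simp only [Set.mem_ofPred_eq] at h; rw [← h]; simp⟩
      · rintro ⟨b, rfl⟩; simp
    rw [this]
    exact isPreconnected_range (by fun_prop)
  let i0 : Fin k := ⟨0, by omega⟩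
  let i1 : Fin k := ⟨1, by omega⟩
  have h01 : i0 ≠ i1 := by simp [i0, i1, Fin.ext_iff]
  refine isPreconnected_of_forall (x := fun _ => 0) ?_
  intro a ha
  obtain ⟨i, hi⟩ := ha
  have hsub : ∀ (j : Fin k) (e : I), (e = 0 ∨ e = 1) → {a : Fin k → I | a j = e} ⊆ Cube.boundary (Fin k) := by
    intro j e he b hb
    exact ⟨j, by rw [show b j = e from hb]; exact he⟩
  obtain ⟨j, hj⟩ : ∃ j : Fin k, j ≠ i := by
    by_cases h : i = i0
    · exact ⟨i1, by rw [h]; exact h01.symm⟩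
    · exact ⟨i0, fun h' => h h'.symm⟩
  refine ⟨{b | b i = a i} ∪ {b | b j = 0}, ?_, ?_, ?_, ?_⟩
  · exact Set.union_subset (hsub _ _ hi) (hsub _ _ (Or.inl rfl))
  · right; rfl
  · left; rfl
  · refine (face i (a i)).union (Function.update (fun _ => 0) i (a i)) ?_ ?_ (face j 0)
    · simp
    · simp [hj]

theorem asph_of_covering (hk : 2 ≤ k) {E : Type*} [TopologicalSpace E] {p : E → X}
    (cov : IsCoveringMap p) (hp : Function.Surjective p) (hE : Asph k E) : Asph k X := by
  intro f hf
  -- lift f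
  let m : C(I × (Fin k → I), Fin k → I) := ⟨fun q i => q.1 * q.2 i, by fun_prop⟩
  obtain ⟨e, he⟩ := hp (f 0)
  have H0 : ∀ a, (f.comp m) (0, a) = p (ContinuousMap.const _ e a) := by
    intro a
    have : m (0, a) = 0 := by ext i; simp [m]
    simp [this, he]
  let L := cov.liftHomotopy (f.comp m) (ContinuousMap.const _ e) H0
  have hL := cov.liftHomotopy_lifts (f.comp m) (ContinuousMap.const _ e) H0
  let g : C(Fin k → I, E) := L.comp ⟨fun a => (1, a), by fun_prop⟩
  have hg : ∀ a, p (g a) = f a := by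
    intro a
    have h2 := congrFun hL (1, a)
    have : m (1, a) = a := by ext i; simp [m]
    simp only [ContinuousMap.comp_apply, Function.comp_apply, this] at h2
    exact h2
  have hgb : BConst g := by
    intro a ha b hb
    exact cov.constOn_of_comp (boundary_isPreconnected hk) g.continuous.continuousOn
      (fun a ha b hb => by rw [hg, hg]; exact hf a ha b hb) ha hb
  obtain ⟨c, hc⟩ := hE g hgb
  refine ⟨p c, ?_⟩
  have := homotopicWith_map hc ⟨p, cov.continuous⟩
  have e1 : f = ContinuousMap.comp ⟨p, cov.continuous⟩ g := by ext a; exact (hg a).symm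
  rw [e1]
  exact this

theorem asph_subsingleton (hk : 1 ≤ k) (h : Asph k X) (x : X) :
    Subsingleton (HomotopyGroup.Pi k X x) := by
  suffices key : ∀ f : GenLoop (Fin k) X x, GenLoop.Homotopic f GenLoop.const by
    constructor
    intro p q
    induction p using Quotient.inductionOn with
    | h f =>
      induction q using Quotient.inductionOn with
      | h g => exact Quotient.sound ((key f).trans (key g).symm)
  intro f
  obtain ⟨c, ⟨F⟩⟩ := h f.1 (fun a ha b hb => by rw [f.2 a ha, f.2 b hb])
  have hFb : ∀ t, ∀ a ∈ Cube.boundary (Fin k), ∀ b ∈ Cube.boundary (Fin k),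
      F (t, a) = F (t, b) := fun t a ha b hb => F.prop t a ha b hb
  have hz : (0 : Fin k → I) ∈ Cube.boundary (Fin k) := ⟨⟨0, hk⟩, Or.inl rfl⟩
  let pr : ℝ → I := Set.projIcc (0 : ℝ) 1 zero_le_one
  have hpr : Continuous pr := continuous_projIcc
  have pr0 : ∀ r : ℝ, r ≤ 0 → pr r = 0 := fun r hr => Set.projIcc_of_le_left _ hr
  have pr1 : ∀ r : ℝ, 1 ≤ r → pr r = 1 := fun r hr => Set.projIcc_of_right_le _ hr
  have prI : ∀ r : I, pr (r : ℝ) = r := fun r => Set.projIcc_val _ r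
  let T : (Fin k → I) → I := fun a => ∏ i, pr (16 / 3 * (a i : ℝ) * (1 - a i))
  have hT : Continuous T := by
    refine continuous_finsetProd _ fun i _ => hpr.comp (by fun_prop)
  let S : I → (Fin k → I) → (Fin k → I) := fun s a i =>
    pr ((1 - s) * (a i : ℝ) + s * (pr (2 * (a i : ℝ) - 1 / 2) : ℝ))
  have hS : Continuous (fun q : I × (Fin k → I) => S q.1 q.2) := by
    refine continuous_pi fun i => hpr.comp ?_
    have : Continuous (fun q : I × (Fin k → I) => ((pr (2 * (q.2 i : ℝ) - 1 / 2) : I) : ℝ)) :=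
      continuous_subtype_val.comp (hpr.comp (by fun_prop))
    fun_prop
  have hTb : ∀ a ∈ Cube.boundary (Fin k), T a = 0 := by
    rintro a ⟨i, hi⟩
    refine Finset.prod_eq_zero (Finset.mem_univ i) (pr0 _ ?_)
    rcases hi with hi | hi <;> simp [hi]
  have hSb : ∀ s, ∀ a ∈ Cube.boundary (Fin k), S s a ∈ Cube.boundary (Fin k) := by
    rintro s a ⟨i, hi⟩
    refine ⟨i, ?_⟩
    rcases hi with hi | hi
    · left
      simp only [S, hi]
      apply pr0
      simp [pr0]
    · right
      simp only [S, hi]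
      apply pr1
      have : pr (2 * ((1 : I) : ℝ) - 1 / 2) = 1 := pr1 _ (by norm_num)
      rw [this]; simp
  have hS0 : ∀ a, S 0 a = a := by
    intro a; ext i; simp [S, prI]
  have hend : ∀ a, F (T a, S 1 a) = F (T a, 0) := by
    intro a
    by_cases hmid : ∀ i, (1 / 4 : ℝ) ≤ a i ∧ (a i : ℝ) ≤ 3 / 4
    · have : T a = 1 := Finset.prod_eq_one fun i _ => pr1 _ (by
        have := hmid i
        nlinarith)
      rw [this]; simp
    · push Not at hmid
      obtain ⟨i, hi⟩ := hmid
      refine hFb _ _ ⟨i, ?_⟩ _ hz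
      by_cases h4 : (1 / 4 : ℝ) ≤ a i
      · right
        have : pr (2 * (a i : ℝ) - 1 / 2) = 1 := pr1 _ (by linarith [hi h4])
        simp only [S, this]
        simp [pr1]
      · left
        have : pr (2 * (a i : ℝ) - 1 / 2) = 0 := pr0 _ (by linarith [not_le.1 h4])
        simp only [S, this]
        simp [pr0]
  have hF0 : ∀ a ∈ Cube.boundary (Fin k), F (0, a) = x := by
    intro a ha
    rw [F.apply_zero]; exact f.2 a ha
  let g : C(Fin k → I, X) := ⟨fun a => F (T a, 0), by fun_prop⟩
  have h1 : f.1.HomotopicRel g (Cube.boundary (Fin k)) := by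
    refine ⟨{ toFun := fun q => F (q.1 * T q.2, S q.1 q.2), continuous_toFun := ?_,
              map_zero_left := ?_, map_one_left := ?_, prop' := ?_ }⟩
    · fun_prop
    · intro a; simp [hS0]
    · intro a; simp [hend, g]
    · intro t a ha
      change F (t * T a, S t a) = f.1 a
      rw [hTb a ha, mul_zero, hF0 _ (hSb t a ha), f.2 a ha]
  have h2 : g.HomotopicRel (GenLoop.const : GenLoop (Fin k) X x).1 (Cube.boundary (Fin k)) := by
    refine ⟨{ toFun := fun q => F (σ q.1 * T q.2, 0), continuous_toFun := ?_,
              map_zero_left := ?_, map_one_left := ?_, prop' := ?_ }⟩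
    · fun_prop
    · intro a; simp [g]
    · intro a
      simp only [unitInterval.symm_one, zero_mul]
      exact hF0 _ hz
    · intro t a ha
      change F (σ t * T a, 0) = F (T a, 0)
      rw [hTb a ha, mul_zero]
  exact h1.trans h2
end
end FN

namespace FN
section
open unitInterval Topology

/-! ### free group of rank two -/
abbrev G := FreeGroup Bool

instance : TopologicalSpace G := ⊥
instance : DiscreteTopology G := ⟨rfl⟩

/-- the one-letter word -/
def lt (x : Bool × Bool) : G := FreeGroup.mk [x]

theorem toWord_lt_mul (x : Bool × Bool) (g : G) :
    (lt x * g).toWord = FreeGroup.reduce (x :: g.toWord) := by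
  rw [lt, ← FreeGroup.mk_toWord (x := g), FreeGroup.mul_mk]
  simp only [FreeGroup.toWord_mk, List.singleton_append, FreeGroup.reduce_toWord]

theorem toWord_cases (x : Bool × Bool) (g : G) :
    (g.toWord = [] ∧ (lt x * g).toWord = [x]) ∨
    (∃ hd tl, g.toWord = hd :: tl ∧
      (((x.1 = hd.1 ∧ x.2 = not hd.2) ∧ (lt x * g).toWord = tl) ∨
       (¬ (x.1 = hd.1 ∧ x.2 = not hd.2) ∧ (lt x * g).toWord = x :: hd :: tl))) := by
  rw [toWord_lt_mul, FreeGroup.reduce.cons, FreeGroup.reduce_toWord]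
  rcases h : g.toWord with _ | ⟨hd, tl⟩
  · simp
  · right
    refine ⟨hd, tl, rfl, ?_⟩
    by_cases h2 : x.1 = hd.1 ∧ x.2 = not hd.2
    · left; exact ⟨h2, by simp only [if_pos h2]⟩
    · right; exact ⟨h2, by simp only [if_neg h2]⟩

theorem norm_lt_mul (x : Bool × Bool) (g : G) :
    (lt x * g).norm = g.norm + 1 ∨ (lt x * g).norm + 1 = g.norm := by
  unfold FreeGroup.norm
  rcases toWord_cases x g with ⟨h1, h2⟩ | ⟨hd, tl, h1, ⟨_, h2⟩ | ⟨_, h2⟩⟩ <;> rw [h1, h2] <;> simp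

theorem parent_unique {x y : Bool × Bool} {g : G} (hx : (lt x * g).norm < g.norm)
    (hy : (lt y * g).norm < g.norm) : x = y := by
  unfold FreeGroup.norm at hx hy
  rcases toWord_cases x g with ⟨h1, h2⟩ | ⟨hd, tl, h1, ⟨h3, h2⟩ | ⟨_, h2⟩⟩
  · rw [h1] at hx; simp at hx
  · rcases toWord_cases y g with ⟨h1', h2'⟩ | ⟨hd', tl', h1', ⟨h3', h2'⟩ | ⟨_, h2'⟩⟩
    · rw [h1'] at hy; simp at hy
    · rw [h1] at h1'
      obtain ⟨rfl, rfl⟩ := List.cons.inj h1'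
      exact Prod.ext (h3.1.trans h3'.1.symm) (h3.2.trans h3'.2.symm)
    · rw [h1', h2'] at hy; simp at hy
  · rw [h1, h2] at hx; simp at hx

theorem parent_exists {g : G} {N : ℕ} (h : g.norm = N + 1) : ∃ x, (lt x * g).norm = N := by
  unfold FreeGroup.norm at h ⊢
  rcases hg : g.toWord with _ | ⟨hd, tl⟩
  · rw [hg] at h; simp at h
  · refine ⟨(hd.1, !hd.2), ?_⟩
    rcases toWord_cases (hd.1, !hd.2) g with ⟨h1, h2⟩ | ⟨hd', tl', h1, ⟨h3, h2⟩ | ⟨h3, h2⟩⟩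
    · rw [h1] at hg; simp at hg
    · rw [h2]
      rw [h1] at h; simpa using h
    · rw [h1] at hg
      obtain ⟨rfl, rfl⟩ := List.cons.inj hg
      simp at h3

/-! ### the punctured plane and its covering -/

abbrev X0 := {p : ℝ × ℝ // ∀ n : ℤ, p ≠ ((n : ℝ), 0)}

def sgn (i : Bool) : ℝ := if i then 1 else -1

def U (i : Bool) : Set X0 := {z | (∀ n : ℤ, z.1.1 ≠ n) ∨ 0 < sgn i * z.1.2}

theorem isOpen_U (i : Bool) : IsOpen (U i) := by
  have h1 : IsOpen {z : X0 | ∀ n : ℤ, z.1.1 ≠ n} := by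
    have : {z : X0 | ∀ n : ℤ, z.1.1 ≠ n} = (fun z : X0 => z.1.1) ⁻¹' (Set.range ((↑) : ℤ → ℝ))ᶜ := by
      ext z
      simp only [Set.mem_ofPred_eq, Set.mem_preimage, Set.mem_compl_iff, Set.mem_range, not_exists]
      exact ⟨fun h n h' => h n h'.symm, fun h n h' => h n h'.symm⟩
    rw [this]
    exact (Int.isClosedEmbedding_coe_real.isClosed_range.isOpen_compl).preimage (by fun_prop)
  have h2 : IsOpen {z : X0 | 0 < sgn i * z.1.2} := isOpen_lt (by fun_prop) (by fun_prop)
  exact h1.union h2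

theorem nonint_of_mem {i j : Bool} (hij : i ≠ j) {z : X0} (hi : z ∈ U i) (hj : z ∈ U j) (n : ℤ) :
    z.1.1 ≠ n := by
  rcases hi with hi | hi
  · exact hi n
  rcases hj with hj | hj
  · exact hj n
  exfalso
  revert hi hj
  cases i <;> cases j <;> simp_all [sgn] <;> intros <;> linarith

noncomputable def ix (z : X0) : Bool := if 0 ≤ z.1.2 then true else false

theorem mem_ix (z : X0) : z ∈ U (ix z) := by
  unfold ix U
  split_ifs with h
  · by_cases h0 : z.1.2 = 0
    · left
      intro n hn
      exact z.2 n (Prod.ext hn h0)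
    · right
      simp only [sgn, if_true, one_mul]
      exact lt_of_le_of_ne h (Ne.symm h0)
  · right
    simp only [sgn]
    simp at h ⊢
    exact h

noncomputable def cc (i : Bool) (z : X0) : G := FreeGroup.of i ^ ⌊z.1.1⌋

theorem floor_eventually {z : X0} (hz : ∀ n : ℤ, z.1.1 ≠ n) : ∀ᶠ z' in 𝓝 z, ⌊z'.1.1⌋ = ⌊z.1.1⌋ := by
  have h : IsOpen {z' : X0 | (⌊z.1.1⌋ : ℝ) < z'.1.1 ∧ z'.1.1 < ⌊z.1.1⌋ + 1} :=
by
    have h1 : IsOpen {z' : X0 | (⌊z.1.1⌋ : ℝ) < z'.1.1} := isOpen_lt (by fun_prop) (by fun_prop)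
    have h2 : IsOpen {z' : X0 | z'.1.1 < (⌊z.1.1⌋ : ℝ) + 1} := isOpen_lt (by fun_prop) (by fun_prop)
    exact h1.inter h2
  filter_upwards [h.mem_nhds ⟨lt_of_le_of_ne (Int.floor_le _) (hz _).symm, Int.lt_floor_add_one _⟩]
    with z' hz'
  exact Int.floor_eq_iff.2 ⟨hz'.1.le, hz'.2⟩

noncomputable def Z : FiberBundleCore Bool X0 G where
  baseSet := U
  isOpen_baseSet := isOpen_U
  indexAt := ix
  mem_baseSet_at := mem_ix
  coordChange i j z v := (cc j z)⁻¹ * (cc i z * v)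
  coordChange_self := by intro i z _ v; simp
  coordChange_comp := by intros; simp
  continuousOn_coordChange := by
    intro i j
    by_cases hij : i = j
    · subst hij
      simp only [inv_mul_cancel_left]
      exact continuousOn_snd
    · rintro ⟨z, v⟩ ⟨⟨hi, hj⟩, -⟩
      apply ContinuousAt.continuousWithinAt
      have hz := nonint_of_mem hij hi hj
      have hc : Continuous (fun p : X0 × G => (cc j z)⁻¹ * (cc i z * p.2)) :=
        (continuous_of_discreteTopology (f := fun v : G => (cc j z)⁻¹ * (cc i z * v))).comp
          continuous_snd
      refine hc.continuousAt.congr ?_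
      have := (continuous_fst (X := X0) (Y := G)).continuousAt (x := (z, v)) (floor_eventually hz)
      filter_upwards [this] with p hp
      have hp' : ⌊p.1.1.1⌋ = ⌊z.1.1⌋ := hp
      simp only [cc, hp']

abbrev E := Z.TotalSpace

theorem cov_E : IsCoveringMap (Z.proj) := FiberBundle.isCoveringMap (F := G) (E := Z.Fiber)

/-- fibre coordinate -/
noncomputable def vv (e : E) : G := e.2

/-- coordinate in chart i -/
noncomputable def uu (i : Bool) (e : E) : G := (cc i e.proj)⁻¹ * (cc (ix e.proj) e.proj * vv e)

theorem uu_ix (e : E) : uu (ix e.proj) e = vv e := by simp [uu]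

theorem nhds_W (i : Bool) (e : E) (he : e.proj ∈ U i) :
    ∀ᶠ e' in 𝓝 e, e'.proj ∈ U i ∧ uu i e' = uu i e := by
  have hs : e ∈ (Z.localTriv i).source := he
  have hc : ContinuousAt (Z.localTriv i) e := (Z.localTriv i).toOpenPartialHomeomorph.continuousAt hs
  have h1 : ∀ᶠ e' in 𝓝 e, e'.proj ∈ U i :=
    ((isOpen_U i).preimage Z.continuous_proj).mem_nhds he
  have h2 : ∀ᶠ e' in 𝓝 e, (Z.localTriv i e').2 = (Z.localTriv i e).2 := by
    have h3 : ContinuousAt (fun e' => (Z.localTriv i e').2) e := continuous_snd.continuousAt.comp hc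
    exact h3 (isOpen_discrete {(Z.localTriv i e).2} |>.mem_nhds rfl)
  filter_upwards [h1, h2] with e' h1 h2
  exact ⟨h1, h2⟩

def strip (n : ℤ) : Set X0 := {z | (n : ℝ) ≤ z.1.1 ∧ z.1.1 ≤ n + 1}

theorem isClosed_strip (n : ℤ) : IsClosed (strip n) := by
  have h1 : IsClosed {z : X0 | (n : ℝ) ≤ z.1.1} := isClosed_le (by fun_prop) (by fun_prop)
  have h2 : IsClosed {z : X0 | z.1.1 ≤ (n : ℝ) + 1} := isClosed_le (by fun_prop) (by fun_prop)
  exact h1.inter h2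

theorem floor_strip {n : ℤ} {z : X0} (hz : z ∈ strip n) (h : ∀ m : ℤ, z.1.1 ≠ m) : ⌊z.1.1⌋ = n := by
  refine Int.floor_eq_iff.2 ⟨hz.1, lt_of_le_of_ne hz.2 ?_⟩
  have := h (n + 1)
  push_cast at this
  exact this

def St (j : G × ℤ) : Set E :=
  {e | e.proj ∈ strip j.2 ∧ ∃ i, e.proj ∈ U i ∧ FreeGroup.of i ^ j.2 * uu i e = j.1}

theorem St_iff {i : Bool} {e : E} (he : e.proj ∈ U i) (j : G × ℤ) :
    e ∈ St j ↔ e.proj ∈ strip j.2 ∧ FreeGroup.of i ^ j.2 * uu i e = j.1 := by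
  constructor
  · rintro ⟨hs, i', hi', h⟩
    refine ⟨hs, ?_⟩
    by_cases hii : i = i'
    · subst hii; exact h
    · have hf := floor_strip hs (nonint_of_mem hii he hi')
      rw [← h]
      simp [uu, cc, hf]
  · rintro ⟨hs, h⟩
    exact ⟨hs, i, he, h⟩

theorem isClosed_St (j : G × ℤ) : IsClosed (St j) := by
  rw [← isOpen_compl_iff, isOpen_iff_mem_nhds]
  intro e he
  have hW := nhds_W _ e (mem_ix e.proj)
  rw [Set.mem_compl_iff, St_iff (mem_ix e.proj)] at he
  by_cases hs : e.proj ∈ strip j.2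
  · filter_upwards [hW] with e' h' hm
    rw [St_iff h'.1, h'.2] at hm
    exact he ⟨hs, hm.2⟩
  · have : ∀ᶠ e' in 𝓝 e, e'.proj ∈ (strip j.2)ᶜ :=
      ((isClosed_strip _).isOpen_compl.preimage Z.continuous_proj).mem_nhds hs
    filter_upwards [this] with e' h' hm
    exact h' hm.1

theorem locallyFinite_St : LocallyFinite St := by
  intro e
  set i := ix e.proj
  have hW := nhds_W i e (mem_ix e.proj)
  let f : X0 → ℝ := fun z => z.1.1
  have h2 : ∀ᶠ e' in 𝓝 e, |e'.proj.1.1 - e.proj.1.1| < 1 := by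
    have hf : Continuous fun e' : E => |e'.proj.1.1 - e.proj.1.1| := by
      have := Z.continuous_proj
      fun_prop
    exact (isOpen_lt hf continuous_const).mem_nhds (by simp)
  refine ⟨_, hW.and h2, ?_⟩
  refine ((Set.finite_Icc (⌊e.proj.1.1⌋ - 3) (⌊e.proj.1.1⌋ + 3)).image
    (fun n : ℤ => ((FreeGroup.of i ^ n * uu i e, n) : G × ℤ))).subset ?_
  rintro ⟨g, n⟩ ⟨e', hm, ⟨hU, hu⟩, habs⟩
  rw [St_iff hU, hu] at hm
  refine ⟨n, ?_, Prod.ext hm.2 rfl⟩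
  have a1 := hm.1.1
  have a2 := hm.1.2
  simp only at a1 a2
  rw [abs_lt] at habs
  have f1 := Int.floor_le e.proj.1.1
  have f2 := Int.lt_floor_add_one e.proj.1.1
  constructor
  · have : (⌊e.proj.1.1⌋ : ℝ) - 3 ≤ n := by linarith
    exact_mod_cast this
  · have : (n : ℝ) ≤ (⌊e.proj.1.1⌋ : ℝ) + 3 := by linarith
    exact_mod_cast this

theorem exists_St (e : E) : ∃ j, e ∈ St j := by
  refine ⟨(FreeGroup.of (ix e.proj) ^ ⌊e.proj.1.1⌋ * uu (ix e.proj) e, ⌊e.proj.1.1⌋), ?_⟩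
  rw [St_iff (mem_ix e.proj)]
  exact ⟨⟨Int.floor_le _, (Int.lt_floor_add_one _).le⟩, rfl⟩

noncomputable def sig (j : G × ℤ) (z : X0) : E :=
  ⟨z, ((FreeGroup.of (ix z) ^ j.2)⁻¹ * j.1 : G)⟩

theorem sig_proj (j : G × ℤ) (z : X0) : (sig j z).proj = z := rfl

theorem sig_mem {j : G × ℤ} {z : X0} (hz : z ∈ strip j.2) : sig j z ∈ St j := by
  rw [St_iff (i := ix z) (mem_ix z)]
  refine ⟨hz, ?_⟩
  have : uu (ix z) (sig j z) = (FreeGroup.of (ix z) ^ j.2)⁻¹ * j.1 := uu_ix (sig j z)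
  rw [this]; simp

theorem sig_eq {j : G × ℤ} {e : E} (he : e ∈ St j) : sig j e.proj = e := by
  rw [St_iff (mem_ix e.proj), uu_ix] at he
  obtain ⟨z, v⟩ := e
  unfold sig
  congr 1
  rw [← he.2]
  exact inv_mul_cancel_left (G := G) _ _

theorem continuousOn_sig (j : G × ℤ) : ContinuousOn (sig j) (strip j.2) := by
  intro z hz
  have hi := mem_ix z
  set i := ix z
  have hc : ContinuousAt (fun z' : X0 => (Z.localTriv i).toOpenPartialHomeomorph.symm
      (z', (FreeGroup.of i ^ j.2)⁻¹ * j.1)) z := by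
    refine ContinuousAt.comp (f := fun z' : X0 => (z', (FreeGroup.of i ^ j.2)⁻¹ * j.1))
      (g := (Z.localTriv i).toOpenPartialHomeomorph.symm) ?_ (by fun_prop)
    apply OpenPartialHomeomorph.continuousAt_symm
    rw [Bundle.Trivialization.mem_target]
    exact hi
  have key : ∀ z' ∈ strip j.2, z' ∈ U i → sig j z' = (Z.localTriv i).toOpenPartialHomeomorph.symm
      (z', (FreeGroup.of i ^ j.2)⁻¹ * j.1) := by
    intro z' hs hU
    rw [Z.localTriv_symm_apply]
    unfold sig
    congr 1
    change _ = (cc (ix z') z')⁻¹ * (cc i z' * _)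
    by_cases h : i = ix z'
    · rw [← h]; simp
    · have hf := floor_strip hs (nonint_of_mem h hU (mem_ix z'))
      simp [cc, hf]
  refine hc.continuousWithinAt.congr_of_eventuallyEq ?_ (key z hz hi)
  filter_upwards [self_mem_nhdsWithin, mem_nhdsWithin_of_mem_nhds ((isOpen_U i).mem_nhds hi)]
    with z' h1 h2 using key z' h1 h2

/-- which side -/
def dd (b : Bool) : ℤ := if b then 1 else -1
def qq (b : Bool) : ℤ := if b then 1 else 0

theorem lt_true (i : Bool) : lt (i, true) = FreeGroup.of i := rfl
theorem lt_false (i : Bool) : lt (i, false) = (FreeGroup.of i)⁻¹ := rfl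

theorem adj {j j' : G × ℤ} {e : E} (h : e ∈ St j) (h' : e ∈ St j') :
    j = j' ∨ ∃ x : Bool × Bool, 0 < sgn x.1 * e.proj.1.2 ∧ e.proj.1.1 = ((j.2 + qq x.2 : ℤ) : ℝ) ∧
      j'.1 = lt x * j.1 := by
  rw [St_iff (mem_ix e.proj)] at h h'
  obtain ⟨g, n⟩ := j
  obtain ⟨g', n'⟩ := j'
  obtain ⟨⟨a1, a2⟩, a3⟩ := h
  obtain ⟨⟨b1, b2⟩, b3⟩ := h'
  simp only at *
  have c1 : n ≤ n' + 1 := by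
    have : (n : ℝ) ≤ n' + 1 := by linarith
    exact_mod_cast this
  have c2 : n' ≤ n + 1 := by
    have : (n' : ℝ) ≤ n + 1 := by linarith
    exact_mod_cast this
  obtain h | h | h : n' = n ∨ n' = n + 1 ∨ n' = n - 1 := by omega
  · left
    subst h
    rw [← a3, ← b3]
  · right
    subst h
    push_cast at b1 b2
    have hx : e.proj.1.1 = n + 1 := by linarith
    refine ⟨(ix e.proj, true), ?_, ?_, ?_⟩
    · rcases mem_ix e.proj with h | h
      · exact absurd (by push_cast; exact hx) (h (n + 1))
      · exact h
    · simp [qq, hx]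
    · rw [← a3, ← b3, lt_true, add_comm n 1, zpow_add, zpow_one, mul_assoc]
  · right
    subst h
    push_cast at b1 b2
    have hx : e.proj.1.1 = n := by linarith
    refine ⟨(ix e.proj, false), ?_, ?_, ?_⟩
    · rcases mem_ix e.proj with h | h
      · exact absurd hx (h n)
      · exact h
    · simp [qq, hx]
    · rw [← a3, ← b3, lt_false, sub_eq_neg_add, zpow_add, zpow_neg_one, mul_assoc]

theorem gate {j : G × ℤ} {z : X0} {x : Bool × Bool} (h : 0 < sgn x.1 * z.1.2)
    (hx : z.1.1 = ((j.2 + qq x.2 : ℤ) : ℝ)) : sig j z ∈ St (lt x * j.1, j.2 + dd x.2) := by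
  obtain ⟨i, b⟩ := x
  obtain ⟨g, n⟩ := j
  simp only at *
  have hU : z ∈ U i := Or.inr h
  have hs : z ∈ strip n := by
    constructor <;> rw [hx] <;> cases b <;> simp [qq]
  have hm := sig_mem (j := (g, n)) hs
  rw [St_iff (i := i) hU] at hm ⊢
  refine ⟨?_, ?_⟩
  · rw [sig_proj]
    constructor <;> rw [hx] <;> cases b <;> simp [qq, dd]
  · have := hm.2
    simp only at this ⊢
    nth_rw 2 [← this]
    cases b
    · simp only [dd, lt_false, Bool.false_eq_true, if_false]
      rw [add_comm, zpow_add, zpow_neg_one, mul_assoc]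
    · simp only [dd, lt_true, if_true]
      rw [add_comm, zpow_add, zpow_one, mul_assoc]

end
end FN

namespace FN
section
open unitInterval Topology

variable {k : ℕ}

theorem paste (f : C(Fin k → I, E)) (J : Set (G × ℤ)) (hf : ∀ a, ∃ j ∈ J, f a ∈ St j)
    (η : G × ℤ → I × X0 → X0) (hη : ∀ j ∈ J, ContinuousOn (η j) {p | p.2 ∈ strip j.2})
    (hm : ∀ j ∈ J, ∀ t, ∀ z ∈ strip j.2, η j (t, z) ∈ strip j.2)
    (hc : ∀ j ∈ J, ∀ j' ∈ J, ∀ e, e ∈ St j → e ∈ St j' → ∀ t,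
      sig j (η j (t, e.proj)) = sig j' (η j' (t, e.proj))) :
    ∃ F : I × (Fin k → I) → E, Continuous F ∧ ∀ j ∈ J, ∀ t a, f a ∈ St j →
      F (t, a) = sig j (η j (t, (f a).proj)) := by
  choose ch hJ hS using hf
  let F : I × (Fin k → I) → E := fun p => sig (ch p.2) (η (ch p.2) (p.1, (f p.2).proj))
  have hF : ∀ j ∈ J, ∀ t a, f a ∈ St j → F (t, a) = sig j (η j (t, (f a).proj)) :=
    fun j hj t a ha => hc _ (hJ a) _ hj _ (hS a) ha t
  refine ⟨F, ?_, hF⟩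
  have hlf : LocallyFinite (fun j : G × ℤ => (fun p : I × (Fin k → I) => f p.2) ⁻¹' St j) :=
    locallyFinite_St.preimage_continuous (by fun_prop)
  have hlf' : LocallyFinite (fun j : J => (fun p : I × (Fin k → I) => f p.2) ⁻¹' St j.1) :=
    hlf.comp_injective Subtype.val_injective
  refine hlf'.continuous ?_ ?_ ?_
  · ext p
    simp only [Set.mem_iUnion, Set.mem_univ, iff_true]
    exact ⟨⟨ch p.2, hJ _⟩, hS _⟩
  · intro j
    exact (isClosed_St _).preimage (by fun_prop)
  · rintro ⟨j, hj⟩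
    have h1 : ContinuousOn (fun p : I × (Fin k → I) => sig j (η j (p.1, (f p.2).proj)))
        ((fun p : I × (Fin k → I) => f p.2) ⁻¹' St j) := by
      refine (continuousOn_sig j).comp ((hη j hj).comp (f := fun p : I × (Fin k → I) => (p.1, (f p.2).proj)) ?_ ?_) ?_
      · have := Z.continuous_proj
        exact (Continuous.prodMk continuous_fst (this.comp (f.continuous.comp continuous_snd))).continuousOn
      · intro p hp
        exact hp.1
      · intro p hp
        exact hm j hj _ _ hp.1
    refine h1.congr ?_
    rintro ⟨t, a⟩ hp
    exact hF j hj t a hp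

/-- coerce to the punctured plane -/
noncomputable def mkX (d : X0) (w : ℝ × ℝ) : X0 :=
  open Classical in if h : ∀ n : ℤ, w ≠ ((n : ℝ), 0) then ⟨w, h⟩ else d

theorem mkX_val {d : X0} {w : ℝ × ℝ} (h : ∀ n : ℤ, w ≠ ((n : ℝ), 0)) : (mkX d w).1 = w := by
  unfold mkX; rw [dif_pos h]

theorem continuousOn_mkX {T : Type*} [TopologicalSpace T] {s : Set T} {d : T → X0} {g : T → ℝ × ℝ}
    (hg : ContinuousOn g s) (h : ∀ x ∈ s, ∀ n : ℤ, g x ≠ ((n : ℝ), 0)) :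
    ContinuousOn (fun x => mkX (d x) (g x)) s := by
  have hi : IsInducing (Subtype.val : X0 → ℝ × ℝ) := ⟨rfl⟩
  rw [hi.continuousOn_iff]
  refine hg.congr ?_
  intro x hx
  exact mkX_val (h x hx)

theorem core {u y s t : ℝ} (hu0 : 0 ≤ u) (hu1 : u ≤ 1) (hs : s = 1 ∨ s = -1) (ht0 : 0 ≤ t)
    (ht1 : t ≤ 1) (h : u = 0 ∨ u = 1 → y ≠ 0) :
    0 ≤ (1 - t) * (u + t * min 1 (u + |y - s * (u + |y|)|)) ∧
    (1 - t) * (u + t * min 1 (u + |y - s * (u + |y|)|)) ≤ 1 ∧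
    ((1 - t) * (u + t * min 1 (u + |y - s * (u + |y|)|)) = 0 ∨
      (1 - t) * (u + t * min 1 (u + |y - s * (u + |y|)|)) = 1 →
      (1 - t) * y + t * (s * (u + |y|)) ≠ 0) := by
  have hm0 : 0 ≤ min 1 (u + |y - s * (u + |y|)|) := le_min zero_le_one (by positivity)
  have hm1 : min 1 (u + |y - s * (u + |y|)|) ≤ 1 := min_le_left _ _
  have hmz : min 1 (u + |y - s * (u + |y|)|) = 0 → y = s * (u + |y|) := by
    intro h0
    have : u + |y - s * (u + |y|)| = 0 := by
      rcases min_choice 1 (u + |y - s * (u + |y|)|) with h' | h'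
      · rw [h'] at h0; norm_num at h0
      · rw [h'] at h0; exact h0
    have h2 := abs_nonneg (y - s * (u + |y|))
    have h3 : |y - s * (u + |y|)| = 0 := by linarith
    rw [abs_eq_zero] at h3
    linarith
  have hr : 0 < u + |y| := by
    by_cases hu : u = 0
    · have := abs_pos.2 (h (Or.inl hu)); linarith
    · have := abs_nonneg y
      have : 0 < u := lt_of_le_of_ne hu0 (Ne.symm hu)
      linarith
  have hsr : s * (u + |y|) ≠ 0 := by
    rcases hs with rfl | rfl
    · simpa using hr.ne'
    · intro h0; linarith
  generalize min 1 (u + |y - s * (u + |y|)|) = m at *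
  generalize s * (u + |y|) = R at *
  refine ⟨by apply mul_nonneg <;> nlinarith, ?_, ?_⟩
  · have h1 : u + t * m ≤ 1 + t := by nlinarith
    have h2 := mul_le_mul_of_nonneg_left h1 (sub_nonneg.2 ht1)
    nlinarith
  intro hX
  by_cases t1 : t = 1
  · subst t1; simpa using hsr
  by_cases t0 : t = 0
  · subst t0
    simp at hX ⊢
    exact h hX
  have ht0' : 0 < t := lt_of_le_of_ne ht0 (Ne.symm t0)
  have ht1' : t < 1 := lt_of_le_of_ne ht1 t1
  rcases hX with hX | hX
  · rcases mul_eq_zero.1 hX with h1 | h1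
    · exact absurd (by linarith) t1
    · have h2 : t * m = 0 := by nlinarith [mul_nonneg ht0 hm0]
      have h3 : m = 0 := by
        rcases mul_eq_zero.1 h2 with h | h
        · exact absurd h t0
        · exact h
      rw [hmz h3]
      have : (1 - t) * R + t * R = R := by ring
      rw [this]; exact hsr
  · exfalso
    have : u + t * m ≤ 1 + t := by nlinarith
    nlinarith

/-- push the strip `n` to the gate in direction `x` -/
noncomputable def push (x : Bool × Bool) (n : ℤ) (t : ℝ) (w : ℝ × ℝ) : ℝ × ℝ :=
  let q : ℝ := ((n + qq x.2 : ℤ) : ℝ)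
  let d : ℝ := -((dd x.2 : ℤ) : ℝ)
  let u : ℝ := d * (w.1 - q)
  (q + d * ((1 - t) * (u + t * min 1 (u + |w.2 - sgn x.1 * (u + |w.2|)|))),
    (1 - t) * w.2 + t * (sgn x.1 * (u + |w.2|)))

theorem sgn_cases (i : Bool) : sgn i = 1 ∨ sgn i = -1 := by cases i <;> simp [sgn]

theorem push_valid (x : Bool × Bool) (n : ℤ) {t : ℝ} (ht0 : 0 ≤ t) (ht1 : t ≤ 1) {z : X0}
    (hz : z ∈ strip n) : ((n : ℝ) ≤ (push x n t z.1).1 ∧ (push x n t z.1).1 ≤ n + 1) ∧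
    ∀ m : ℤ, push x n t z.1 ≠ ((m : ℝ), 0) := by
  obtain ⟨i, b⟩ := x
  obtain ⟨⟨p, y⟩, hp⟩ := z
  obtain ⟨h1, h2⟩ := hz
  simp only at h1 h2
  have hy1 : p = n → y ≠ 0 := fun h h' => hp n (by rw [h, h'])
  have hy2 : p = n + 1 → y ≠ 0 := fun h h' => hp (n + 1) (by rw [h, h']; push_cast; rfl)
  have key : ∀ X Y : ℝ, 0 ≤ X ∧ X ≤ 1 ∧ (X = 0 ∨ X = 1 → Y ≠ 0) → ∀ (q : ℤ) (m : ℤ) (d : ℤ),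
      d = 1 ∨ d = -1 → ((q : ℝ) + d * X, Y) ≠ ((m : ℝ), 0) := by
    rintro X Y ⟨a1, a2, a3⟩ q m d hd h
    rw [Prod.mk.injEq] at h
    obtain ⟨h, hY⟩ := h
    refine a3 ?_ hY
    have hX : X = ((d * (m - q) : ℤ) : ℝ) := by
      push_cast; rw [← h]; rcases hd with rfl | rfl <;> push_cast <;> ring
    rw [hX] at a1 a2 ⊢
    have b1 : 0 ≤ d * (m - q) := by exact_mod_cast a1
    have b2 : d * (m - q) ≤ 1 := by exact_mod_cast a2
    have : d * (m - q) = 0 ∨ d * (m - q) = 1 := by omega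
    rcases this with h | h <;> rw [h] <;> simp
  cases b
  · have hc := core (u := p - n) (y := y) (s := sgn i) (t := t) (by linarith) (by linarith)
      (sgn_cases i) ht0 ht1 (by
        rintro (h | h)
        · exact hy1 (by linarith)
        · exact hy2 (by linarith))
    have e : push (i, false) n t (p, y) = ((n : ℝ) + (1 : ℤ) * ((1 - t) * ((p - n) + t * min 1 ((p - n) + |y - sgn i * ((p - n) + |y|)|))),
      (1 - t) * y + t * (sgn i * ((p - n) + |y|))) := by
      simp [push, qq, dd]
    rw [e]
    refine ⟨?_, fun m => key _ _ hc n m 1 (Or.inl rfl)⟩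
    push_cast
    constructor <;> [linarith [hc.1]; linarith [hc.2.1]]
  · have hc := core (u := n + 1 - p) (y := y) (s := sgn i) (t := t) (by linarith) (by linarith)
      (sgn_cases i) ht0 ht1 (by
        rintro (h | h)
        · exact hy2 (by linarith)
        · exact hy1 (by linarith))
    have e : push (i, true) n t (p, y) = (((n + 1 : ℤ) : ℝ) + (-1 : ℤ) * ((1 - t) * ((n + 1 - p) + t * min 1 ((n + 1 - p) + |y - sgn i * ((n + 1 - p) + |y|)|))),
      (1 - t) * y + t * (sgn i * ((n + 1 - p) + |y|))) := by
      simp [push, qq, dd]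
    rw [e]
    refine ⟨?_, fun m => key _ _ hc (n + 1) m (-1) (Or.inr rfl)⟩
    push_cast
    constructor <;> [linarith [hc.2.1]; linarith [hc.1]]

theorem push_zero (x : Bool × Bool) (n : ℤ) (w : ℝ × ℝ) : push x n 0 w = w := by
  obtain ⟨i, b⟩ := x
  obtain ⟨p, y⟩ := w
  cases b <;> simp [push, qq, dd]

theorem push_gate (x : Bool × Bool) (n : ℤ) (t : ℝ) (w : ℝ × ℝ) (h : 0 < sgn x.1 * w.2)
    (hx : w.1 = ((n + qq x.2 : ℤ) : ℝ)) : push x n t w = w := by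
  obtain ⟨i, b⟩ := x
  obtain ⟨p, y⟩ := w
  simp only at h hx
  subst hx
  have : sgn i * |y| = y := by
    cases i
    · simp [sgn] at h ⊢; rw [abs_of_neg h]; ring
    · simp [sgn] at h ⊢; exact h.le
  simp [push, this]
  ring

theorem push_one (x : Bool × Bool) (n : ℤ) (w : ℝ × ℝ) :
    push x n 1 w = (((n + qq x.2 : ℤ) : ℝ),
      sgn x.1 * (-((dd x.2 : ℤ) : ℝ) * (w.1 - ((n + qq x.2 : ℤ) : ℝ)) + |w.2|)) := by
  simp [push]

theorem continuous_push (x : Bool × Bool) (n : ℤ) :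
    Continuous (fun p : ℝ × (ℝ × ℝ) => push x n p.1 p.2) := by
  unfold push
  fun_prop

end
end FN

namespace FN
section
open unitInterval Topology

variable {k : ℕ}

theorem paste_homotopy (f : C(Fin k → I, E)) (hb : BConst f) (J : Set (G × ℤ))
    (hf : ∀ a, ∃ j ∈ J, f a ∈ St j)
    (η : G × ℤ → I × X0 → X0) (hη : ∀ j ∈ J, ContinuousOn (η j) {p | p.2 ∈ strip j.2})
    (hm : ∀ j ∈ J, ∀ t, ∀ z ∈ strip j.2, η j (t, z) ∈ strip j.2)
    (hc : ∀ j ∈ J, ∀ j' ∈ J, ∀ e, e ∈ St j → e ∈ St j' → ∀ t,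
      sig j (η j (t, e.proj)) = sig j' (η j' (t, e.proj)))
    (h0 : ∀ j ∈ J, ∀ z ∈ strip j.2, η j (0, z) = z) :
    ∃ g : C(Fin k → I, E), ContinuousMap.HomotopicWith f g BConst ∧
      ∀ j ∈ J, ∀ a, f a ∈ St j → g a = sig j (η j (1, (f a).proj)) := by
  obtain ⟨F, hF, hFj⟩ := paste f J hf η hη hm hc
  refine ⟨⟨fun a => F (1, a), by fun_prop⟩, ?_, fun j hj a ha => hFj j hj 1 a ha⟩
  refine homotopicWith_of F hF ?_ (fun a => rfl) ?_
  · intro a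
    obtain ⟨j, hj, ha⟩ := hf a
    rw [hFj j hj _ _ ha, h0 j hj _ ha.1, sig_eq ha]
  · intro t a ha b hb'
    have e := hb a ha b hb'
    obtain ⟨j, hj, hs⟩ := hf a
    rw [hFj j hj _ _ hs, hFj j hj _ _ (e ▸ hs), e]

theorem claim_step (N : ℕ) (f : C(Fin k → I, E)) (hb : BConst f)
    (hf : ∀ a, ∃ j : G × ℤ, j.1.norm ≤ N + 1 ∧ f a ∈ St j) :
    ∃ g : C(Fin k → I, E), ContinuousMap.HomotopicWith f g BConst ∧
      ∀ a, ∃ j : G × ℤ, j.1.norm ≤ N ∧ g a ∈ St j := by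
  classical
  have hpar : ∀ j : G × ℤ, ∃ x : Bool × Bool, j.1.norm = N + 1 → (lt x * j.1).norm = N := by
    intro j
    by_cases h : j.1.norm = N + 1
    · obtain ⟨x, hx⟩ := parent_exists h
      exact ⟨x, fun _ => hx⟩
    · exact ⟨(true, true), fun h' => absurd h' h⟩
  choose x hx using hpar
  let η : G × ℤ → I × X0 → X0 := fun j p =>
    if j.1.norm ≤ N then p.2 else mkX p.2 (push (x j) j.2 p.1 p.2.1)
  have η1 : ∀ j p, j.1.norm ≤ N → η j p = p.2 := fun j p h => if_pos h
  have η2 : ∀ j p, ¬ j.1.norm ≤ N → η j p = mkX p.2 (push (x j) j.2 p.1 p.2.1) :=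
    fun j p h => if_neg h
  have ηval : ∀ j t, ∀ z ∈ strip j.2, ¬ j.1.norm ≤ N → (η j (t, z)).1 = push (x j) j.2 t z.1 := by
    intro j t z hz h
    rw [η2 _ _ h]
    exact mkX_val (push_valid (x j) j.2 t.2.1 t.2.2 hz).2
  have P := paste_homotopy f hb {j | j.1.norm ≤ N + 1} hf η ?_ ?_ ?_ ?_
  · obtain ⟨g, hg, hgj⟩ := P
    refine ⟨g, hg, ?_⟩
    intro a
    obtain ⟨j, hj, ha⟩ := hf a
    have e := hgj j hj a ha
    by_cases h : j.1.norm ≤ N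
    · refine ⟨j, h, ?_⟩
      rw [e, η1 _ _ h]
      exact sig_mem ha.1
    · have hN : j.1.norm = N + 1 := by omega
      have hv := ηval j 1 _ ha.1 h
      refine ⟨(lt (x j) * j.1, j.2 + dd (x j).2), (hx j hN).le, ?_⟩
      rw [e]
      have hp := push_valid (x j) j.2 zero_le_one le_rfl ha.1
      apply gate
      · rw [hv]
        have h2 := hp.2 (j.2 + qq (x j).2)
        rw [Set.Icc.coe_one, push_one] 
        rw [push_one] at h2
        have hne : -((dd (x j).2 : ℤ) : ℝ) * ((f a).proj.1.1 - ((j.2 + qq (x j).2 : ℤ) : ℝ)) + |(f a).proj.1.2| ≠ 0 := by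
          intro h0
          apply h2
          rw [h0, mul_zero]
        have hnn : 0 ≤ -((dd (x j).2 : ℤ) : ℝ) * ((f a).proj.1.1 - ((j.2 + qq (x j).2 : ℤ) : ℝ)) := by
          have h3 := ha.1.1
          have h4 := ha.1.2
          cases (x j).2
          · simp [dd, qq]; exact h3
          · simp [dd, qq]; linarith
        have hpos : 0 < -((dd (x j).2 : ℤ) : ℝ) * ((f a).proj.1.1 - ((j.2 + qq (x j).2 : ℤ) : ℝ)) + |(f a).proj.1.2| :=
          lt_of_le_of_ne (by positivity) hne.symm
        simp only
        rw [← mul_assoc]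
        rcases sgn_cases (x j).1 with h | h <;> rw [h] <;> simpa using hpos
      · rw [hv, Set.Icc.coe_one, push_one]
  · intro j hj
    by_cases h : j.1.norm ≤ N
    · have : η j = fun p => p.2 := funext fun p => η1 j p h
      rw [this]; exact continuousOn_snd
    · have : η j = fun p => mkX p.2 (push (x j) j.2 p.1 p.2.1) := funext fun p => η2 j p h
      rw [this]
      refine continuousOn_mkX ?_ ?_
      · exact ((continuous_push (x j) j.2).comp (f := fun p : I × X0 => ((p.1 : ℝ), p.2.1))
          (by fun_prop)).continuousOn
      · intro p hp
        exact (push_valid (x j) j.2 p.1.2.1 p.1.2.2 hp).2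
  · intro j hj t z hz
    by_cases h : j.1.norm ≤ N
    · rw [η1 _ _ h]; exact hz
    · have := (push_valid (x j) j.2 t.2.1 t.2.2 hz).1
      rw [← ηval j t z hz h] at this
      exact this
  · -- compatibility
    have fixed : ∀ j j' : G × ℤ, j.1.norm ≤ N + 1 → j'.1.norm ≤ N + 1 → j ≠ j' →
        ∀ e, e ∈ St j → e ∈ St j' → ∀ t, η j (t, e.proj) = e.proj := by
      intro j j' hj hj' hne e he he' t
      by_cases h : j.1.norm ≤ N
      · rw [η1 _ _ h]
      · have hN : j.1.norm = N + 1 := by omega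
        rcases adj he he' with h1 | ⟨y, hy1, hy2, hy3⟩
        · exact absurd h1 hne
        · have hn := norm_lt_mul y j.1
          rw [← hy3] at hn
          have hlt : (lt y * j.1).norm < j.1.norm := by rw [← hy3]; omega
          have hlt' : (lt (x j) * j.1).norm < j.1.norm := by rw [hx j hN]; omega
          have hxy := parent_unique hlt hlt'
          subst hxy
          apply Subtype.ext
          rw [ηval j t _ he.1 h]
          exact push_gate _ _ _ _ hy1 hy2
    intro j hj j' hj' e he he' t
    by_cases hne : j = j'
    · subst hne; rfl
    · rw [fixed j j' hj hj' hne e he he' t, fixed j' j hj' hj (Ne.symm hne) e he' he t,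
        sig_eq he, sig_eq he']
  · intro j hj z hz
    by_cases h : j.1.norm ≤ N
    · rw [η1 _ _ h]
    · apply Subtype.ext
      rw [ηval j 0 _ hz h, Set.Icc.coe_zero, push_zero]

theorem claim_zero (f : C(Fin k → I, E)) (hb : BConst f)
    (hf : ∀ a, ∃ j : G × ℤ, j.1.norm ≤ 0 ∧ f a ∈ St j) :
    ∃ c, ContinuousMap.HomotopicWith f (ContinuousMap.const _ c) BConst := by
  let L : ℤ → ℝ → ℝ × ℝ → ℝ × ℝ := fun n t w => (w.1 + t * (n + 1 / 2 - w.1), (1 - t) * w.2)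
  have hL : ∀ n (t : I) (z : X0), z ∈ strip n → ((n : ℝ) ≤ (L n t z.1).1 ∧ (L n t z.1).1 ≤ n + 1) ∧
    ∀ m : ℤ, L n t z.1 ≠ ((m : ℝ), 0) := by
    rintro n ⟨t, ht0, ht1⟩ ⟨⟨p, y⟩, hp⟩ ⟨h1, h2⟩
    simp only at h1 h2
    simp only [L]
    refine ⟨⟨by nlinarith, by nlinarith⟩, ?_⟩
    intro m hm
    rw [Prod.mk.injEq] at hm
    obtain ⟨a1, a2⟩ := hm
    by_cases t0 : t = 0
    · subst t0
      simp at a1 a2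
      exact hp m (by rw [a1, a2])
    have ht0' : 0 < t := lt_of_le_of_ne ht0 (Ne.symm t0)
    have b1 : (n : ℝ) < m := by rw [← a1]; nlinarith
    have b2 : (m : ℝ) < n + 1 := by rw [← a1]; nlinarith
    have b1' : n < m := by exact_mod_cast b1
    have b2' : m < n + 1 := by exact_mod_cast b2
    omega
  have hone : ∀ g : G, g.norm ≤ 0 → g = 1 := by
    intro g hg
    exact FreeGroup.norm_eq_zero.1 (Nat.le_zero.1 hg)
  have huniq : ∀ j j' : G × ℤ, j.1.norm ≤ 0 → j'.1.norm ≤ 0 → ∀ e, e ∈ St j → e ∈ St j' → j = j' := by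
    intro j j' hj hj' e he he'
    rcases adj he he' with h1 | ⟨y, hy1, hy2, hy3⟩
    · exact h1
    · have hn := norm_lt_mul y j.1
      rw [← hy3] at hn
      omega
  have hmk : ∀ n (t : I) (z : X0), z ∈ strip n → (mkX z (L n t z.1)).1 = L n t z.1 :=
    fun n t z hz => mkX_val (hL n t z hz).2
  have P := paste_homotopy f hb {j | j.1.norm ≤ 0} hf
    (fun j p => mkX p.2 (L j.2 p.1 p.2.1)) ?_ ?_ ?_ ?_
  · obtain ⟨g, hg, hgj⟩ := P
    have hx : ∀ a, ∃ n : ℤ, g a = sig (1, n) (g a).proj ∧ (g a).proj.1 = ((n : ℝ) + 1 / 2, 0) := by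
      intro a
      obtain ⟨j, hj, ha⟩ := hf a
      have e := hgj j hj a ha
      refine ⟨j.2, ?_, ?_⟩
      · rw [e, sig_proj]
        have : j = (1, j.2) := Prod.ext (hone _ hj) rfl
        rw [← this]
      · rw [e, sig_proj]
        simp only
        rw [hmk _ _ _ ha.1]
        simp [L]
    have hconst : ∀ a b, (g a).proj.1.1 = (g b).proj.1.1 := by
      have hc : Continuous (fun a => (g a).proj.1.1 - 1 / 2) := by
        have h1 := Z.continuous_proj
        have h2 : Continuous fun a => (g a).proj := h1.comp g.continuous
        fun_prop
      choose n hn1 hn2 using hx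
      have hcn : Continuous n := by
        rw [Int.isClosedEmbedding_coe_real.isInducing.continuous_iff]
        convert hc using 1
        ext a
        simp [hn2]
      intro a b
      have := PreconnectedSpace.constant (f := n) inferInstance hcn (x := a) (y := b)
      rw [hn2, hn2, this]
    refine ⟨g 0, ?_⟩
    have : ContinuousMap.const _ (g 0) = g := by
      ext1 a
      obtain ⟨n, h1, h2⟩ := hx a
      obtain ⟨n', h1', h2'⟩ := hx 0
      have h3 := hconst a 0
      rw [h2, h2'] at h3
      simp only at h3
      have h4 : n = n' := by
        have : (n : ℝ) = n' := by linarith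
        exact_mod_cast this
      subst h4
      rw [ContinuousMap.const_apply, h1, h1']
      congr 1
      exact Subtype.ext (h2'.trans h2.symm)
    rw [this]
    exact hg
  · intro j hj
    refine continuousOn_mkX ?_ ?_
    · apply Continuous.continuousOn
      simp only [L]
      fun_prop
    · intro p hp
      exact (hL j.2 p.1 p.2 hp).2
  · intro j hj t z hz
    have := (hL j.2 t z hz).1
    rw [← hmk _ _ _ hz] at this
    exact this
  · intro j hj j' hj' e he he' t
    rw [huniq j j' hj hj' e he he']
  · intro j hj z hz
    apply Subtype.ext
    simp only
    rw [hmk _ _ _ hz]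
    simp [L]

theorem claim (N : ℕ) : ∀ f : C(Fin k → I, E), BConst f →
    (∀ a, ∃ j : G × ℤ, j.1.norm ≤ N ∧ f a ∈ St j) →
    ∃ c, ContinuousMap.HomotopicWith f (ContinuousMap.const _ c) BConst := by
  induction N with
  | zero => exact fun f hb hf => claim_zero f hb hf
  | succ N ih =>
    intro f hb hf
    obtain ⟨g, hg, hgj⟩ := claim_step N f hb hf
    exact asph_of_homotopic hg (ih g (BConst.right hg) hgj)

theorem asph_E : Asph k E := by
  intro f hb
  have hlf : LocallyFinite (fun j : G × ℤ => f ⁻¹' St j) :=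
    locallyFinite_St.preimage_continuous f.continuous
  have hfin : {j : G × ℤ | ((f ⁻¹' St j) ∩ Set.univ).Nonempty}.Finite :=
    hlf.finite_nonempty_inter_compact isCompact_univ
  obtain ⟨N, hN⟩ := (hfin.image (fun j : G × ℤ => j.1.norm)).bddAbove
  refine claim N f hb ?_
  intro a
  obtain ⟨j, hj⟩ := exists_St (f a)
  exact ⟨j, hN ⟨j, ⟨a, hj, trivial⟩, rfl⟩, hj⟩

theorem asph_X0 (hk : 2 ≤ k) : Asph k X0 :=
  asph_of_covering hk cov_E (fun z => ⟨⟨z, (1 : G)⟩, rfl⟩) asph_E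

end
end FN

namespace FN
section
open unitInterval Topology

variable {k : ℕ}

/-- the plane minus `0, ..., m-1` -/
abbrev P (m : ℕ) := {w : ℂ // ∀ i : Fin m, w ≠ ((i : ℕ) : ℂ)}

theorem asph_P (hk : 2 ≤ k) (m : ℕ) : Asph k (P m) := by
  intro f hb
  let cl : ℝ → ℝ := fun x => max (-1 / 2) (min x (m - 1 / 2))
  have hcl : Continuous cl := by fun_prop
  have hm : (0 : ℝ) ≤ m := Nat.cast_nonneg m
  have hcl1 : ∀ x : ℝ, -1 / 2 ≤ x → x ≤ m - 1 / 2 → cl x = x := by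
    intro x h1 h2
    simp only [cl]
    rw [min_eq_left h2, max_eq_right h1]
  have hcl2 : ∀ x : ℝ, x < -1 / 2 → cl x = -1 / 2 := by
    intro x h1
    simp only [cl]
    exact max_eq_left ((min_le_left _ _).trans h1.le)
  have hcl3 : ∀ x : ℝ, (m : ℝ) - 1 / 2 < x → cl x = m - 1 / 2 := by
    intro x h1
    simp only [cl]
    rw [min_eq_right h1.le]
    exact max_eq_right (by linarith)
  have v1 : ∀ (t : I) (w : P m), ∀ i : Fin m,
      (⟨(1 - t) * w.1.re + t * cl w.1.re, w.1.im⟩ : ℂ) ≠ ((i : ℕ) : ℂ) := by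
    rintro ⟨t, ht0, ht1⟩ w i h
    have h1 := congrArg Complex.re h
    have h2 := congrArg Complex.im h
    simp at h1 h2
    have hi : ((i : ℕ) : ℝ) + 1 ≤ m := by exact_mod_cast i.2
    have hi0 : (0 : ℝ) ≤ (i : ℕ) := Nat.cast_nonneg _
    by_cases c1 : w.1.re < -1 / 2
    · rw [hcl2 _ c1] at h1; nlinarith
    by_cases c2 : (m : ℝ) - 1 / 2 < w.1.re
    · rw [hcl3 _ c2] at h1; nlinarith
    rw [hcl1 _ (not_lt.1 c1) (not_lt.1 c2)] at h1
    apply w.2 i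
    apply Complex.ext
    · simp; linarith
    · simp [h2]
  have v2 : ∀ (w : P m), ∀ n : ℤ, ((cl w.1.re, w.1.im) : ℝ × ℝ) ≠ ((n : ℝ), 0) := by
    intro w n h
    rw [Prod.mk.injEq] at h
    obtain ⟨h1, h2⟩ := h
    by_cases c1 : w.1.re < -1 / 2
    · rw [hcl2 _ c1] at h1
      have : (-1 : ℝ) = ((2 * n : ℤ) : ℝ) := by push_cast; linarith
      have : (-1 : ℤ) = 2 * n := by exact_mod_cast this
      omega
    by_cases c2 : (m : ℝ) - 1 / 2 < w.1.re
    · rw [hcl3 _ c2] at h1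
      have : ((2 * (m : ℤ) - 1 : ℤ) : ℝ) = ((2 * n : ℤ) : ℝ) := by push_cast; linarith
      have : (2 * (m : ℤ) - 1 : ℤ) = 2 * n := by exact_mod_cast this
      omega
    rw [hcl1 _ (not_lt.1 c1) (not_lt.1 c2)] at h1
    rw [h1] at c1 c2
    have n0 : -1 < n := by
      have : ((-1 : ℤ) : ℝ) < n := by push_cast; linarith
      exact_mod_cast this
    have n1 : n < m := by
      have : (n : ℝ) < ((m : ℤ) : ℝ) := by push_cast; linarith
      exact_mod_cast this
    lift n to ℕ using (by omega)
    apply w.2 ⟨n, by omega⟩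
    apply Complex.ext
    · simp [h1]
    · simp [h2]
  let ι : C(X0, P m) := ⟨fun z => ⟨⟨z.1.1, z.1.2⟩, fun i h => by
    have h1 := congrArg Complex.re h
    have h2 := congrArg Complex.im h
    simp at h1 h2
    exact z.2 (i : ℕ) (Prod.ext (by simp [h1]) (by simp [h2]))⟩, by
      refine Continuous.subtype_mk ?_ _
      have : (fun z : X0 => (⟨z.1.1, z.1.2⟩ : ℂ)) = fun z : X0 => ((z.1.1 : ℂ) + z.1.2 * Complex.I) := by
        funext z; apply Complex.ext <;> simp
      rw [this]
      fun_prop⟩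
  let g : C(Fin k → I, X0) := ⟨fun a => ⟨(cl (f a).1.re, (f a).1.im), v2 (f a)⟩, by fun_prop⟩
  have hgb : BConst g := by
    intro a ha b hb'
    apply Subtype.ext
    simp only [g, ContinuousMap.coe_mk]
    rw [hb a ha b hb']
  obtain ⟨c, hc⟩ := asph_X0 hk g hgb
  refine ⟨ι c, ?_⟩
  have h1 := homotopicWith_map hc ι
  refine ContinuousMap.HomotopicWith.trans (g := ι.comp g) ?_ h1
  refine homotopicWith_of (fun p => ⟨⟨(1 - p.1) * (f p.2).1.re + p.1 * cl (f p.2).1.re, (f p.2).1.im⟩,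
    v1 p.1 (f p.2)⟩) ?_ ?_ ?_ ?_
  · refine Continuous.subtype_mk ?_ _
    have : (fun p : I × (Fin k → I) => (⟨(1 - p.1) * (f p.2).1.re + p.1 * cl (f p.2).1.re, (f p.2).1.im⟩ : ℂ))
        = fun p => ((((1 - p.1) * (f p.2).1.re + p.1 * cl (f p.2).1.re : ℝ) : ℂ) + (f p.2).1.im * Complex.I) := by
      funext z; apply Complex.ext <;> simp
    rw [this]
    fun_prop
  · intro a
    apply Subtype.ext; apply Complex.ext <;> simp
  · intro a
    apply Subtype.ext; apply Complex.ext <;> simp [ι, g]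
  · intro t a ha b hb'
    apply Subtype.ext
    simp only
    rw [hb a ha b hb']

end
end FN

namespace FN
section
open unitInterval Topology

/-- move the point `x` along when the points `z` move to `w` -/
noncomputable def phi {n : ℕ} (δ : ℝ) (z w : Fin n → ℂ) (x : ℂ) : ℂ :=
  x + ∑ i, ((max 0 (1 - ‖x - z i‖ / δ) : ℝ) : ℂ) * (w i - z i)

theorem phi_self {n : ℕ} (δ : ℝ) (z : Fin n → ℂ) (x : ℂ) : phi δ z z x = x := by simp [phi]

theorem phi_avoid {n : ℕ} {δ : ℝ} (hδ : 0 < δ) {z w : Fin n → ℂ} {x : ℂ}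
    (hsep : ∀ i j, i ≠ j → 4 * δ ≤ ‖z i - z j‖) (hw : ∀ i, ‖w i - z i‖ < δ)
    (hx : ∀ i, x ≠ z i) (j : Fin n) : phi δ z w x ≠ w j := by
  intro h
  by_cases hi : ∃ i, ‖x - z i‖ < δ
  · obtain ⟨i, hi⟩ := hi
    have hsum : phi δ z w x = x + ((1 - ‖x - z i‖ / δ : ℝ) : ℂ) * (w i - z i) := by
      unfold phi
      rw [Finset.sum_eq_single i]
      · rw [max_eq_right]
        rw [sub_nonneg, div_le_one hδ]; exact hi.le
      · intro l _ hl
        rw [max_eq_left]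
        · simp
        · rw [sub_nonpos, one_le_div hδ]
          have h1 := hsep i l (Ne.symm hl)
          have h2 : ‖z i - z l‖ ≤ ‖x - z i‖ + ‖x - z l‖ := by
            rw [← norm_neg (x - z i)]
            calc ‖z i - z l‖ = ‖-(x - z i) + (x - z l)‖ := by congr 1; ring
              _ ≤ _ := norm_add_le _ _
          linarith
      · intro h; exact absurd (Finset.mem_univ i) h
    have hpos : 0 < ‖x - z i‖ := norm_pos_iff.2 (sub_ne_zero.2 (hx i))
    by_cases hij : i = j
    · subst hij
      rw [hsum] at h
      have h1 : x - z i = ((‖x - z i‖ / δ : ℝ) : ℂ) * (w i - z i) := by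
        have : x - z i - ((‖x - z i‖ / δ : ℝ) : ℂ) * (w i - z i) =
          x + ((1 - ‖x - z i‖ / δ : ℝ) : ℂ) * (w i - z i) - w i := by push_cast; ring
        rw [← sub_eq_zero, this, h, sub_self]
      have h2 := congrArg norm h1
      rw [norm_mul, Complex.norm_real, Real.norm_of_nonneg (by positivity)] at h2
      have h3 : ‖x - z i‖ / δ * ‖w i - z i‖ < ‖x - z i‖ / δ * δ :=
        mul_lt_mul_of_pos_left (hw i) (by positivity)
      rw [div_mul_cancel₀ _ hδ.ne'] at h3
      linarith
    · have h1 := hsep i j hij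
      have h2 : ‖z i - z j‖ ≤ ‖w j - z j‖ + ‖x - z i‖ + ‖w i - z i‖ := by
        have e : z i - z j = (w j - z j) - (x - z i) - ((1 - ‖x - z i‖ / δ : ℝ) : ℂ) * (w i - z i) := by
          rw [← h, hsum]; ring
        have h3 : ‖((1 - ‖x - z i‖ / δ : ℝ) : ℂ) * (w i - z i)‖ ≤ ‖w i - z i‖ := by
          rw [norm_mul, Complex.norm_real, Real.norm_of_nonneg]
          · apply mul_le_of_le_one_left (norm_nonneg _)
            have : 0 ≤ ‖x - z i‖ / δ := by positivity
            linarith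
          · rw [sub_nonneg, div_le_one hδ]; exact hi.le
        calc ‖z i - z j‖ = _ := congrArg norm e
          _ ≤ ‖(w j - z j) - (x - z i)‖ + _ := norm_sub_le _ _
          _ ≤ ‖w j - z j‖ + ‖x - z i‖ + ‖((1 - ‖x - z i‖ / δ : ℝ) : ℂ) * (w i - z i)‖ := by
            gcongr; exact norm_sub_le _ _
          _ ≤ _ := by gcongr
      linarith [hw i, hw j]
  · push Not at hi
    have : phi δ z w x = x := by
      unfold phi
      rw [Finset.sum_eq_zero, add_zero]
      intro l _
      rw [max_eq_left]
      · simp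
      · rw [sub_nonpos, one_le_div hδ]; exact hi l
    rw [this] at h
    have := hi j
    rw [h] at this
    linarith [hw j]

theorem lift_last {A : Type*} [PseudoMetricSpace A] [CompactSpace A] {n : ℕ}
    (z : C(I × A, Fin n → ℂ)) (hz : ∀ p, Function.Injective (z p)) (g0 : C(A, ℂ))
    (hg0 : ∀ a i, g0 a ≠ z (0, a) i) :
    ∃ g : C(I × A, ℂ), (∀ a, g (0, a) = g0 a) ∧ (∀ p i, g p ≠ z p i) ∧
      (∀ a b, g0 a = g0 b → (∀ t, z (t, a) = z (t, b)) → ∀ t, g (t, a) = g (t, b)) := by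
  obtain ⟨δ, hδ, hsep⟩ : ∃ δ : ℝ, 0 < δ ∧ ∀ p i j, i ≠ j → 4 * δ ≤ ‖z p i - z p j‖ := by
    let Q := {q : Fin n × Fin n // q.1 ≠ q.2}
    let F : (I × A) × Q → ℝ := fun y => ‖z y.1 y.2.1.1 - z y.1 y.2.1.2‖
    have hF : Continuous F := by
      rw [continuous_prod_of_discrete_right]
      intro q
      simp only [F]
      fun_prop
    obtain ⟨c, hc, h⟩ := isCompact_univ.exists_forall_le' (a := 0) hF.continuousOn (by
      rintro ⟨p, q⟩ _
      exact norm_pos_iff.2 (sub_ne_zero.2 fun h => q.2 (hz p h)))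
    refine ⟨c / 4, by positivity, fun p i j hij => ?_⟩
    have := h (p, ⟨(i, j), hij⟩) trivial
    simp only [F] at this
    linarith
  obtain ⟨ε, hε, hu⟩ := Metric.uniformContinuous_iff.1
    (CompactSpace.uniformContinuous_of_continuous z.continuous) δ hδ
  obtain ⟨N, hN⟩ := exists_nat_one_div_lt hε
  let pr : ℝ → I := Set.projIcc (0 : ℝ) 1 zero_le_one
  have hpr : Continuous pr := continuous_projIcc
  let zr : ℝ → A → Fin n → ℂ := fun t a => z (pr t, a)
  have hzr : Continuous fun p : ℝ × A => zr p.1 p.2 := by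
    simp only [zr]; fun_prop
  have hclose : ∀ s t a i, |s - t| ≤ 1 / (N + 1 : ℝ) → ‖zr s a i - zr t a i‖ < δ := by
    intro s t a i h
    have h1 : dist (pr s, a) (pr t, a) < ε := by
      rw [Prod.dist_eq, dist_self, max_eq_left dist_nonneg, Subtype.dist_eq, Real.dist_eq]
      exact (Set.abs_projIcc_sub_projIcc zero_le_one).trans_lt (h.trans_lt hN)
    have h2 := (dist_le_pi_dist _ _ i).trans_lt (hu h1)
    rwa [dist_eq_norm] at h2
  have main : ∀ j : ℕ, ∃ g : ℝ × A → ℂ, Continuous g ∧ (∀ a, g (0, a) = g0 a) ∧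
      (∀ t a i, 0 ≤ t → t ≤ (j : ℝ) / (N + 1) → g (t, a) ≠ zr t a i) ∧
      (∀ a b, g0 a = g0 b → (∀ t, z (t, a) = z (t, b)) → ∀ t, g (t, a) = g (t, b)) := by
    intro j
    induction j with
    | zero =>
      refine ⟨fun p => g0 p.2, by fun_prop, fun _ => rfl, ?_, fun a b h _ _ => h⟩
      intro t a i h1 h2
      have : t = 0 := le_antisymm (by simpa using h2) h1
      subst this
      have : pr 0 = 0 := Set.projIcc_of_le_left _ le_rfl
      simp only [zr, this]
      exact hg0 a i
    | succ j ih =>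
      obtain ⟨g, hg, hg1, hg2, hg3⟩ := ih
      set τ : ℝ := (j : ℝ) / (N + 1) with hτ
      have hτ0 : 0 ≤ τ := by positivity
      have same : ∀ t a, t ≤ τ → phi δ (zr τ a) (zr (max t τ) a) (g (min t τ, a)) = g (t, a) := by
        intro t a h
        rw [max_eq_right h, min_eq_left h, phi_self]
      refine ⟨fun p => phi δ (zr τ p.2) (zr (max p.1 τ) p.2) (g (min p.1 τ, p.2)), ?_, ?_, ?_, ?_⟩
      · have c1 : Continuous fun p : ℝ × A => zr τ p.2 :=
          hzr.comp (f := fun p : ℝ × A => (τ, p.2)) (by fun_prop)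
        have c2 : Continuous fun p : ℝ × A => zr (max p.1 τ) p.2 :=
          hzr.comp (f := fun p : ℝ × A => (max p.1 τ, p.2)) (by fun_prop)
        have c3 : Continuous fun p : ℝ × A => g (min p.1 τ, p.2) := by fun_prop
        unfold phi
        fun_prop
      · intro a
        simp only
        rw [same 0 a hτ0, hg1]
      · intro t a i h1 h2
        simp only
        rcases le_total t τ with h | h
        · rw [same t a h]; exact hg2 t a i h1 h
        · rw [max_eq_left h, min_eq_right h]
          refine phi_avoid hδ (fun i j hij => hsep _ i j hij) ?_ (fun i => hg2 τ a i hτ0 le_rfl) i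
          intro i
          apply hclose
          rw [abs_of_nonneg (sub_nonneg.2 h)]
          have : ((j + 1 : ℕ) : ℝ) / (N + 1) = τ + 1 / (N + 1) := by rw [hτ]; push_cast; ring
          linarith
      · intro a b h1 h2 t
        have e : ∀ s, zr s a = zr s b := fun s => h2 _
        simp only
        rw [e, e, hg3 a b h1 h2]
  obtain ⟨g, hg, hg1, hg2, hg3⟩ := main (N + 1)
  refine ⟨⟨fun p => g (p.1, p.2), by fun_prop⟩, fun a => hg1 a, ?_, ?_⟩
  · rintro ⟨t, a⟩ i
    have := hg2 t a i t.2.1 (by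
      push_cast
      rw [div_self (by positivity)]
      exact t.2.2)
    have e : pr t = t := Set.projIcc_val _ t
    simp only [zr, e] at this
    exact this
  · intro a b h1 h2 t
    exact hg3 a b h1 h2 t

end
end FN

namespace FN
open unitInterval Topology

variable {k n : ℕ}

theorem cont_coord {T : Type*} [TopologicalSpace T] {f : T → ConfigSpace n} (hf : Continuous f)
    (i : Fin n) : Continuous fun a => (f a).1 i :=
  (continuous_apply i).comp (continuous_subtype_val.comp hf)

/-- forget the first point -/
def tl (x : ConfigSpace (n + 1)) : ConfigSpace n :=
  ⟨Fin.tail x.1, x.2.comp (Fin.succ_injective n)⟩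

theorem continuous_tl : Continuous (tl (n := n)) := by
  refine Continuous.subtype_mk ?_ _
  exact continuous_pi fun i => cont_coord continuous_id i.succ

theorem lift_homotopy (f : C(Fin k → I, ConfigSpace (n + 1))) (hb : BConst f)
    (F : C(I × (Fin k → I), ConfigSpace n)) (h0 : ∀ a, F (0, a) = tl (f a))
    (hF : ∀ t, ∀ a ∈ Cube.boundary (Fin k), ∀ b ∈ Cube.boundary (Fin k), F (t, a) = F (t, b)) :
    ∃ g : C(Fin k → I, ConfigSpace (n + 1)), ContinuousMap.HomotopicWith f g BConst ∧
      ∀ a, tl (g a) = F (1, a) := by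
  obtain ⟨g, hg0, hg1, hg2⟩ := lift_last (A := Fin k → I) ⟨fun p => (F p).1, by fun_prop⟩
    (fun p => (F p).2) ⟨fun a => (f a).1 0, cont_coord f.continuous 0⟩ (by
      intro a i h
      simp only [ContinuousMap.coe_mk] at h
      rw [h0 a] at h
      have := (f a).2 h
      exact absurd this.symm (Fin.succ_ne_zero i))
  let H : I × (Fin k → I) → ConfigSpace (n + 1) := fun p => ⟨Fin.cons (g p) (F p).1, by
    rw [Fin.cons_injective_iff]
    refine ⟨?_, (F p).2⟩
    rintro ⟨i, hi⟩
    exact hg1 p i hi.symm⟩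
  have hH : Continuous H := by
    refine Continuous.subtype_mk ?_ _
    refine continuous_pi fun i => ?_
    refine Fin.cases ?_ (fun i => ?_) i
    · simp only [Fin.cons_zero]; fun_prop
    · simp only [Fin.cons_succ]; exact cont_coord F.continuous i
  refine ⟨⟨fun a => H (1, a), by fun_prop⟩, homotopicWith_of H hH ?_ (fun a => rfl) ?_, ?_⟩
  · intro a
    apply Subtype.ext
    simp only [H, hg0, h0]
    exact Fin.cons_self_tail _
  · intro t a ha b hb'
    apply Subtype.ext
    simp only [H]
    rw [hF t a ha b hb', hg2 a b (congrArg (fun x => x.1 0) (hb a ha b hb'))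
      (fun t => congrArg Subtype.val (hF t a ha b hb')) t]
  · intro a
    apply Subtype.ext
    exact Fin.tail_cons (α := fun _ => ℂ) (g (1, a)) (F (1, a)).1

theorem joined (c w : ConfigSpace n) : Joined c w := by
  let B : Fin n × Fin n → Set ℂ := fun q => {s | q.1 ≠ q.2 ∧
    c.1 q.1 + s * (w.1 q.1 - c.1 q.1) = c.1 q.2 + s * (w.1 q.2 - c.1 q.2)}
  have hB : (⋃ q, B q).Countable := by
    refine Set.countable_iUnion fun q => Set.Subsingleton.countable ?_
    rintro s ⟨hq, hs⟩ s' ⟨-, hs'⟩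
    by_contra hne
    have h1 : (s - s') * ((w.1 q.1 - c.1 q.1) - (w.1 q.2 - c.1 q.2)) = 0 := by linear_combination hs - hs'
    rcases mul_eq_zero.1 h1 with h | h
    · exact hne (sub_eq_zero.1 h)
    · apply hq; apply c.2; linear_combination hs - s * h
  have hpc := hB.isPathConnected_compl_of_one_lt_rank (by
    rw [Complex.rank_real_complex]; norm_num)
  have m0 : (0 : ℂ) ∈ (⋃ q, B q)ᶜ := by
    simp only [Set.mem_compl_iff, Set.mem_iUnion, not_exists]
    rintro q ⟨hq, h⟩
    apply hq; apply c.2; simpa using h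
  have m1 : (1 : ℂ) ∈ (⋃ q, B q)ᶜ := by
    simp only [Set.mem_compl_iff, Set.mem_iUnion, not_exists]
    rintro q ⟨hq, h⟩
    apply hq; apply w.2; simpa using h
  obtain ⟨γ, hγ⟩ := hpc.joinedIn 0 m0 1 m1
  refine ⟨⟨⟨fun t => ⟨fun i => c.1 i + γ t * (w.1 i - c.1 i), ?_⟩, ?_⟩, ?_, ?_⟩⟩
  · intro i j hij
    by_contra hne
    exact hγ t (Set.mem_iUnion.2 ⟨(i, j), hne, hij⟩)
  · refine Continuous.subtype_mk ?_ _
    fun_prop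
  · apply Subtype.ext; funext i; simp
  · apply Subtype.ext; funext i; simp

/-- the standard configuration -/
def std (n : ℕ) : ConfigSpace n := ⟨fun i => ((i : ℕ) : ℂ), fun i j h => by
  apply Fin.ext; simp only at h; exact_mod_cast h⟩

theorem asph_config (hk : 2 ≤ k) (n : ℕ) : Asph k (ConfigSpace n) := by
  induction n with
  | zero =>
    intro f hb
    refine ⟨f 0, ?_⟩
    have : ContinuousMap.const _ (f 0) = f := by
      ext a i; exact i.elim0
    rw [this]
    exact ContinuousMap.HomotopicWith.refl f hb
  | succ n ih =>
    intro f hb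
    let tlc : C(ConfigSpace (n + 1), ConfigSpace n) := ⟨tl, continuous_tl⟩
    obtain ⟨c, ⟨F⟩⟩ := ih (tlc.comp f) (fun a ha b hb' => congrArg tl (hb a ha b hb'))
    obtain ⟨g, hg, hg1⟩ := lift_homotopy f hb F.toContinuousMap (fun a => F.apply_zero a)
      (fun t a ha b hb' => F.prop t a ha b hb')
    have hg1' : ∀ a, tl (g a) = c := fun a => (hg1 a).trans (F.apply_one a)
    obtain ⟨γ⟩ := joined c (std n)
    obtain ⟨g', hg', hg1'⟩ := lift_homotopy g (BConst.right hg) ⟨fun p => γ p.1, by fun_prop⟩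
      (fun a => by simp [hg1']) (fun t a ha b hb' => rfl)
    refine asph_of_homotopic (hg.trans hg') ?_
    have hs : ∀ a, tl (g' a) = std n := fun a => by rw [hg1']; simp
    let h : C(Fin k → I, P n) := ⟨fun a => ⟨(g' a).1 0, fun i hi => by
      have h1 : (tl (g' a)).1 i = (std n).1 i := by rw [hs a]
      have h2 : (g' a).1 0 = (g' a).1 i.succ := hi.trans h1.symm
      exact absurd ((g' a).2 h2).symm (Fin.succ_ne_zero i)⟩,
        Continuous.subtype_mk (cont_coord g'.continuous 0) _⟩
    let ι : C(P n, ConfigSpace (n + 1)) := ⟨fun w => ⟨Fin.cons w.1 (std n).1, by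
      rw [Fin.cons_injective_iff]
      refine ⟨?_, (std n).2⟩
      rintro ⟨i, hi⟩
      exact w.2 i hi.symm⟩, by
        refine Continuous.subtype_mk ?_ _
        refine continuous_pi fun i => ?_
        refine Fin.cases ?_ (fun i => ?_) i
        · simp only [Fin.cons_zero]; fun_prop
        · simp only [Fin.cons_succ]; fun_prop⟩
    obtain ⟨c', hc'⟩ := asph_P hk n h (fun a ha b hb' => by
      apply Subtype.ext
      exact congrArg (fun x => x.1 0) (BConst.right hg' a ha b hb'))
    refine ⟨ι c', ?_⟩
    have e : g' = ι.comp h := by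
      ext1 a
      apply Subtype.ext
      have h1 : Fin.tail (g' a).1 = (std n).1 := congrArg Subtype.val (hs a)
      simp only [ι, h, ContinuousMap.comp_apply, ContinuousMap.coe_mk]
      rw [← h1]
      exact (Fin.cons_self_tail _).symm
    rw [e]
    exact homotopicWith_map hc' ι

end FN

namespace FN
open unitInterval Topology

variable {n : ℕ}

instance actPerm : MulAction (Equiv.Perm (Fin n)) (ConfigSpace n) where
  smul g x := ⟨fun i => x.1 (g⁻¹ i), x.2.comp (g⁻¹).injective⟩
  one_smul x := rfl
  mul_smul g h x := by
    apply Subtype.ext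
    funext i
    change x.1 ((g * h)⁻¹ i) = x.1 (h⁻¹ (g⁻¹ i))
    rw [mul_inv_rev]; rfl

theorem smul_coord (g : Equiv.Perm (Fin n)) (x : ConfigSpace n) (i : Fin n) :
    (g • x).1 i = x.1 (g⁻¹ i) := rfl

theorem cov_config : IsCoveringMap (Quotient.mk (configSetoid n)) := by
  have : IsQuotientCoveringMap (Quotient.mk (configSetoid n)) (Equiv.Perm (Fin n)) :=
    { isQuotientMap_quotient_mk' with
      continuous_const_smul := by
        intro g
        refine Continuous.subtype_mk ?_ _
        exact continuous_pi fun i => cont_coord continuous_id (g⁻¹ i)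
      apply_eq_iff_mem_orbit := by
        intro e₁ e₂
        rw [Quotient.eq]
        constructor
        · rintro ⟨π, h⟩
          refine ⟨π, ?_⟩
          apply Subtype.ext
          funext i
          change e₂.1 (π⁻¹ i) = _
          rw [← h]
          simp
        · rintro ⟨π, rfl⟩
          refine ⟨π, ?_⟩
          funext i
          change e₂.1 (π⁻¹ (π i)) = _
          simp
      disjoint := by
        intro e
        refine ⟨⋂ i, ⋂ j, {x | i ≠ j → ‖x.1 i - e.1 i‖ < ‖x.1 i - e.1 j‖}, ?_, ?_⟩
        · rw [Filter.iInter_mem]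
          intro i
          rw [Filter.iInter_mem]
          intro j
          by_cases hij : i = j
          · simp [hij]
          · have ho : IsOpen {x : ConfigSpace n | ‖x.1 i - e.1 i‖ < ‖x.1 i - e.1 j‖} := by
              have hi := cont_coord (n := n) continuous_id i
              exact isOpen_lt (hi.sub continuous_const).norm (hi.sub continuous_const).norm
            refine Filter.mem_of_superset (ho.mem_nhds ?_) (fun x hx _ => hx)
            simp only [Set.mem_ofPred_eq, sub_self, norm_zero]
            exact norm_pos_iff.2 (sub_ne_zero.2 fun h => hij (e.2 h))
        · rintro g ⟨_, ⟨x, hx, rfl⟩, hgx⟩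
          simp only [Set.mem_iInter, Set.mem_ofPred_eq] at hx hgx
          by_contra hg
          obtain ⟨i, hi⟩ : ∃ i, g⁻¹ i ≠ i := by
            by_contra! hall
            apply hg
            rw [← inv_inv g, inv_eq_one]
            exact Equiv.ext hall
          have h1 := hx (g⁻¹ i) i hi
          have h2 := hgx i (g⁻¹ i) (Ne.symm hi)
          rw [smul_coord] at h2
          exact lt_asymm h1 h2 }
  exact this.isCoveringMap

end FN

open scoped Topology in
/-- (Fadell–Neuwirth) The ordered and unordered configuration spaces of `n ≥ 1` points
in `ℂ` are aspherical: all higher homotopy groups vanish. -/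
theorem configSpaces_aspherical (n : ℕ) (hn : 1 ≤ n) (k : ℕ) (hk : 2 ≤ k) :
    (∀ x : ConfigSpace n, Subsingleton (π_ k (ConfigSpace n) x)) ∧
    (∀ y : UConfigSpace n, Subsingleton (π_ k (UConfigSpace n) y)) := by
  have h := FN.asph_config hk n
  refine ⟨fun x => FN.asph_subsingleton (by omega) h x, fun y => ?_⟩
  exact FN.asph_subsingleton (by omega)
    (FN.asph_of_covering hk FN.cov_config Quotient.mk_surjective h) y
end

section
/- The braid group B_n is residually finite: for every β ∈ B_n with β ≠ 1, there exist a finite group H and a group homomorphism φ : B_n → H such that φ(β) ≠ 1. -/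
namespace BraidRF

open FreeGroup (of lift_apply_of)

/-! ### Residual finiteness of free groups -/

/-- Partial left translations of a finite subset of a group extend to permutations. -/
theorem exists_perm_rep {α : Type} {G : Type} [Group G] (f : α → G) (T : Set G) (hT : T.Finite) :
    ∃ φ : FreeGroup α →* Equiv.Perm T, ∀ (a : α) (t : T) (h : f a * t ∈ T),
      φ (of a) t = ⟨f a * t, h⟩ := by
  classical
  have : Finite T := hT
  let e : ∀ a : α, {t : T // f a * (t : G) ∈ T} ≃ {t : T // (f a)⁻¹ * (t : G) ∈ T} := fun a =>
    { toFun := fun t => ⟨⟨f a * t.1, t.2⟩, by simp⟩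
      invFun := fun t => ⟨⟨(f a)⁻¹ * t.1, t.2⟩, by simp⟩
      left_inv := fun t => by ext; simp
      right_inv := fun t => by ext; simp }
  refine ⟨FreeGroup.lift fun a => (e a).extendSubtype, fun a t h => ?_⟩
  rw [FreeGroup.lift_apply_of, Equiv.extendSubtype_apply_of_mem (e a) t h]
  rfl

/-- Free groups are residually finite. -/
theorem freeGroup_rf (x : FreeGroup ℕ) (hx : x ≠ 1) :
    ∃ (Q : Type) (_ : Group Q) (_ : Finite Q) (φ : FreeGroup ℕ →* Q), φ x ≠ 1 := by
  classical
  set L := x.toWord with hL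
  let T : Set (FreeGroup ℕ) := FreeGroup.mk '' {l | l ∈ L.tails}
  have hT : T.Finite := (List.finite_toSet L.tails).image _
  obtain ⟨φ, hφ⟩ := exists_perm_rep (fun a : ℕ => (of a : FreeGroup ℕ)) T hT
  have : Finite T := hT
  have key : ∀ l : List (ℕ × Bool), (hl : l <:+ L) → ∀ (h1 : (1 : FreeGroup ℕ) ∈ T)
      (hm : FreeGroup.mk l ∈ T), φ (FreeGroup.mk l) ⟨1, h1⟩ = ⟨FreeGroup.mk l, hm⟩ := by
    intro l
    induction l with
    | nil =>
      intro hl h1 hm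
      change φ 1 _ = _
      rw [map_one]; rfl
    | cons p l ih =>
      intro hl h1 hm
      obtain ⟨a, b⟩ := p
      have hl' : l <:+ L := (List.suffix_cons _ _).trans hl
      have hm' : FreeGroup.mk l ∈ T := ⟨l, by simpa using hl', rfl⟩
      have ih' := ih hl' h1 hm'
      cases b with
      | true =>
        have e : FreeGroup.mk ((a, true) :: l) = of a * FreeGroup.mk l := by
          rw [FreeGroup.of, FreeGroup.mul_mk]; rfl
        have hm2 : of a * FreeGroup.mk l ∈ T := e ▸ hm
        have := hφ a ⟨_, hm'⟩ hm2
        simp only [e, map_mul, Equiv.Perm.mul_apply, ih', this]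
      | false =>
        have e : FreeGroup.mk ((a, false) :: l) = (of a)⁻¹ * FreeGroup.mk l := by
          rw [FreeGroup.of, FreeGroup.inv_mk, FreeGroup.mul_mk]; rfl
        have hm2 : (of a)⁻¹ * FreeGroup.mk l ∈ T := e ▸ hm
        have := hφ a ⟨_, hm2⟩ (by simpa using hm')
        simp only [e, map_mul, Equiv.Perm.mul_apply, ih', map_inv]
        rw [Equiv.Perm.inv_eq_iff_eq, this]
        simp
  refine ⟨Equiv.Perm T, inferInstance, inferInstance, φ, fun h => hx ?_⟩
  have h1 : (1 : FreeGroup ℕ) ∈ T := ⟨[], by simp, rfl⟩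
  have hm : FreeGroup.mk L ∈ T := ⟨L, by simp, rfl⟩
  have h2 := key L (List.suffix_refl L) h1 hm
  have hxL : FreeGroup.mk L = x := FreeGroup.mk_toWord
  have := congrArg Subtype.val h2
  simp only [hxL, h] at this
  exact this.symm

/-- Separating an element acting nontrivially on a free group. -/
theorem separate {G : Type} [Group G] (n : ℕ) (ρ : G →* MulAut (FreeGroup ℕ))
    (hρ : ∀ g i, n ≤ i → ρ g (of i) = of i) (β : G) (hβ : ρ β ≠ 1) :
    ∃ (H : Type) (_ : Group H) (_ : Finite H) (φ : G →* H), φ β ≠ 1 := by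
  obtain ⟨x, hx⟩ : ∃ x, ρ β x ≠ x := by
    by_contra! h
    exact hβ (MulEquiv.ext h)
  obtain ⟨Q, _, _, f, hf⟩ := freeGroup_rf (ρ β x * x⁻¹) (by rwa [Ne, mul_inv_eq_one])
  let X := {g : FreeGroup ℕ →* Q // ∀ i, n ≤ i → g (of i) = f (of i)}
  have : Finite X := by
    refine Finite.of_injective (β := Fin n → Q) (fun g i => g.1 (of (i : ℕ))) ?_
    intro g h hgh
    apply Subtype.ext
    apply FreeGroup.ext_hom
    intro i
    by_cases hi : n ≤ i
    · rw [g.2 i hi, h.2 i hi]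
    · exact congrFun hgh ⟨i, by omega⟩
  letI : MulAction G X :=
    { smul := fun g h => ⟨h.1.comp (ρ g⁻¹).toMonoidHom, fun i hi => by
        simp only [MonoidHom.comp_apply, MulEquiv.coe_toMonoidHom, hρ _ i hi, h.2 i hi]⟩
      one_smul := fun h => by
        apply Subtype.ext; apply MonoidHom.ext; intro y
        change h.1 (ρ (1 : G)⁻¹ y) = _
        simp
      mul_smul := fun a b h => by
        apply Subtype.ext; apply MonoidHom.ext; intro y
        change h.1 (ρ (a * b)⁻¹ y) = h.1 (ρ b⁻¹ (ρ a⁻¹ y))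
        rw [mul_inv_rev, map_mul]; rfl }
  refine ⟨Equiv.Perm X, inferInstance, inferInstance, MulAction.toPermHom G X, fun h => hf ?_⟩
  have h1 : β • (⟨f, fun _ _ => rfl⟩ : X) = ⟨f, fun _ _ => rfl⟩ := by
    have := congrArg (fun p : Equiv.Perm X => p ⟨f, fun _ _ => rfl⟩) h
    exact this
  have h2 := congrArg (fun g : X => g.1 (ρ β x)) h1
  change f (ρ β⁻¹ (ρ β x)) = f (ρ β x) at h2
  rw [← MulAut.mul_apply, ← map_mul, inv_mul_cancel, map_one, MulAut.one_apply] at h2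
  rw [map_mul, map_inv, ← h2, mul_inv_cancel]

/-! ### The Artin action -/

/-- Artin endomorphism. -/
def artFun (i : ℕ) : FreeGroup ℕ →* FreeGroup ℕ :=
  FreeGroup.lift fun k => if k = i then of (i + 1) else
    if k = i + 1 then (of (i + 1))⁻¹ * of i * of (i + 1) else of k

/-- Inverse Artin endomorphism. -/
def artInv (i : ℕ) : FreeGroup ℕ →* FreeGroup ℕ :=
  FreeGroup.lift fun k => if k = i then of i * of (i + 1) * (of i)⁻¹ else
    if k = i + 1 then of i else of k

/-- Artin automorphism. -/
def art (i : ℕ) : MulAut (FreeGroup ℕ) :=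
  MonoidHom.toMulEquiv (artFun i) (artInv i)
    (by
      ext k
      simp only [artFun, artInv, MonoidHom.comp_apply, lift_apply_of, MonoidHom.id_apply]
      split_ifs <;> simp_all [mul_assoc])
    (by
      ext k
      simp only [artFun, artInv, MonoidHom.comp_apply, lift_apply_of, MonoidHom.id_apply]
      split_ifs <;> simp_all [mul_assoc])

theorem art_self (i : ℕ) : art i (of i) = of (i + 1) := by
  change artFun i (of i) = _
  simp [artFun]

theorem art_succ (i : ℕ) : art i (of (i + 1)) = (of (i + 1))⁻¹ * of i * of (i + 1) := by
  change artFun i (of (i + 1)) = _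
  simp [artFun]

theorem art_ne (i k : ℕ) (h : k ≠ i) (h' : k ≠ i + 1) : art i (of k) = of k := by
  change artFun i (of k) = _
  simp [artFun, h, h']

theorem aut_ext {a b : MulAut (FreeGroup ℕ)} (h : ∀ i, a (of i) = b (of i)) : a = b := by
  have : a.toMonoidHom = b.toMonoidHom := FreeGroup.ext_hom _ _ h
  exact MulEquiv.ext fun x => DFunLike.congr_fun this x

theorem art_comm (i j : ℕ) (h : i + 1 < j) : art i * art j = art j * art i := by
  apply aut_ext
  intro k
  simp only [MulAut.mul_apply]
  have hi : i ≠ j := by omega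
  rcases eq_or_ne k i with rfl | h1
  · rw [art_self, art_ne j k (by omega) (by omega), art_self, art_ne j _ (by omega) (by omega)]
  rcases eq_or_ne k (i + 1) with rfl | h2
  · rw [art_succ, art_ne j _ (by omega) (by omega), art_succ]
    simp [art_ne j i (by omega) (by omega), art_ne j (i + 1) (by omega) (by omega)]
  rw [art_ne i k h1 h2]
  rcases eq_or_ne k j with rfl | h3
  · rw [art_self, art_ne i _ (by omega) (by omega)]
  rcases eq_or_ne k (j + 1) with rfl | h4
  · rw [art_succ]
    simp [art_ne i j (by omega) (by omega), art_ne i (j + 1) (by omega) (by omega)]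
  rw [art_ne j k h3 h4, art_ne i k h1 h2]

theorem art_braid (i : ℕ) : art i * art (i + 1) * art i = art (i + 1) * art i * art (i + 1) := by
  apply aut_ext
  intro k
  simp only [MulAut.mul_apply]
  have e1 : art (i + 1) (of i) = of i := art_ne _ _ (by omega) (by omega)
  have e2 : art i (of (i + 1 + 1)) = of (i + 1 + 1) := art_ne _ _ (by omega) (by omega)
  have e3 := art_self (i + 1)
  have e4 := art_succ (i + 1)
  rcases eq_or_ne k i with rfl | h1
  · simp [art_self, art_succ, e1, e2, e3, e4]
  rcases eq_or_ne k (i + 1) with rfl | h2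
  · simp [art_self, art_succ, e1, e2, e3, e4, mul_assoc]
  rcases eq_or_ne k (i + 1 + 1) with rfl | h3
  · simp [art_self, art_succ, e1, e2, e3, e4, mul_assoc]
  rw [art_ne i k h1 h2, art_ne (i + 1) k h2 h3, art_ne i k h1 h2, art_ne (i + 1) k h2 h3]

/-! ### Centralizer of a basis element -/

/-- Kill the generator `N`. -/
def kill (N : ℕ) : FreeGroup ℕ →* FreeGroup ℕ :=
  FreeGroup.lift fun k => if k = N then 1 else of k

theorem kill_self (N : ℕ) : kill N (of N) = 1 := by simp [kill]

theorem kill_ne (N k : ℕ) (h : k ≠ N) : kill N (of k) = of k := by simp [kill, h]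

theorem kill_of_commute (N : ℕ) (v : FreeGroup ℕ) (h : v * of N * v⁻¹ = of N) : kill N v = 1 := by
  classical
  let ψ : FreeGroup ℕ →* Equiv.Perm (FreeGroup ℕ × Bool) := FreeGroup.lift fun k =>
    if k = N then Equiv.swap (1, true) (1, false)
    else (Equiv.mulLeft (of k)).prodCongr (Equiv.refl Bool)
  have hψ : ∀ k, ψ (of k) = if k = N then Equiv.swap (1, true) (1, false)
    else (Equiv.mulLeft (of k)).prodCongr (Equiv.refl Bool) := fun k => lift_apply_of
  have hof : ∀ k p, (ψ (of k) p).1 = kill N (of k) * p.1 := by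
    intro k p
    rw [hψ]
    by_cases hk : k = N
    · subst hk
      rw [if_pos rfl, kill_self, one_mul, Equiv.swap_apply_def]
      split_ifs <;> simp_all
    · rw [if_neg hk, kill_ne _ _ hk]; rfl
  have hfst : ∀ w p, (ψ w p).1 = kill N w * p.1 := by
    intro w
    induction w using FreeGroup.induction_on with
    | C1 => simp
    | of k => exact hof k
    | inv_of k ih =>
      intro p
      have := hof k ((ψ (of k)).symm p)
      rw [Equiv.apply_symm_apply] at this
      rw [map_inv, map_inv, this, inv_mul_cancel_left]; rfl
    | mul x y hx hy => intro p; simp [hx, hy, mul_assoc]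
  by_contra hne
  have hc : of N * v = v * of N := by
    rw [mul_inv_eq_iff_eq_mul] at h; exact h.symm
  have h3 := congrArg (fun w => ψ w (1, true)) hc
  simp only [map_mul, Equiv.Perm.mul_apply] at h3
  have h4 : ∀ p : FreeGroup ℕ × Bool, p.1 ≠ 1 → ψ (of N) p = p := by
    intro p hp
    rw [hψ, if_pos rfl]
    apply Equiv.swap_apply_of_ne_of_ne <;> rintro rfl <;> exact hp rfl
  rw [h4 _ (by rw [hfst]; simpa using hne), hψ, if_pos rfl, Equiv.swap_apply_left] at h3
  have := (ψ v).injective h3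
  simp at this

end BraidRF

namespace BraidRF

open FreeGroup (of lift_apply_of)

/-! ### Group theoretic part: combing -/

theorem br1 {G : Type} [Group G] {a b : G} (h : a * b * a = b * a * b) :
    a * (b * (a * a) * b⁻¹) * a⁻¹ = b * b := by
  have h1 : SemiconjBy (a * b) a b := by rw [SemiconjBy, h, mul_assoc]
  have h2 := (h1.mul_right h1).eq
  rw [mul_inv_eq_iff_eq_mul, ← mul_assoc, mul_inv_eq_iff_eq_mul, ← mul_assoc, h2]
  simp only [mul_assoc]

theorem br2 {G : Type} [Group G] {a b : G} (h : a * b * a = b * a * b) :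
    a * (b * b) * a⁻¹ = b⁻¹ * (a * a) * b := by
  have h1 : SemiconjBy (b * a) b a := by rw [SemiconjBy, ← h, mul_assoc]
  have h2 := (h1.mul_right h1).eq
  rw [mul_inv_eq_iff_eq_mul, mul_assoc, mul_assoc, eq_inv_mul_iff_mul_eq, ← mul_assoc, h2]

/-- Braid generators `s 0, …, s m` with the coset representatives `c k = s m ⋯ s k`. -/
structure Setup (G : Type) [Group G] (m : ℕ) where
  s : ℕ → G
  c : ℕ → G
  comm : ∀ i j, i + 1 < j → j ≤ m → s i * s j = s j * s i
  braid : ∀ i, i + 1 ≤ m → s i * s (i + 1) * s i = s (i + 1) * s i * s (i + 1)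
  c_top : c (m + 1) = 1
  c_step : ∀ k, k ≤ m → c k = c (k + 1) * s k

namespace Setup

variable {G : Type} [Group G] {m : ℕ} (P : Setup G m)

/-- The pure braid generators. -/
def A (k : ℕ) : G := P.c (k + 1) * (P.s k * P.s k) * (P.c (k + 1))⁻¹

/-- The subgroup generated by the `A k`. -/
def U : Subgroup G := Subgroup.closure (P.A '' {k | k ≤ m})

/-- The subgroup generated by `s 0, …, s (m-1)`. -/
def H : Subgroup G := Subgroup.closure (P.s '' {k | k < m})

theorem A_mem {k : ℕ} (h : k ≤ m) : P.A k ∈ P.U := Subgroup.subset_closure ⟨k, h, rfl⟩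

theorem s_mem {k : ℕ} (h : k < m) : P.s k ∈ P.H := Subgroup.subset_closure ⟨k, h, rfl⟩

/-- Downward induction principle. -/
theorem down {p : ℕ → Prop} (n : ℕ) (h0 : p n) (hs : ∀ k, k < n → p (k + 1) → p k) :
    ∀ k, k ≤ n → p k := by
  intro k hk
  induction hd : n - k generalizing k with
  | zero =>
    obtain rfl : k = n := by omega
    exact h0
  | succ d ih => exact hs k (by omega) (ih (k + 1) (by omega) (by omega))

theorem c_comm (j k : ℕ) (hjk : j + 1 < k) (hk : k ≤ m + 1) : Commute (P.s j) (P.c k) := by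
  revert hjk
  refine down (p := fun k => j + 1 < k → Commute (P.s j) (P.c k)) (m + 1) ?_ ?_ k hk
  · intro _
    rw [P.c_top]; exact Commute.one_right _
  · intro k hk ih hjk
    rw [P.c_step k (by omega)]
    exact (ih (by omega)).mul_right (P.comm j k hjk (by omega))

theorem c_shift (j k : ℕ) (hkj : k ≤ j) (hj : j < m) : P.s j * P.c k = P.c k * P.s (j + 1) := by
  refine down (p := fun k => P.s j * P.c k = P.c k * P.s (j + 1)) j ?_ ?_ k hkj
  · rw [P.c_step j (by omega), P.c_step (j + 1) (by omega)]
    have h1 := (P.c_comm j (j + 1 + 1) (by omega) (by omega)).eq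
    have h2 := P.braid j (by omega)
    calc P.s j * (P.c (j + 1 + 1) * P.s (j + 1) * P.s j)
        = (P.s j * P.c (j + 1 + 1)) * P.s (j + 1) * P.s j := by simp only [mul_assoc]
      _ = P.c (j + 1 + 1) * (P.s j * P.s (j + 1) * P.s j) := by rw [h1]; simp only [mul_assoc]
      _ = _ := by rw [h2]; simp only [mul_assoc]
  · intro k hk ih
    rw [P.c_step k (by omega), ← mul_assoc, ih, mul_assoc, mul_assoc,
      P.comm k (j + 1) (by omega) (by omega)]

theorem F1 (j k : ℕ) (hj : j < m) (hk : k ≤ m) (h1 : k ≠ j) (h2 : k ≠ j + 1) :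
    Commute (P.s j) (P.A k) := by
  rcases lt_or_gt_of_ne h1 with h | h
  · have e : SemiconjBy (P.c (k + 1)) (P.s (j + 1)) (P.s j) :=
      (P.c_shift j (k + 1) (by omega) hj).symm
    have e2 : Commute (P.s (j + 1)) (P.s k) := (P.comm k (j + 1) (by omega) (by omega)).symm
    have e3 := (e2.mul_right e2).eq
    change P.s j * P.A k = P.A k * P.s j
    have e4 := e.inv_symm_left.eq
    have e5 := e.eq
    unfold A
    calc _ = (P.s j * P.c (k + 1)) * (P.s k * P.s k) * (P.c (k + 1))⁻¹ := by
            simp only [mul_assoc]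
      _ = P.c (k + 1) * (P.s (j + 1) * (P.s k * P.s k)) * (P.c (k + 1))⁻¹ := by
            rw [← e5]; simp only [mul_assoc]
      _ = P.c (k + 1) * (P.s k * P.s k) * (P.s (j + 1) * (P.c (k + 1))⁻¹) := by
            rw [e3]; simp only [mul_assoc]
      _ = _ := by rw [← e4]; simp only [mul_assoc]
  · have e := P.c_comm j (k + 1) (by omega) (by omega)
    have e2 : Commute (P.s j) (P.s k) := P.comm j k (by omega) (by omega)
    exact (e.mul_right (e2.mul_right e2)).mul_right e.inv_right

theorem F2 (j : ℕ) (hj : j < m) : P.s j * P.A j * (P.s j)⁻¹ = P.A (j + 1) := by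
  have e := (P.c_comm j (j + 1 + 1) (by omega) (by omega)).eq
  have h := br1 (P.braid j (by omega))
  unfold A
  rw [← h, P.c_step (j + 1) (by omega)]
  have e' : (P.c (j + 1 + 1))⁻¹ * (P.s j)⁻¹ = (P.s j)⁻¹ * (P.c (j + 1 + 1))⁻¹ := by
    rw [← mul_inv_rev, e, mul_inv_rev]
  calc _ = (P.s j * P.c (j + 1 + 1)) * (P.s (j + 1) * (P.s j * P.s j) * (P.s (j + 1))⁻¹) *
        ((P.c (j + 1 + 1))⁻¹ * (P.s j)⁻¹) := by simp only [mul_assoc, mul_inv_rev]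
    _ = _ := by rw [e, e']; simp only [mul_assoc]

theorem F3 (j : ℕ) (hj : j < m) :
    P.s j * P.A (j + 1) * (P.s j)⁻¹ = (P.A (j + 1))⁻¹ * P.A j * P.A (j + 1) := by
  have e := (P.c_comm j (j + 1 + 1) (by omega) (by omega)).eq
  have h := br2 (P.braid j (by omega))
  have e' : (P.c (j + 1 + 1))⁻¹ * (P.s j)⁻¹ = (P.s j)⁻¹ * (P.c (j + 1 + 1))⁻¹ := by
    rw [← mul_inv_rev, e, mul_inv_rev]
  unfold A
  rw [P.c_step (j + 1) (by omega)]
  calc _ = (P.s j * P.c (j + 1 + 1)) * (P.s (j + 1) * P.s (j + 1)) *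
        ((P.c (j + 1 + 1))⁻¹ * (P.s j)⁻¹) := by simp only [mul_assoc]
    _ = P.c (j + 1 + 1) * (P.s j * (P.s (j + 1) * P.s (j + 1)) * (P.s j)⁻¹) *
        (P.c (j + 1 + 1))⁻¹ := by rw [e, e']; simp only [mul_assoc]
    _ = _ := by rw [h]; group

theorem conj_U {g : G} (h : ∀ k, k ≤ m → g * P.A k * g⁻¹ ∈ P.U) :
    ∀ u ∈ P.U, g * u * g⁻¹ ∈ P.U := by
  have : P.U ≤ P.U.comap (MulAut.conj g).toMonoidHom := by
    conv_lhs => unfold U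
    rw [Subgroup.closure_le]
    rintro _ ⟨k, hk, rfl⟩
    exact h k hk
  exact fun u hu => this hu

theorem normalizes {h : G} (hh : h ∈ P.H) :
    (∀ u ∈ P.U, h * u * h⁻¹ ∈ P.U) ∧ (∀ u ∈ P.U, h⁻¹ * u * h⁻¹⁻¹ ∈ P.U) := by
  induction hh using Subgroup.closure_induction with
  | mem x hx =>
    obtain ⟨j, hj, rfl⟩ := hx
    have hj : j < m := hj
    have e1 := P.F2 j hj
    have e2 := P.F3 j hj
    have m1 := P.A_mem (k := j) (by omega)
    have m2 := P.A_mem (k := j + 1) (by omega)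
    constructor
    · apply P.conj_U
      intro k hk
      rcases eq_or_ne k j with rfl | h1
      · rw [e1]; exact m2
      rcases eq_or_ne k (j + 1) with rfl | h2
      · rw [e2]; exact mul_mem (mul_mem (inv_mem m2) m1) m2
      rw [(P.F1 j k hj hk h1 h2).eq, mul_inv_cancel_right]
      exact P.A_mem hk
    · apply P.conj_U
      intro k hk
      rw [inv_inv]
      rcases eq_or_ne k j with rfl | h1
      · have : (P.s k)⁻¹ * P.A k * P.s k = P.A k * P.A (k + 1) * (P.A k)⁻¹ := by
          have e3 : P.A k = P.A (k + 1) * (P.s k * P.A (k + 1) * (P.s k)⁻¹) *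
            (P.A (k + 1))⁻¹ := by rw [e2]; group
          rw [← e1] at e3
          calc (P.s k)⁻¹ * P.A k * P.s k = (P.s k)⁻¹ * (P.s k * P.A k * (P.s k)⁻¹ *
              (P.s k * (P.s k * P.A k * (P.s k)⁻¹) * (P.s k)⁻¹) *
              (P.s k * P.A k * (P.s k)⁻¹)⁻¹) * P.s k := by rw [← e3]
            _ = _ := by rw [← e1]; group
        rw [this]
        exact mul_mem (mul_mem m1 m2) (inv_mem m1)
      rcases eq_or_ne k (j + 1) with rfl | h2
      · have : (P.s j)⁻¹ * P.A (j + 1) * P.s j = P.A j := by rw [← e1]; group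
        rw [this]; exact m1
      rw [mul_assoc, ← (P.F1 j k hj hk h1 h2).eq, inv_mul_cancel_left]
      exact P.A_mem hk
  | one => simp
  | mul x y _ _ hx hy =>
    constructor
    · intro u hu
      have := hx.1 _ (hy.1 u hu)
      simpa [mul_assoc] using this
    · intro u hu
      have := hy.2 _ (hx.2 u hu)
      simpa [mul_assoc] using this
  | inv x _ hx =>
    refine ⟨hx.2, fun u hu => ?_⟩
    have := hx.1 u hu
    simpa using this

/-- Coset moves. -/
theorem move (k j : ℕ) (hk : k ≤ m + 1) (hj : j ≤ m) :
    (∃ t k', (t ∈ P.H ∨ t ∈ P.U) ∧ k' ≤ m + 1 ∧ P.c k * P.s j = t * P.c k') ∧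
    (∃ t k', (t ∈ P.H ∨ t ∈ P.U) ∧ k' ≤ m + 1 ∧ P.c k * (P.s j)⁻¹ = t * P.c k') := by
  rcases lt_trichotomy (j + 1) k with h | h | h
  · have e := P.c_comm j k h hk
    have hm := P.s_mem (k := j) (by omega)
    exact ⟨⟨P.s j, k, Or.inl hm, hk, e.eq.symm⟩,
      ⟨(P.s j)⁻¹, k, Or.inl (inv_mem hm), hk, e.inv_left.eq.symm⟩⟩
  · subst h
    refine ⟨⟨1, j, Or.inl (one_mem _), by omega, ?_⟩,
      ⟨(P.A j)⁻¹, j, Or.inr (inv_mem (P.A_mem hj)), by omega, ?_⟩⟩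
    · rw [P.c_step j hj, one_mul]
    · rw [P.c_step j hj, A]; group
  · rcases eq_or_ne k j with rfl | hne
    · refine ⟨⟨P.A k, k + 1, Or.inr (P.A_mem hj), by omega, ?_⟩,
        ⟨1, k + 1, Or.inl (one_mem _), by omega, ?_⟩⟩
      · rw [P.c_step k hj, A]; group
      · rw [P.c_step k hj]; group
    · obtain ⟨i, rfl⟩ : ∃ i, j = i + 1 := ⟨j - 1, by omega⟩
      have e := P.c_shift i k (by omega) (by omega)
      have hm := P.s_mem (k := i) (by omega)
      refine ⟨⟨P.s i, k, Or.inl hm, hk, e.symm⟩, ⟨(P.s i)⁻¹, k, Or.inl (inv_mem hm), hk, ?_⟩⟩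
      rw [mul_inv_eq_iff_eq_mul, mul_assoc, ← e, inv_mul_cancel_left]

theorem absorb {u h t : G} (hu : u ∈ P.U) (hh : h ∈ P.H) (ht : t ∈ P.H ∨ t ∈ P.U) :
    ∃ u' ∈ P.U, ∃ h' ∈ P.H, u * h * t = u' * h' := by
  rcases ht with ht | ht
  · exact ⟨u, hu, h * t, mul_mem hh ht, mul_assoc _ _ _⟩
  · exact ⟨u * (h * t * h⁻¹), mul_mem hu ((P.normalizes hh).1 t ht), h, hh, by group⟩

/-- Every braid is combed. -/
theorem comb {g : G} (hg : g ∈ Subgroup.closure (P.s '' {k | k < m + 1})) :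
    ∃ u ∈ P.U, ∃ h ∈ P.H, ∃ k, k ≤ m + 1 ∧ g = u * h * P.c k := by
  have step : ∀ u ∈ P.U, ∀ h ∈ P.H, ∀ x y : G,
      (∃ t k', (t ∈ P.H ∨ t ∈ P.U) ∧ k' ≤ m + 1 ∧ x * y = t * P.c k') →
      ∃ u' ∈ P.U, ∃ h' ∈ P.H, ∃ k, k ≤ m + 1 ∧ u * h * x * y = u' * h' * P.c k := by
    rintro u hu h hh x y ⟨t, k', ht, hk', e⟩
    obtain ⟨u', hu', h', hh', e'⟩ := P.absorb hu hh ht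
    exact ⟨u', hu', h', hh', k', hk', by rw [mul_assoc, e, ← mul_assoc, e']⟩
  induction hg using Subgroup.closure_induction_right with
  | one => exact ⟨1, one_mem _, 1, one_mem _, m + 1, le_rfl, by simp [P.c_top]⟩
  | mul_right x _ y hy ih =>
    obtain ⟨j, hj, rfl⟩ := hy
    obtain ⟨u, hu, h, hh, k, hk, rfl⟩ := ih
    exact step u hu h hh _ _ (P.move k j hk (Nat.lt_succ_iff.mp hj)).1
  | mul_inv_cancel x _ y hy ih =>
    obtain ⟨j, hj, rfl⟩ := hy
    obtain ⟨u, hu, h, hh, k, hk, rfl⟩ := ih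
    exact step u hu h hh _ _ (P.move k j hk (Nat.lt_succ_iff.mp hj)).2

/-! ### The action -/

section action

variable (ρ : G →* MulAut (FreeGroup ℕ))

theorem c_fix (hρ : ∀ i ≤ m, ρ (P.s i) = art i) (i k : ℕ) (hik : i < k) (hk : k ≤ m + 1) :
    ρ (P.c k) (of i) = of i := by
  revert hik
  refine down (p := fun k => i < k → ρ (P.c k) (of i) = of i) (m + 1) ?_ ?_ k hk
  · intro _; simp [P.c_top]
  · intro k hk ih hik
    rw [P.c_step k (by omega), map_mul, MulAut.mul_apply, hρ k (by omega),
      art_ne _ _ (by omega) (by omega), ih (by omega)]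

theorem c_self (hρ : ∀ i ≤ m, ρ (P.s i) = art i) (k : ℕ) (hk : k ≤ m + 1) :
    ρ (P.c k) (of k) = of (m + 1) := by
  refine down (p := fun k => ρ (P.c k) (of k) = of (m + 1)) (m + 1) ?_ ?_ k hk
  · simp [P.c_top]
  · intro k hk ih
    rw [P.c_step k (by omega), map_mul, MulAut.mul_apply, hρ k (by omega), art_self, ih]

theorem A_top (hρ : ∀ i ≤ m, ρ (P.s i) = art i) (k : ℕ) (hk : k ≤ m) :
    ρ (P.A k) (of (m + 1)) =
      ((of (m + 1))⁻¹ * (of k)⁻¹) * of (m + 1) * ((of (m + 1))⁻¹ * (of k)⁻¹)⁻¹ := by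
  have h1 := P.c_self ρ hρ (k + 1) (by omega)
  have h2 := P.c_fix ρ hρ k (k + 1) (by omega) (by omega)
  have h3 : ρ (P.c (k + 1))⁻¹ (of (m + 1)) = of (k + 1) := by
    rw [← h1, ← MulAut.mul_apply, ← map_mul, inv_mul_cancel, map_one, MulAut.one_apply]
  rw [A, map_mul, MulAut.mul_apply, h3, map_mul, map_mul, MulAut.mul_apply, MulAut.mul_apply,
    hρ k hk]
  simp only [art_succ, art_self, map_mul, map_inv, h1, h2]
  group

theorem A_kill (hρ : ∀ i ≤ m, ρ (P.s i) = art i) (k : ℕ) (hk : k ≤ m) (x : FreeGroup ℕ) :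
    kill (m + 1) (ρ (P.A k) x) = kill (m + 1) x := by
  let q : FreeGroup ℕ →* FreeGroup ℕ := (kill (m + 1)).comp (ρ (P.c (k + 1))).toMonoidHom
  have hq : ∀ y, q y = kill (m + 1) (ρ (P.c (k + 1)) y) := fun _ => rfl
  have hq1 : q (of (k + 1)) = 1 := by rw [hq, P.c_self ρ hρ (k + 1) (by omega), kill_self]
  have key : ∀ y, q (art k (art k y)) = q y := by
    intro y
    have : (q.comp (art k).toMonoidHom).comp (art k).toMonoidHom = q := by
      apply FreeGroup.ext_hom
      intro i
      change q (art k (art k (of i))) = q (of i)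
      rcases eq_or_ne i k with rfl | h1
      · simp [art_self, art_succ, hq1]
      rcases eq_or_ne i (k + 1) with rfl | h2
      · simp [art_self, art_succ, hq1]
      rw [art_ne _ _ h1 h2, art_ne _ _ h1 h2]
    exact DFunLike.congr_fun this y
  rw [A, map_mul, MulAut.mul_apply, map_mul, MulAut.mul_apply, map_mul, MulAut.mul_apply,
    hρ k hk, ← hq, key, hq, ← MulAut.mul_apply, ← map_mul, mul_inv_cancel, map_one,
    MulAut.one_apply]

theorem U_kill (hρ : ∀ i ≤ m, ρ (P.s i) = art i) {u : G} (hu : u ∈ P.U) :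
    ∀ x, kill (m + 1) (ρ u x) = kill (m + 1) x := by
  induction hu using Subgroup.closure_induction with
  | mem x hx => obtain ⟨k, hk, rfl⟩ := hx; exact P.A_kill ρ hρ k hk
  | one => simp
  | mul x y _ _ hx hy => intro z; rw [map_mul, MulAut.mul_apply, hx, hy]
  | inv x _ hx =>
    intro z
    rw [← hx, ← MulAut.mul_apply, ← map_mul, mul_inv_cancel, map_one, MulAut.one_apply]

theorem H_top (hρ : ∀ i ≤ m, ρ (P.s i) = art i) {h : G} (hh : h ∈ P.H) :
    ρ h (of (m + 1)) = of (m + 1) := by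
  induction hh using Subgroup.closure_induction with
  | mem x hx =>
    obtain ⟨k, hk, rfl⟩ := hx
    have hk : k < m := hk
    rw [hρ k (by omega), art_ne _ _ (by omega) (by omega)]
  | one => simp
  | mul x y _ _ hx hy => rw [map_mul, MulAut.mul_apply, hy, hx]
  | inv x _ hx =>
    conv_lhs => rw [← hx]
    rw [← MulAut.mul_apply, ← map_mul, inv_mul_cancel, map_one, MulAut.one_apply]

theorem H_kill (hρ : ∀ i ≤ m, ρ (P.s i) = art i) {h : G} (hh : h ∈ P.H) :
    ∀ x, kill (m + 1) (ρ h x) = ρ h (kill (m + 1) x) := by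
  induction hh using Subgroup.closure_induction with
  | mem x hx =>
    obtain ⟨k, hk, rfl⟩ := hx
    have hk : k < m := hk
    rw [hρ k (by omega)]
    intro y
    have : (kill (m + 1)).comp (art k).toMonoidHom =
        (art k).toMonoidHom.comp (kill (m + 1)) := by
      apply FreeGroup.ext_hom
      intro i
      change kill (m + 1) (art k (of i)) = art k (kill (m + 1) (of i))
      rcases eq_or_ne i (m + 1) with rfl | h0
      · rw [art_ne _ _ (by omega) (by omega), kill_self, map_one]
      rw [kill_ne _ _ h0]
      rcases eq_or_ne i k with rfl | h1
      · rw [art_self, kill_ne _ _ (by omega)]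
      rcases eq_or_ne i (k + 1) with rfl | h2
      · simp [art_succ, kill_ne (m + 1) k (by omega), kill_ne (m + 1) (k + 1) h0]
      rw [art_ne _ _ h1 h2, kill_ne _ _ h0]
    exact DFunLike.congr_fun this y
  | one => simp
  | mul x y _ _ hx hy => intro z; rw [map_mul, MulAut.mul_apply, hx, hy]; rfl
  | inv x _ hx =>
    intro z
    apply (ρ x).injective
    rw [← hx, ← MulAut.mul_apply, ← MulAut.mul_apply, ← map_mul, mul_inv_cancel, map_one,
      MulAut.one_apply, MulAut.one_apply]

theorem U_push (hρ : ∀ i ≤ m, ρ (P.s i) = art i) {u : G} (hu : u ∈ P.U) :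
    ∃ v, ρ u (of (m + 1)) = v * of (m + 1) * v⁻¹ ∧
      FreeGroup.lift P.A (kill (m + 1) v) = u⁻¹ := by
  induction hu using Subgroup.closure_induction with
  | mem x hx =>
    obtain ⟨k, hk, rfl⟩ := hx
    have hk : k ≤ m := hk
    refine ⟨_, P.A_top ρ hρ k hk, ?_⟩
    rw [map_mul, map_inv, map_inv, kill_self, kill_ne _ _ (by omega)]
    simp
  | one => exact ⟨1, by simp⟩
  | mul x y hx' hy' hx hy =>
    obtain ⟨v, hv, hv'⟩ := hx
    obtain ⟨w, hw, hw'⟩ := hy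
    refine ⟨ρ x w * v, ?_, ?_⟩
    · rw [map_mul, MulAut.mul_apply, hw, map_mul, map_mul, map_inv, hv]
      group
    · rw [map_mul, map_mul, P.U_kill ρ hρ hx', hv', hw', mul_inv_rev]
  | inv x hx' hx =>
    obtain ⟨v, hv, hv'⟩ := hx
    refine ⟨(ρ x⁻¹ v)⁻¹, ?_, ?_⟩
    · apply (ρ x).injective
      have e : ∀ z, ρ x (ρ x⁻¹ z) = z := fun z => by
        rw [← MulAut.mul_apply, ← map_mul, mul_inv_cancel, map_one, MulAut.one_apply]
      rw [e, inv_inv, map_mul, map_mul, map_inv, e, hv]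
      group
    · rw [map_inv, map_inv, P.U_kill ρ hρ (inv_mem hx'), hv']

theorem faithful_step (hρ : ∀ i ≤ m, ρ (P.s i) = art i)
    (ih : ∀ h ∈ P.H, ρ h = 1 → h = 1) {g : G}
    (hg : g ∈ Subgroup.closure (P.s '' {k | k < m + 1})) (h1 : ρ g = 1) : g = 1 := by
  obtain ⟨u, hu, h, hh, k, hk, rfl⟩ := P.comb hg
  have act : ∀ x, ρ u (ρ h (ρ (P.c k) x)) = x := by
    intro x
    have := DFunLike.congr_fun h1 x
    rwa [map_mul, map_mul] at this
  have hkm : k = m + 1 := by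
    by_contra hne
    have e := congrArg (kill (m + 1)) (act (of k))
    rw [P.U_kill ρ hρ hu, P.H_kill ρ hρ hh, P.c_self ρ hρ k hk, kill_self, map_one,
      kill_ne _ _ hne] at e
    exact FreeGroup.one_ne_of _ e
  subst hkm
  simp only [P.c_top, map_one, MulAut.one_apply, mul_one] at act ⊢
  have hh1 : h = 1 := by
    apply ih h hh
    apply aut_ext
    intro i
    rcases eq_or_ne i (m + 1) with rfl | hi
    · rw [P.H_top ρ hρ hh]; rfl
    · have e := congrArg (kill (m + 1)) (act (of i))
      rw [P.U_kill ρ hρ hu, P.H_kill ρ hρ hh, kill_ne _ _ hi] at e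
      exact e
  subst hh1
  simp only [map_one, MulAut.one_apply, mul_one] at act ⊢
  obtain ⟨v, hv, hv'⟩ := P.U_push ρ hρ hu
  rw [act] at hv
  rw [kill_of_commute _ _ hv.symm, map_one] at hv'
  exact inv_eq_one.mp hv'.symm

end action

end Setup

/-- Faithfulness of the Artin action. -/
theorem faithful {G : Type} [Group G] (M : ℕ) (s : ℕ → G)
    (hcomm : ∀ i j, i + 1 < j → j < M → s i * s j = s j * s i)
    (hbr : ∀ i, i + 1 < M → s i * s (i + 1) * s i = s (i + 1) * s i * s (i + 1))
    (ρ : G →* MulAut (FreeGroup ℕ)) (hρ : ∀ i < M, ρ (s i) = art i) (m : ℕ) (hm : m ≤ M) :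
    ∀ g ∈ Subgroup.closure (s '' {k | k < m}), ρ g = 1 → g = 1 := by
  induction m with
  | zero => intro g hg _; simpa using hg
  | succ m ih =>
    intro g hg h1
    let d : ℕ → G := fun n => Nat.rec 1 (fun i x => x * s (m - i)) n
    let P : Setup G m :=
      { s := s
        c := fun k => d (m + 1 - k)
        comm := fun i j h h' => hcomm i j h (by omega)
        braid := fun i h => hbr i (by omega)
        c_top := by simp [d]
        c_step := fun k hk => by
          have e : m + 1 - k = (m - k) + 1 := by omega
          have e' : m + 1 - (k + 1) = m - k := by omega
          rw [e, e']
          change d (m - k) * s (m - (m - k)) = _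
          rw [Nat.sub_sub_self hk] }
    exact P.faithful_step ρ (fun i hi => hρ i (by omega)) (ih (by omega)) hg h1

end BraidRF

/-- The braid group `Bₙ` is residually finite. -/
theorem braidGroup_residuallyFinite (n : ℕ) (β : BraidGroup n) (hβ : β ≠ 1) :
    ∃ (H : Type) (_ : Group H) (_ : Finite H) (φ : BraidGroup n →* H), φ β ≠ 1 := by
  classical
  have hrel : ∀ r ∈ braidRels n,
      FreeGroup.lift (fun i : Fin (n - 1) => BraidRF.art (i : ℕ)) r = 1 := by
    rintro r (⟨i, j, hij, rfl⟩ | ⟨i, j, hij, rfl⟩)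
    · rw [map_mul, map_inv, mul_inv_eq_one]
      simpa using BraidRF.art_comm i j hij
    · rw [map_mul, map_inv, mul_inv_eq_one]
      simpa [hij] using BraidRF.art_braid i
  let ρ : BraidGroup n →* MulAut (FreeGroup ℕ) := PresentedGroup.toGroup hrel
  have hρof : ∀ i : Fin (n - 1), ρ (PresentedGroup.of i) = BraidRF.art (i : ℕ) :=
    fun i => PresentedGroup.toGroup.of hrel
  let s : ℕ → BraidGroup n := fun i => if h : i < n - 1 then PresentedGroup.of ⟨i, h⟩ else 1
  have hs : ∀ i (h : i < n - 1), s i = PresentedGroup.of ⟨i, h⟩ := fun i h => dif_pos h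
  have hcl : ∀ g : BraidGroup n, g ∈ Subgroup.closure (s '' {k | k < n - 1}) := by
    intro g
    have h1 : g ∈ Subgroup.closure (Set.range (PresentedGroup.of (rels := braidRels n))) := by
      rw [PresentedGroup.closure_range_of]; trivial
    refine Subgroup.closure_mono ?_ h1
    rintro _ ⟨i, rfl⟩
    exact ⟨i, i.2, hs i i.2⟩
  have hρs : ∀ i < n - 1, ρ (s i) = BraidRF.art i := fun i hi => by rw [hs i hi, hρof]
  apply BraidRF.separate n ρ
  · intro g i hi
    induction hcl g using Subgroup.closure_induction with
    | mem x hx =>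
      obtain ⟨k, hk, rfl⟩ := hx
      have hk : k < n - 1 := hk
      rw [hρs k hk, BraidRF.art_ne _ _ (by omega) (by omega)]
    | one => simp
    | mul x y _ _ hx hy => rw [map_mul, MulAut.mul_apply, hy, hx]
    | inv x _ hx =>
      conv_lhs => rw [← hx]
      rw [← MulAut.mul_apply, ← map_mul, inv_mul_cancel, map_one, MulAut.one_apply]
  · intro h
    refine hβ (BraidRF.faithful (n - 1) s ?_ ?_ ρ hρs (n - 1) le_rfl β (hcl β) h)
    · intro i j hij hj
      rw [hs i (by omega), hs j hj]
      have : PresentedGroup.mk (braidRels n) _ = 1 :=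
        PresentedGroup.one_of_mem (Or.inl ⟨⟨i, by omega⟩, ⟨j, hj⟩, hij, rfl⟩)
      rw [map_mul, map_inv, mul_inv_eq_one, map_mul, map_mul] at this
      exact this
    · intro i hi
      rw [hs i (by omega), hs (i + 1) hi]
      have : PresentedGroup.mk (braidRels n) _ = 1 :=
        PresentedGroup.one_of_mem (Or.inr ⟨⟨i, by omega⟩, ⟨i + 1, hi⟩, rfl, rfl⟩)
      rw [map_mul, map_inv, mul_inv_eq_one, map_mul, map_mul, map_mul, map_mul] at this
      exact this
end
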